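/- (Main theorem: exponential decay of fluctuations) Let Γ be a group of polynomial growth and (α,β) ⊂ (0,∞) a nonempty interval with 0 < α < β. Then there exist constants c₁ > 0 and c₂ ∈ (0,1), depending only on Γ, α, β, such that for every probability space (X,ℬ,μ), every measure-preserving action of Γ on X, every measurable f ≥ 0 on X, and every N ≥ 1: μ({x ∈ X : the sequence ( (1/|B(k)|) Σ_{g∈B(k)} f(g·x) )_{k≥1} fluctuates at least N times across (α,β)}) < c₁ c₂^N. -/

import Mathlib

open Filter MeasureTheory Function Set
open scoped BigOperators

variable {Γ : Type*} [Group Γ]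

/-- The word norm associated to a finite generating set `S`:
the infimum of `Σ |pᵢ|` over all representations `γ = s₁^{p₁} ⋯ s_l^{p_l}` with `sᵢ ∈ S`. -/
noncomputable def wordNorm (S : Finset Γ) (γ : Γ) : ℕ :=
  sInf {n | ∃ l : List (Γ × ℤ), (∀ p ∈ l, p.1 ∈ S) ∧
    (l.map fun p => p.1 ^ p.2).prod = γ ∧ (l.map fun p => p.2.natAbs).sum = n}

/-- Closed ball of radius `r` around `x` for the right word metric `d_R(x,y) = ‖x y⁻¹‖`. -/
def wordBall (S : Finset Γ) (x : Γ) (r : ℝ) : Set Γ :=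
  {y | (wordNorm S (x * y⁻¹) : ℝ) ≤ r}

/-- A sequence `(a k)_{k ≥ 1}` fluctuates at least `N` times across `(α,β)`: there are
indices `i₀ < i₁ < … < i_N` with `a (i j) < α` for odd `j` and `a (i j) > β` for even `j`. -/
def Fluct (a : ℕ → ℝ) (α β : ℝ) (N : ℕ) : Prop :=
  ∃ i : Fin (N + 1) → ℕ, StrictMono i ∧ (∀ j, 1 ≤ i j) ∧
    ∀ j : Fin (N + 1), (Odd (j : ℕ) → a (i j) < α) ∧ (Even (j : ℕ) → β < a (i j))

namespace PolyGrowth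

open scoped Pointwise

/-- Every finite subset of `G` grows polynomially of degree at most `d`. -/
def PG (d : ℕ) (G : Type*) [Group G] : Prop :=
  ∀ A : Set G, A.Finite → ∃ C : ℝ, ∀ n : ℕ, ((A ^ n).ncard : ℝ) ≤ C * ((n : ℝ) + 1) ^ d

theorem PG.of_injective {G H : Type*} [Group G] [Group H] {d : ℕ} (h : PG d G) (f : H →* G)
    (hf : Injective f) : PG d H := by
  intro A hA
  obtain ⟨C, hC⟩ := h (f '' A) (hA.image f)
  refine ⟨C, fun n => ?_⟩
  rw [← Set.ncard_image_of_injective _ hf, Set.image_pow]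
  exact hC n

theorem finite_pow {G : Type*} [Monoid G] {A : Set G} (hA : A.Finite) (n : ℕ) :
    (A ^ n).Finite := by
  induction n with
  | zero => simp
  | succ n ih => rw [pow_succ]; exact ih.mul hA

/-- Law of the `n`-step random walk with steps in `T`, started at the identity. -/
noncomputable def walk {G : Type*} [Group G] (T : Finset G) : ℕ → G → ℝ
  | 0 => Set.indicator {1} 1
  | n + 1 => fun x => (∑ s ∈ T, walk T n (s * x)) / T.card

section Walk
variable {G : Type*} [Group G] {T : Finset G}

theorem walk_nonneg (n : ℕ) (x : G) : 0 ≤ walk T n x := by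
  induction n generalizing x with
  | zero => exact Set.indicator_nonneg (by simp) _
  | succ n ih =>
    simp only [walk]
    exact div_nonneg (Finset.sum_nonneg fun s _ => ih _) (by positivity)

theorem walk_support (hinv : ∀ s ∈ T, s⁻¹ ∈ T) (n : ℕ) (x : G) (hx : walk T n x ≠ 0) :
    x ∈ (T : Set G) ^ n := by
  induction n generalizing x with
  | zero => simpa [walk] using hx
  | succ n ih =>
    simp only [walk] at hx
    have : ∑ s ∈ T, walk T n (s * x) ≠ 0 := fun h => hx (by rw [h, zero_div])
    obtain ⟨s, hs, hsx⟩ := Finset.exists_ne_zero_of_sum_ne_zero this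
    rw [pow_succ']
    exact ⟨s⁻¹, hinv s hs, s * x, ih _ hsx, by simp⟩

theorem walk_support_finite (hinv : ∀ s ∈ T, s⁻¹ ∈ T) (n : ℕ) :
    (support (walk T n)).Finite :=
  (finite_pow T.finite_toSet n).subset fun x hx => walk_support hinv n x hx

theorem walk_translate_support (hinv : ∀ s ∈ T, s⁻¹ ∈ T) (n : ℕ) (s : G) :
    (support fun x => walk T n (s * x)).Finite :=
  (walk_support_finite hinv n).preimage (mul_right_injective s).injOn

theorem summable_of_support {ι : Type*} {f g : ι → ℝ} (hf : (support f).Finite)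
    (h : ∀ x, f x = 0 → g x = 0) : Summable g :=
  summable_of_hasFiniteSupport (hf.subset fun x hx hfx => hx (h x hfx))

/-- Expectation of `φ` at time `n`. -/
noncomputable def walkE (T : Finset G) (n : ℕ) (φ : G → ℝ) : ℝ := ∑' x, walk T n x * φ x

theorem walkE_summable (hinv : ∀ s ∈ T, s⁻¹ ∈ T) (n : ℕ) (φ : G → ℝ) :
    Summable fun x => walk T n x * φ x :=
  summable_of_support (walk_support_finite hinv n) fun x hx => by simp [hx]

theorem walkE_summable_translate (hinv : ∀ s ∈ T, s⁻¹ ∈ T) (n : ℕ) (φ : G → ℝ) (s : G) :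
    Summable fun x => walk T n (s * x) * φ x :=
  summable_of_support (walk_translate_support hinv n s) fun x hx => by simp [hx]

theorem walkE_translate (n : ℕ) (φ : G → ℝ) (s : G) :
    ∑' x, walk T n (s * x) * φ x = walkE T n fun x => φ (s⁻¹ * x) := by
  rw [walkE, ← (Equiv.mulLeft s).tsum_eq fun x => walk T n x * φ (s⁻¹ * x)]
  simp

theorem walkE_zero (φ : G → ℝ) : walkE T 0 φ = φ 1 := by
  rw [walkE, tsum_eq_single 1]
  · simp [walk]
  · intro x hx
    simp [walk, hx]

theorem walkE_add (hinv : ∀ s ∈ T, s⁻¹ ∈ T) (n : ℕ) (φ ψ : G → ℝ) :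
    walkE T n (fun x => φ x + ψ x) = walkE T n φ + walkE T n ψ := by
  simp only [walkE, mul_add]
  exact (walkE_summable hinv n φ).tsum_add (walkE_summable hinv n ψ)

theorem walkE_sub (hinv : ∀ s ∈ T, s⁻¹ ∈ T) (n : ℕ) (φ ψ : G → ℝ) :
    walkE T n (fun x => φ x - ψ x) = walkE T n φ - walkE T n ψ := by
  simp only [walkE, mul_sub]
  exact (walkE_summable hinv n φ).tsum_sub (walkE_summable hinv n ψ)

theorem walkE_smul (n : ℕ) (c : ℝ) (φ : G → ℝ) :
    walkE T n (fun x => c * φ x) = c * walkE T n φ := by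
  simp only [walkE, mul_left_comm, tsum_mul_left]

theorem walkE_sum (hinv : ∀ s ∈ T, s⁻¹ ∈ T) {ι : Type*} (n : ℕ) (J : Finset ι) (φ : ι → G → ℝ) :
    walkE T n (fun x => ∑ i ∈ J, φ i x) = ∑ i ∈ J, walkE T n (φ i) := by
  simp only [walkE, Finset.mul_sum]
  exact Summable.tsum_finsetSum fun i _ => walkE_summable hinv n _

theorem walkE_mono (hinv : ∀ s ∈ T, s⁻¹ ∈ T) (n : ℕ) {φ ψ : G → ℝ} (h : ∀ x, φ x ≤ ψ x) :
    walkE T n φ ≤ walkE T n ψ :=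
  (walkE_summable hinv n φ).tsum_le_tsum
    (fun x => mul_le_mul_of_nonneg_left (h x) (walk_nonneg n x)) (walkE_summable hinv n ψ)

theorem walkE_succ_left (hinv : ∀ s ∈ T, s⁻¹ ∈ T) (n : ℕ) (φ : G → ℝ) :
    walkE T (n + 1) φ = (∑ s ∈ T, walkE T n fun x => φ (s⁻¹ * x)) / T.card := by
  simp only [← walkE_translate]
  rw [← Summable.tsum_finsetSum fun s _ => walkE_summable_translate hinv n φ s, ← tsum_div_const,
    walkE]
  refine tsum_congr fun x => ?_
  simp only [walk, Finset.sum_mul, Finset.sum_div]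
  exact Finset.sum_congr rfl fun s _ => by ring

theorem walkE_succ_left' (hinv : ∀ s ∈ T, s⁻¹ ∈ T) (n : ℕ) (φ : G → ℝ) :
    walkE T (n + 1) φ = (∑ s ∈ T, walkE T n fun x => φ (s * x)) / T.card := by
  rw [walkE_succ_left hinv]
  congr 1
  exact Finset.sum_nbij' (fun s => s⁻¹) (fun s => s⁻¹) (by simpa using hinv) (by simpa using hinv)
    (by simp) (by simp) (by simp)

theorem walkE_succ_right (hinv : ∀ s ∈ T, s⁻¹ ∈ T) (n : ℕ) (φ : G → ℝ) :
    walkE T (n + 1) φ = walkE T n fun x => (∑ s ∈ T, φ (x * s)) / T.card := by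
  induction n generalizing φ with
  | zero => simp [walkE_succ_left' hinv, walkE_zero]
  | succ n ih =>
    rw [walkE_succ_left' hinv, walkE_succ_left' hinv]
    congr 1
    exact Finset.sum_congr rfl fun s _ => by rw [ih]; simp [mul_assoc]

theorem walkE_const (hinv : ∀ s ∈ T, s⁻¹ ∈ T) (h1 : (1 : G) ∈ T) (n : ℕ) (c : ℝ) :
    walkE T n (fun _ => c) = c := by
  have hq : (T.card : ℝ) ≠ 0 := by
    have := Finset.card_pos.2 ⟨_, h1⟩
    positivity
  induction n with
  | zero => exact walkE_zero _
  | succ n ih => rw [walkE_succ_left hinv, ih]; simp; field_simp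

/-- Entropy of the walk at time `n`. -/
noncomputable def entropy (T : Finset G) (n : ℕ) : ℝ := ∑' x, Real.negMulLog (walk T n x)

theorem entropy_summable (hinv : ∀ s ∈ T, s⁻¹ ∈ T) (n : ℕ) :
    Summable fun x => Real.negMulLog (walk T n x) :=
  summable_of_support (walk_support_finite hinv n) fun x hx => by simp [hx]

theorem sq_sqrt_sub_le {a r : ℝ} (ha : 0 ≤ a) (hr : 0 ≤ r) (h : r = 0 → a = 0) :
    (√a - √r) ^ 2 ≤ -Real.negMulLog a - a * Real.log r - a + r := by
  rcases eq_or_lt_of_le hr with rfl | hr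
  · simp [h rfl]
  rcases eq_or_lt_of_le ha with rfl | ha
  · simp [hr.le]
  have h1 := Real.one_sub_inv_le_log_of_pos (show 0 < √a / √r by positivity)
  rw [Real.log_div (by positivity) (by positivity), Real.log_sqrt ha.le, Real.log_sqrt hr.le,
    inv_div] at h1
  have h2 : a * (1 - √r / √a) = a - √a * √r := by
    have : √a * √a = a := Real.mul_self_sqrt ha.le
    field_simp
    linear_combination √r * this
  have h3 := mul_le_mul_of_nonneg_left h1 ha.le
  rw [h2] at h3
  have e1 : √a ^ 2 = a := Real.sq_sqrt ha.le
  have e2 : √r ^ 2 = r := Real.sq_sqrt hr.le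
  simp only [Real.negMulLog]
  nlinarith

theorem sum_sq_sqrt_le (hinv : ∀ s ∈ T, s⁻¹ ∈ T) (h1 : (1 : G) ∈ T) (n : ℕ) :
    ∑ s ∈ T, ∑' x, (√(walk T n (s * x)) - √(walk T (n + 1) x)) ^ 2 ≤
      T.card * (entropy T (n + 1) - entropy T n) := by
  have hq : (0 : ℝ) < T.card := by exact_mod_cast Finset.card_pos.2 ⟨_, h1⟩
  have hsum : ∀ x, ∑ s ∈ T, walk T n (s * x) = T.card * walk T (n + 1) x := fun x => by
    simp only [walk]; field_simp
  have hz : ∀ s ∈ T, ∀ x, walk T (n + 1) x = 0 → walk T n (s * x) = 0 := fun s hs x hx =>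
    (Finset.sum_eq_zero_iff_of_nonneg (f := fun s => walk T n (s * x))
      fun s _ => walk_nonneg n _).1 (by rw [hsum, hx, mul_zero]) s hs
  have hS := fun s (hs : s ∈ T) => summable_of_support (walk_support_finite hinv (n + 1))
    (g := fun x => (√(walk T n (s * x)) - √(walk T (n + 1) x)) ^ 2)
    fun x hx => by simp [hx, hz s hs x hx]
  have hE : ∀ s, Summable fun x => Real.negMulLog (walk T n (s * x)) := fun s =>
    (Equiv.mulLeft s).summable_iff.2 (entropy_summable hinv n)
  have hE' : ∀ s, ∑' x, Real.negMulLog (walk T n (s * x)) = entropy T n := fun s =>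
    (Equiv.mulLeft s).tsum_eq fun x => Real.negMulLog (walk T n x)
  have hR : T.card * (entropy T (n + 1) - entropy T n) =
      ∑' x, (T.card * Real.negMulLog (walk T (n + 1) x) -
        ∑ s ∈ T, Real.negMulLog (walk T n (s * x))) := by
    rw [Summable.tsum_sub ((entropy_summable hinv _).mul_left _) (summable_sum fun s _ => hE s),
      tsum_mul_left, Summable.tsum_finsetSum fun s _ => hE s]
    simp only [hE', Finset.sum_const, nsmul_eq_mul, entropy]
    ring
  rw [← Summable.tsum_finsetSum hS, hR]
  refine (summable_sum hS).tsum_le_tsum (fun x => ?_)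
    (((entropy_summable hinv _).mul_left _).sub (summable_sum fun s _ => hE s))
  calc ∑ s ∈ T, (√(walk T n (s * x)) - √(walk T (n + 1) x)) ^ 2
      ≤ ∑ s ∈ T, (-Real.negMulLog (walk T n (s * x)) -
          walk T n (s * x) * Real.log (walk T (n + 1) x) - walk T n (s * x) +
            walk T (n + 1) x) :=
        Finset.sum_le_sum fun s hs =>
          sq_sqrt_sub_le (walk_nonneg n _) (walk_nonneg _ _) (hz s hs x)
    _ = _ := by
      simp only [Finset.sum_add_distrib, Finset.sum_sub_distrib, ← Finset.sum_mul, hsum,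
        Finset.sum_neg_distrib, Finset.sum_const, nsmul_eq_mul, Real.negMulLog]
      ring

theorem entropy_le_log (hinv : ∀ s ∈ T, s⁻¹ ∈ T) (h1 : (1 : G) ∈ T) (n : ℕ) :
    entropy T n ≤ Real.log (((T : Set G) ^ n).ncard) := by
  have hfin : ((T : Set G) ^ n).Finite := finite_pow T.finite_toSet _
  have hne : ((T : Set G) ^ n).Nonempty := ⟨1, by simpa using Set.pow_mem_pow (n := n) h1⟩
  set B := hfin.toFinset
  have hcard : ((T : Set G) ^ n).ncard = B.card := Set.ncard_eq_toFinset_card _ hfin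
  have hB : (0 : ℝ) < B.card := by
    exact_mod_cast Finset.card_pos.2 ((Set.Finite.toFinset_nonempty hfin).2 hne)
  have hout : ∀ x, x ∉ B → walk T n x = 0 := fun x hx => by
    by_contra h
    exact hx (hfin.mem_toFinset.2 (walk_support hinv n x h))
  have hone : ∑ x ∈ B, walk T n x = 1 := by
    have := walkE_const hinv h1 n 1
    rwa [walkE, tsum_eq_sum (s := B) fun x hx => by simp [hout x hx],
      Finset.sum_congr rfl fun x _ => mul_one _] at this
  rw [entropy, tsum_eq_sum (s := B) fun x hx => by simp [hout x hx], hcard]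
  have : ∀ x ∈ B, Real.negMulLog (walk T n x) ≤
      walk T n x * Real.log B.card + (B.card : ℝ)⁻¹ - walk T n x := by
    intro x _
    rcases eq_or_lt_of_le (walk_nonneg (T := T) n x) with h | h
    · rw [← h]; simp
    have := Real.log_le_sub_one_of_pos (show 0 < ((B.card : ℝ) * walk T n x)⁻¹ by positivity)
    rw [Real.log_inv, Real.log_mul hB.ne' h.ne'] at this
    have h3 := mul_le_mul_of_nonneg_left this h.le
    have h4 : walk T n x * (((B.card : ℝ) * walk T n x)⁻¹ - 1) = (B.card : ℝ)⁻¹ - walk T n x := by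
      field_simp
    rw [h4] at h3
    simp only [Real.negMulLog]
    linarith
  refine (Finset.sum_le_sum this).trans (le_of_eq ?_)
  rw [Finset.sum_sub_distrib, Finset.sum_add_distrib, ← Finset.sum_mul, hone]
  simp [hB.ne']

/-- The basic comparison between the walk and its translate. -/
theorem sq_walk_diff_le (hinv : ∀ s ∈ T, s⁻¹ ∈ T) (h1 : (1 : G) ∈ T) (n : ℕ) (φ : G → ℝ)
    {s : G} (hs : s ∈ T) :
    (walkE T n (fun x => φ (s⁻¹ * x)) - walkE T (n + 1) φ) ^ 2 ≤
      2 * T.card * (T.card + 1) * (entropy T (n + 1) - entropy T n) *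
        walkE T (n + 1) fun x => φ x ^ 2 := by
  have hq : (0 : ℝ) < T.card := by exact_mod_cast Finset.card_pos.2 ⟨_, h1⟩
  have hle : ∀ x, walk T n (s * x) ≤ T.card * walk T (n + 1) x := fun x => by
    have : T.card * walk T (n + 1) x = ∑ s ∈ T, walk T n (s * x) := by
      simp only [walk]; field_simp
    rw [this]
    exact Finset.single_le_sum (f := fun s => walk T n (s * x)) (fun s _ => walk_nonneg n _) hs
  have hz : ∀ s ∈ T, ∀ x, walk T (n + 1) x = 0 → walk T n (s * x) = 0 := fun s hs x hx => by
    have : ∑ s ∈ T, walk T n (s * x) = 0 := by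
      simp only [walk] at hx
      simpa [hq.ne'] using hx
    exact (Finset.sum_eq_zero_iff_of_nonneg fun s _ => walk_nonneg n _).1 this s hs
  set B := (walk_support_finite hinv (n + 1)).toFinset
  have hout : ∀ x, x ∉ B → walk T (n + 1) x = 0 := fun x hx => by simpa [B] using hx
  have hout' : ∀ s ∈ T, ∀ x, x ∉ B → walk T n (s * x) = 0 := fun s hs x hx =>
    hz s hs x (hout x hx)
  have hmain := sum_sq_sqrt_le hinv h1 n
  have hone : ∑ x ∈ B, (√(walk T n (s * x)) - √(walk T (n + 1) x)) ^ 2 ≤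
      T.card * (entropy T (n + 1) - entropy T n) := by
    refine le_trans ?_ hmain
    rw [← tsum_eq_sum (L := .unconditional G)
      (f := fun x => (√(walk T n (s * x)) - √(walk T (n + 1) x)) ^ 2) fun x hx => by simp [hout x hx, hout' s hs x hx]]
    exact Finset.single_le_sum
      (f := fun s => ∑' x, (√(walk T n (s * x)) - √(walk T (n + 1) x)) ^ 2)
      (fun s _ => tsum_nonneg fun x => sq_nonneg _) hs
  rw [← walkE_translate, tsum_eq_sum (s := B) fun x hx => by simp [hout' s hs x hx], walkE, walkE,
    tsum_eq_sum (s := B) fun x hx => by simp [hout x hx],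
    tsum_eq_sum (s := B) fun x hx => by simp [hout x hx], ← Finset.sum_sub_distrib]
  have heq : ∀ x ∈ B, walk T n (s * x) * φ x - walk T (n + 1) x * φ x =
      (√(walk T n (s * x)) - √(walk T (n + 1) x)) *
        ((√(walk T n (s * x)) + √(walk T (n + 1) x)) * φ x) := fun x _ => by
    have e1 := Real.sq_sqrt (walk_nonneg (T := T) n (s * x))
    have e2 := Real.sq_sqrt (walk_nonneg (T := T) (n + 1) x)
    linear_combination (-φ x) * e1 + φ x * e2
  rw [Finset.sum_congr rfl heq]
  refine (Finset.sum_mul_sq_le_sq_mul_sq _ _ _).trans ?_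
  have h2 : ∑ x ∈ B, ((√(walk T n (s * x)) + √(walk T (n + 1) x)) * φ x) ^ 2 ≤
      2 * (T.card + 1) * ∑ x ∈ B, walk T (n + 1) x * φ x ^ 2 := by
    rw [Finset.mul_sum]
    refine Finset.sum_le_sum fun x _ => ?_
    have e1 := Real.sq_sqrt (walk_nonneg (T := T) n (s * x))
    have e2 := Real.sq_sqrt (walk_nonneg (T := T) (n + 1) x)
    have e3 := hle x
    have : (√(walk T n (s * x)) + √(walk T (n + 1) x)) ^ 2 ≤
        2 * (T.card + 1) * walk T (n + 1) x := by
      nlinarith [sq_nonneg (√(walk T n (s * x)) - √(walk T (n + 1) x))]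
    rw [mul_pow]
    nlinarith [mul_le_mul_of_nonneg_right this (sq_nonneg (φ x))]
  have h0 : 0 ≤ ∑ x ∈ B, (√(walk T n (s * x)) - √(walk T (n + 1) x)) ^ 2 :=
    Finset.sum_nonneg fun x _ => sq_nonneg _
  calc _ ≤ (T.card * (entropy T (n + 1) - entropy T n)) *
        (2 * (T.card + 1) * ∑ x ∈ B, walk T (n + 1) x * φ x ^ 2) :=
        mul_le_mul hone h2 (Finset.sum_nonneg fun x _ => sq_nonneg _) (h0.trans hone)
    _ = _ := by ring

theorem entropy_mono (hinv : ∀ s ∈ T, s⁻¹ ∈ T) (h1 : (1 : G) ∈ T) (n : ℕ) :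
    entropy T n ≤ entropy T (n + 1) := by
  have hq : (0 : ℝ) < T.card := by exact_mod_cast Finset.card_pos.2 ⟨_, h1⟩
  have h := (Finset.sum_nonneg fun s _ => tsum_nonneg fun x => sq_nonneg _).trans
    (sum_sq_sqrt_le hinv h1 n)
  have := nonneg_of_mul_nonneg_right h hq
  linarith

theorem entropy_zero : entropy T 0 = 0 := by
  rw [entropy, tsum_eq_single 1]
  · simp [walk]
  · intro x hx
    simp [walk, hx]

/-- Times at which the entropy increment is at most harmonic. -/
theorem exists_good_time {d : ℕ} (hG : PG d G) (hinv : ∀ s ∈ T, s⁻¹ ∈ T) (h1 : (1 : G) ∈ T)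
    (n₀ : ℕ) : ∃ n, n₀ ≤ n ∧ entropy T (n + 1) - entropy T n ≤ (d + 1) / (n + 1) := by
  by_contra! hcon
  obtain ⟨C, hC⟩ := hG T T.finite_toSet
  have hlow : ∀ k : ℕ, (d + 1) * (Real.log (n₀ + k + 1) - Real.log (n₀ + 1)) ≤
      entropy T (n₀ + k) - entropy T n₀ := by
    intro k
    induction k with
    | zero => simp
    | succ k ih =>
      have h2 := hcon (n₀ + k) (by omega)
      have hp : (0 : ℝ) < n₀ + k + 1 := by positivity
      have h3 := Real.log_le_sub_one_of_pos (show 0 < ((n₀ + k + 1 + 1 : ℝ) / (n₀ + k + 1)) by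
        positivity)
      rw [Real.log_div (by positivity) hp.ne'] at h3
      have h4 : ((n₀ + k + 1 + 1 : ℝ) / (n₀ + k + 1)) - 1 = 1 / (n₀ + k + 1) := by
        field_simp; ring
      rw [h4] at h3
      have h5 : ((d : ℝ) + 1) * (Real.log (n₀ + k + 1 + 1) - Real.log (n₀ + k + 1)) ≤
          (d + 1) / (n₀ + k + 1) := by
        rw [div_eq_mul_one_div]
        exact mul_le_mul_of_nonneg_left h3 (by positivity)
      push_cast at h2 ⊢
      rw [← add_assoc, ← add_assoc]
      linarith
  have hup : ∀ k : ℕ, Real.log (n₀ + k + 1) ≤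
      Real.log C + (d + 1) * Real.log (n₀ + 1) - entropy T n₀ := by
    intro k
    have h2 := hlow k
    have h3 := entropy_le_log hinv h1 (n₀ + k)
    have h4 := hC (n₀ + k)
    have hpos : (0 : ℝ) < ((T : Set G) ^ (n₀ + k)).ncard := by
      have hfin : ((T : Set G) ^ (n₀ + k)).Finite := finite_pow T.finite_toSet _
      exact_mod_cast (Set.ncard_pos hfin).2 ⟨1, by simpa using Set.pow_mem_pow (n := n₀ + k) h1⟩
    have h5 := Real.log_le_log hpos h4
    have hp : (0 : ℝ) < (n₀ + k : ℕ) + 1 := by positivity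
    have hCp : 0 < C := by
      by_contra h
      have : C * ((n₀ + k : ℕ) + 1 : ℝ) ^ d ≤ 0 :=
        mul_nonpos_of_nonpos_of_nonneg (not_lt.1 h) (by positivity)
      linarith
    rw [Real.log_mul hCp.ne' (by positivity), Real.log_pow] at h5
    push_cast at *
    linarith
  set M := Real.log C + (d + 1) * Real.log (n₀ + 1) - entropy T n₀
  obtain ⟨k, hk⟩ := exists_nat_gt (Real.exp M)
  have := hup k
  rw [Real.log_le_iff_le_exp (by positivity)] at this
  have : (0 : ℝ) ≤ n₀ := by positivity
  linarith

end Walk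

/-- An isometric action on a real inner product space whose orthonormal families have bounded size
is given by orthogonal matrices. -/
theorem exists_orthogonal_rep {G V : Type*} [Group G] [AddCommGroup V] [Module ℝ V]
    (Q : InnerProductSpace.Core ℝ V) (N : ℕ)
    (hN : ∀ (m : ℕ) (u : Fin m → V), (∀ i j, Q.inner (u i) (u j) = if i = j then 1 else 0) → m ≤ N)
    (ρ : G →* Module.End ℝ V) (hρ : ∀ g u v, Q.inner (ρ g u) (ρ g v) = Q.inner u v) :
    ∃ (m : ℕ) (M : G →* Matrix.unitaryGroup (Fin m) ℝ), ∀ g, M g = 1 → ρ g = 1 := by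
  let _ : NormedAddCommGroup V := Q.toNormedAddCommGroup
  let _ : InnerProductSpace ℝ V := InnerProductSpace.ofCore Q.toCore
  have hfin : FiniteDimensional ℝ V := by
    have : Module.rank ℝ V ≤ N := rank_le fun s hs => by
      have h2 : LinearIndependent ℝ fun i : Fin s.card => ((s.equivFin.symm i : s) : V) :=
        hs.comp _ s.equivFin.symm.injective
      have h3 := InnerProductSpace.gramSchmidtNormed_orthonormal (𝕜 := ℝ) h2
      exact hN s.card _ (orthonormal_iff_ite.1 h3)
    exact Module.rank_lt_aleph0_iff.1 (this.trans_lt (Cardinal.natCast_lt_aleph0))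
  let b := stdOrthonormalBasis ℝ V
  have hadj : ∀ g (u v : V), inner ℝ u (ρ g v) = inner ℝ (ρ g⁻¹ u) v := fun g u v => by
    have h : inner ℝ (ρ g (ρ g⁻¹ u)) (ρ g v) = inner ℝ (ρ g⁻¹ u) v := hρ g (ρ g⁻¹ u) v
    rwa [← Module.End.mul_apply, ← map_mul, mul_inv_cancel, map_one, Module.End.one_apply] at h
  let A : G → Matrix (Fin _) (Fin _) ℝ := fun g => Matrix.of fun i j => inner ℝ (b i) (ρ g (b j))
  have hmul : ∀ g h, A (g * h) = A g * A h := fun g h => by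
    ext i j
    simp only [A, Matrix.mul_apply, Matrix.of_apply, map_mul, Module.End.mul_apply]
    rw [hadj, ← b.sum_inner_mul_inner]
    exact Finset.sum_congr rfl fun k _ => by rw [hadj g]
  have hone : A 1 = 1 := by
    ext i j
    simp [A, Matrix.one_apply, orthonormal_iff_ite.1 b.orthonormal]
  have hstar : ∀ g, star (A g) = A g⁻¹ := fun g => by
    ext i j
    simp only [A, Matrix.star_apply, Matrix.of_apply, star_trivial]
    rw [hadj, real_inner_comm]
  refine ⟨_, ⟨⟨fun g => ⟨A g, ?_⟩, Subtype.ext hone⟩, fun g h => Subtype.ext (hmul g h)⟩, ?_⟩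
  · rw [Matrix.mem_unitaryGroup_iff, hstar, ← hmul, mul_inv_cancel, hone]
  · intro g hg
    have hA : A g = 1 := congrArg Subtype.val hg
    refine b.toBasis.ext fun j => b.toBasis.ext_elem_iff.2 fun i => ?_
    have := congrFun (congrFun hA i) j
    simp only [A, Matrix.one_apply, Matrix.of_apply] at this
    simp only [OrthonormalBasis.coe_toBasis, OrthonormalBasis.coe_toBasis_repr_apply,
      OrthonormalBasis.repr_apply_apply, this, Module.End.one_apply]
    exact (orthonormal_iff_ite.1 b.orthonormal i j).symm

section Harmonic
variable {G : Type*} [Group G] {T : Finset G}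

/-- Harmonic functions for the right random walk with steps in `T`. -/
def Harm (T : Finset G) (u : G → ℝ) : Prop := ∀ x, (∑ s ∈ T, u (x * s)) / T.card = u x

/-- Carré du champ of the walk. -/
noncomputable def grad (T : Finset G) (u v : G → ℝ) (x : G) : ℝ :=
  (∑ s ∈ T, (u (x * s) - u x) * (v (x * s) - v x)) / T.card

theorem Harm.walkE_eq (hinv : ∀ s ∈ T, s⁻¹ ∈ T) {u : G → ℝ} (hu : Harm T u) (n : ℕ) (g : G) :
    walkE T n (fun x => u (g * x)) = u g := by
  induction n with
  | zero => simp [walkE_zero]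
  | succ n ih =>
    rw [walkE_succ_right hinv, ← ih]
    congr 1
    funext x
    simpa [mul_assoc] using hu (g * x)

theorem Harm.walkE_sq_eq (hinv : ∀ s ∈ T, s⁻¹ ∈ T) (h1 : (1 : G) ∈ T) {u : G → ℝ}
    (hu : Harm T u) (n : ℕ) (g : G) :
    walkE T n (fun x => (u (g * x) - u g) ^ 2) =
      ∑ k ∈ Finset.range n, walkE T k fun x => grad T u u (g * x) := by
  have hq : (T.card : ℝ) ≠ 0 := by
    have := Finset.card_pos.2 ⟨_, h1⟩
    positivity
  induction n with
  | zero => simp [walkE_zero]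
  | succ n ih =>
    rw [Finset.sum_range_succ, ← ih, walkE_succ_right hinv, ← walkE_add hinv]
    congr 1
    funext x
    have h := hu (g * x)
    rw [div_eq_iff hq] at h
    have h2 : ∑ s ∈ T, (u (g * x * s) - u (g * x)) = 0 := by
      rw [Finset.sum_sub_distrib, h]; simp [mul_comm]
    simp only [grad, ← mul_assoc]
    rw [div_eq_iff hq, add_mul, div_mul_cancel₀ _ hq]
    have h3 : ∀ s ∈ T, (u (g * x * s) - u g) ^ 2 = (u (g * x) - u g) ^ 2 +
        (u (g * x * s) - u (g * x)) * (u (g * x * s) - u (g * x)) +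
        2 * (u (g * x) - u g) * (u (g * x * s) - u (g * x)) := fun s _ => by ring
    rw [Finset.sum_congr rfl h3, Finset.sum_add_distrib, Finset.sum_add_distrib, ← Finset.mul_sum,
      h2]
    simp [mul_comm]

theorem Harm.sq_diff_le (hinv : ∀ s ∈ T, s⁻¹ ∈ T) (h1 : (1 : G) ∈ T) {u : G → ℝ}
    (hu : Harm T u) (n : ℕ) (g : G) {s : G} (hs : s ∈ T) :
    (u (g * s) - u g) ^ 2 ≤ 2 * T.card * (T.card + 1) * (entropy T (n + 1) - entropy T n) *
      ∑ k ∈ Finset.range (n + 1), walkE T k fun x => grad T u u (g * x) := by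
  have h := sq_walk_diff_le hinv h1 n (fun x => u (g * x) - u g) (hinv s hs)
  rw [hu.walkE_sq_eq hinv h1, inv_inv] at h
  rw [walkE_sub hinv, walkE_sub hinv, walkE_const hinv h1, walkE_const hinv h1,
    hu.walkE_eq hinv] at h
  have h2 := hu.walkE_eq hinv n (g * s)
  simp only [mul_assoc] at h2
  rw [h2] at h
  simpa using h

/-- Times at which the entropy increment is at most harmonic. -/
def goodTimes (T : Finset G) (d : ℕ) : Set ℕ :=
  {n | entropy T (n + 1) - entropy T n ≤ (d + 1) / (n + 1)}

/-- Cesàro averages of the expectations along the walk. -/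
noncomputable def cesaro (T : Finset G) (F : G → ℝ) (n : ℕ) : ℝ :=
  (∑ k ∈ Finset.range (n + 1), walkE T k F) / (n + 1)

theorem abs_walkE_le (hinv : ∀ s ∈ T, s⁻¹ ∈ T) (h1 : (1 : G) ∈ T) {F : G → ℝ} {M : ℝ}
    (hF : ∀ x, |F x| ≤ M) (n : ℕ) : |walkE T n F| ≤ M := by
  rw [abs_le]
  have h2 := walkE_mono hinv n (φ := F) (ψ := fun _ => M) fun x => (abs_le.1 (hF x)).2
  have h3 := walkE_mono hinv n (ψ := F) (φ := fun _ => -M) fun x => (abs_le.1 (hF x)).1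
  rw [walkE_const hinv h1] at h2 h3
  exact ⟨h3, h2⟩

theorem abs_cesaro_le (hinv : ∀ s ∈ T, s⁻¹ ∈ T) (h1 : (1 : G) ∈ T) {F : G → ℝ} {M : ℝ}
    (hF : ∀ x, |F x| ≤ M) (n : ℕ) : |cesaro T F n| ≤ M := by
  rw [cesaro, abs_div, abs_of_pos (by positivity : (0 : ℝ) < n + 1), div_le_iff₀ (by positivity)]
  refine (Finset.abs_sum_le_sum_abs _ _).trans ?_
  refine (Finset.sum_le_sum fun k _ => abs_walkE_le hinv h1 hF k).trans ?_
  simp [mul_comm]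

theorem cesaro_add (hinv : ∀ s ∈ T, s⁻¹ ∈ T) (F H : G → ℝ) (n : ℕ) :
    cesaro T (fun x => F x + H x) n = cesaro T F n + cesaro T H n := by
  simp only [cesaro, walkE_add hinv, Finset.sum_add_distrib, add_div]

theorem cesaro_smul (c : ℝ) (F : G → ℝ) (n : ℕ) :
    cesaro T (fun x => c * F x) n = c * cesaro T F n := by
  simp only [cesaro, walkE_smul, ← Finset.mul_sum, mul_div_assoc]

theorem cesaro_mono (hinv : ∀ s ∈ T, s⁻¹ ∈ T) {F H : G → ℝ} (h : ∀ x, F x ≤ H x) (n : ℕ) :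
    cesaro T F n ≤ cesaro T H n := by
  unfold cesaro
  gcongr
  exact walkE_mono hinv _ h

theorem entropy_div_tendsto {d : ℕ} (hG : PG d G) (hinv : ∀ s ∈ T, s⁻¹ ∈ T) (h1 : (1 : G) ∈ T) :
    Tendsto (fun n : ℕ => entropy T n / n) atTop (nhds 0) := by
  obtain ⟨C, hC⟩ := hG T T.finite_toSet
  have hup : ∀ n, entropy T n ≤ Real.log C + d * Real.log (n + 1) := by
    intro n
    have h3 := entropy_le_log hinv h1 n
    have h4 := hC n
    have hpos : (0 : ℝ) < ((T : Set G) ^ n).ncard := by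
      have hfin : ((T : Set G) ^ n).Finite := finite_pow T.finite_toSet _
      exact_mod_cast (Set.ncard_pos hfin).2 ⟨1, by simpa using Set.pow_mem_pow (n := n) h1⟩
    have h5 := Real.log_le_log hpos h4
    have hCp : 0 < C := by
      by_contra h
      have : C * ((n : ℝ) + 1) ^ d ≤ 0 :=
        mul_nonpos_of_nonpos_of_nonneg (not_lt.1 h) (by positivity)
      linarith
    rw [Real.log_mul hCp.ne' (by positivity), Real.log_pow] at h5
    linarith
  have h0 : ∀ n, 0 ≤ entropy T n := fun n => by
    have := monotone_nat_of_le_succ (entropy_mono hinv h1) (Nat.zero_le n)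
    rwa [entropy_zero] at this
  have hlog : Tendsto (fun n : ℕ => Real.log (n + 1) / (n + 1)) atTop (nhds 0) := by
    have := (Real.isLittleO_log_id_atTop.tendsto_div_nhds_zero).comp
      ((tendsto_natCast_atTop_atTop (R := ℝ)).comp (tendsto_add_atTop_nat 1))
    simpa [Function.comp_def] using this
  have h1' : Tendsto (fun n : ℕ => ((n : ℝ) + 1) / n) atTop (nhds 1) := by
    have := (tendsto_const_nhds (x := (1 : ℝ))).add (tendsto_one_div_atTop_nhds_zero_nat (𝕜 := ℝ))
    rw [add_zero] at this
    refine this.congr' ?_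
    filter_upwards [eventually_gt_atTop 0] with n hn
    have : (n : ℝ) ≠ 0 := by positivity
    field_simp
  have hlog2 : Tendsto (fun n : ℕ => Real.log (n + 1) / n) atTop (nhds 0) := by
    have := hlog.mul h1'
    rw [zero_mul] at this
    refine this.congr fun n => ?_
    field_simp
  have hfin : Tendsto (fun n : ℕ => Real.log C / n + d * (Real.log (n + 1) / n)) atTop
      (nhds 0) := by
    have := (tendsto_const_div_atTop_nhds_zero_nat (Real.log C)).add
      (hlog2.const_mul (d : ℝ))
    simpa using this
  refine squeeze_zero (fun n => div_nonneg (h0 n) (by positivity)) (fun n => ?_) hfin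
  rw [← mul_div_assoc, ← add_div]
  gcongr
  exact hup n

/-- Cesàro averages become invariant. -/
theorem cesaro_translate_tendsto {d : ℕ} (hG : PG d G) (hinv : ∀ s ∈ T, s⁻¹ ∈ T)
    (h1 : (1 : G) ∈ T) {F : G → ℝ} {M : ℝ} (hF : ∀ x, |F x| ≤ M) {s : G} (hs : s ∈ T) :
    Tendsto (fun n => cesaro T (fun x => F (s * x)) n - cesaro T F n) atTop (nhds 0) := by
  have hM : 0 ≤ M := (abs_nonneg _).trans (hF 1)
  set c : ℝ := 2 * T.card * (T.card + 1) with hc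
  have hc0 : 0 ≤ c := by positivity
  have hstep : ∀ (ε : ℝ), 0 < ε → ∀ k, |walkE T k (fun x => F (s * x)) - walkE T (k + 1) F| ≤
      ε + c * M ^ 2 / ε * (entropy T (k + 1) - entropy T k) := by
    intro ε hε k
    have h := sq_walk_diff_le hinv h1 k F (hinv s hs)
    rw [inv_inv] at h
    have hΔ : 0 ≤ entropy T (k + 1) - entropy T k := sub_nonneg.2 (entropy_mono hinv h1 k)
    have h2 : walkE T (k + 1) (fun x => F x ^ 2) ≤ M ^ 2 :=
      (le_abs_self _).trans (abs_walkE_le hinv h1 (fun x => by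
        rw [abs_pow]; exact pow_le_pow_left₀ (abs_nonneg _) (hF x) 2) _)
    have h3 := h.trans (mul_le_mul_of_nonneg_left h2 (by positivity))
    set y := walkE T k (fun x => F (s * x)) - walkE T (k + 1) F
    have h4 : y ^ 2 / ε ≤ c * M ^ 2 / ε * (entropy T (k + 1) - entropy T k) := by
      rw [div_mul_eq_mul_div]
      gcongr
      linarith
    have h5 : |y| ≤ ε + y ^ 2 / ε := by
      rw [← sq_abs, ← sub_nonneg]
      have : ε + |y| ^ 2 / ε - |y| = ((|y| - ε / 2) ^ 2 + 3 / 4 * ε ^ 2) / ε := by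
        field_simp; ring
      rw [this]; positivity
    linarith
  have hbd : ∀ ε : ℝ, 0 < ε → ∀ n, |cesaro T (fun x => F (s * x)) n - cesaro T F n| ≤
      ε + c * M ^ 2 / ε * (entropy T (n + 1) / (n + 1 : ℕ)) + 2 * M / (n + 1 : ℕ) := by
    intro ε hε n
    have hn : (0 : ℝ) < n + 1 := by positivity
    have e1 : ∑ k ∈ Finset.range (n + 1), walkE T k F =
        ∑ k ∈ Finset.range (n + 1), walkE T (k + 1) F - walkE T (n + 1) F + walkE T 0 F := by
      have := Finset.sum_range_sub (fun k => walkE T k F) (n + 1)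
      rw [Finset.sum_sub_distrib] at this
      linarith
    have e2 : ∑ k ∈ Finset.range (n + 1), (entropy T (k + 1) - entropy T k) =
        entropy T (n + 1) := by
      rw [Finset.sum_range_sub (entropy T), entropy_zero, sub_zero]
    have e3 : |∑ k ∈ Finset.range (n + 1), (walkE T k (fun x => F (s * x)) -
        walkE T (k + 1) F)| ≤ (n + 1) * ε + c * M ^ 2 / ε * entropy T (n + 1) := by
      refine (Finset.abs_sum_le_sum_abs _ _).trans
        ((Finset.sum_le_sum fun k _ => hstep ε hε k).trans ?_)
      rw [Finset.sum_add_distrib, ← Finset.mul_sum, e2]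
      simp
    rw [Finset.sum_sub_distrib] at e3
    rw [cesaro, cesaro, ← sub_div, e1, abs_div, abs_of_pos hn, div_le_iff₀ hn]
    have a1 := abs_le.1 (abs_walkE_le hinv h1 hF 0)
    have a2 := abs_le.1 (abs_walkE_le hinv h1 hF (n + 1))
    have a3 := abs_le.1 e3
    have : (ε + c * M ^ 2 / ε * (entropy T (n + 1) / (n + 1 : ℕ)) + 2 * M / (n + 1 : ℕ)) *
        ((n : ℝ) + 1) = (n + 1) * ε + c * M ^ 2 / ε * entropy T (n + 1) + 2 * M := by
      push_cast; field_simp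
    rw [this, abs_le]
    constructor <;> linarith [a1.1, a1.2, a2.1, a2.2, a3.1, a3.2]
  rw [Metric.tendsto_atTop']
  intro ε hε
  have ht : Tendsto (fun n : ℕ => ε / 2 + c * M ^ 2 / (ε / 2) * (entropy T (n + 1) / (n + 1 : ℕ)) +
      2 * M / (n + 1 : ℕ)) atTop (nhds (ε / 2 + c * M ^ 2 / (ε / 2) * 0 + 0)) := by
    refine (tendsto_const_nhds.add (Tendsto.const_mul _ ?_)).add ?_
    · exact (entropy_div_tendsto hG hinv h1).comp (tendsto_add_atTop_nat 1)
    · exact (tendsto_const_div_atTop_nhds_zero_nat (2 * M)).comp (tendsto_add_atTop_nat 1)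
  have hlt := ht.eventually (gt_mem_nhds (show ε / 2 + c * M ^ 2 / (ε / 2) * 0 + 0 < ε by linarith))
  obtain ⟨N, hN⟩ := eventually_atTop.1 hlt
  refine ⟨N, fun n hn => ?_⟩
  rw [Real.dist_eq, sub_zero]
  exact (hbd (ε / 2) (by positivity) n).trans_lt (hN n hn.le)

theorem exists_ultrafilter_good {d : ℕ} (hG : PG d G) (hinv : ∀ s ∈ T, s⁻¹ ∈ T)
    (h1 : (1 : G) ∈ T) : ∃ U : Ultrafilter ℕ, (U : Filter ℕ) ≤ atTop ∧ goodTimes T d ∈ U := by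
  have : NeBot (atTop ⊓ 𝓟 (goodTimes T d)) := by
    rw [← frequently_mem_iff_neBot, frequently_atTop]
    exact fun n₀ => exists_good_time hG hinv h1 n₀
  refine ⟨Ultrafilter.of (atTop ⊓ 𝓟 (goodTimes T d)), (Ultrafilter.of_le _).trans inf_le_left, ?_⟩
  exact (Ultrafilter.of_le _).trans inf_le_right (mem_principal_self _)

/-- Limits along an ultrafilter of Cesàro averages. -/
noncomputable def meanLim (T : Finset G) (U : Ultrafilter ℕ) (F : G → ℝ) : ℝ :=
  limUnder (U : Filter ℕ) (cesaro T F)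

theorem tendsto_meanLim (hinv : ∀ s ∈ T, s⁻¹ ∈ T) (h1 : (1 : G) ∈ T) (U : Ultrafilter ℕ)
    {F : G → ℝ} (hF : ∃ M, ∀ x, |F x| ≤ M) :
    Tendsto (cesaro T F) U (nhds (meanLim T U F)) := by
  obtain ⟨M, hM⟩ := hF
  apply tendsto_nhds_limUnder
  have hK : IsCompact (Set.Icc (-M) M) := isCompact_Icc
  obtain ⟨a, -, ha⟩ := hK.ultrafilter_le_nhds (U.map (cesaro T F)) (by
    rw [le_principal_iff]
    exact Filter.mem_map.2 (Eventually.of_forall fun n => abs_le.1 (abs_cesaro_le hinv h1 hM n)))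
  exact ⟨a, ha⟩

theorem meanLim_translate {d : ℕ} (hG : PG d G) (hinv : ∀ s ∈ T, s⁻¹ ∈ T) (h1 : (1 : G) ∈ T)
    (hT : Subgroup.closure (T : Set G) = ⊤) {U : Ultrafilter ℕ} (hU : (U : Filter ℕ) ≤ atTop)
    {F : G → ℝ} (hF : ∃ M, ∀ x, |F x| ≤ M) (g : G) :
    meanLim T U (fun x => F (g * x)) = meanLim T U F := by
  have key : ∀ s ∈ T, ∀ F : G → ℝ, (∃ M, ∀ x, |F x| ≤ M) →
      meanLim T U (fun x => F (s * x)) = meanLim T U F := by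
    intro s hs F hF
    obtain ⟨M, hM⟩ := hF
    have t1 := tendsto_meanLim hinv h1 U (F := fun x => F (s * x)) ⟨M, fun x => hM _⟩
    have t2 := tendsto_meanLim hinv h1 U ⟨M, hM⟩
    have t3 := (cesaro_translate_tendsto hG hinv h1 hM hs).mono_left hU
    have := tendsto_nhds_unique (t1.sub t2) t3
    linarith
  have hg : g ∈ Subgroup.closure (T : Set G) := hT ▸ Subgroup.mem_top g
  induction hg using Subgroup.closure_induction generalizing F with
  | mem s hs => exact key s hs F hF
  | one => simp
  | mul a b _ _ iha ihb =>
    obtain ⟨M, hM⟩ := hF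
    have := ihb (F := fun x => F (a * x)) ⟨M, fun x => hM _⟩
    rw [← iha ⟨M, hM⟩, ← this]
    simp [mul_assoc]
  | inv a _ ih =>
    obtain ⟨M, hM⟩ := hF
    have := ih (F := fun x => F (a⁻¹ * x)) ⟨M, fun x => hM _⟩
    rw [← this]
    simp

/-- Lipschitz harmonic functions vanishing at the identity. -/
def lipHarm (T : Finset G) : Submodule ℝ (G → ℝ) where
  carrier := {u | Harm T u ∧ u 1 = 0 ∧ ∃ L, ∀ x, ∀ s ∈ T, |u (x * s) - u x| ≤ L}
  add_mem' := by
    rintro u v ⟨hu, hu1, L, hL⟩ ⟨hv, hv1, L', hL'⟩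
    refine ⟨fun x => ?_, by simp [hu1, hv1], L + L', fun x s hs => ?_⟩
    · simp [Finset.sum_add_distrib, add_div, hu x, hv x]
    · have : (u + v) (x * s) - (u + v) x = (u (x * s) - u x) + (v (x * s) - v x) := by
        simp only [Pi.add_apply]; ring
      rw [this]
      exact (abs_add_le _ _).trans (add_le_add (hL x s hs) (hL' x s hs))
  zero_mem' := ⟨fun x => by simp, rfl, 0, by simp⟩
  smul_mem' := by
    rintro c u ⟨hu, hu1, L, hL⟩
    refine ⟨fun x => ?_, by simp [hu1], |c| * L, fun x s hs => ?_⟩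
    · simp [← Finset.mul_sum, mul_div_assoc, hu x]
    · simp only [Pi.smul_apply, smul_eq_mul, ← mul_sub, abs_mul]
      exact mul_le_mul_of_nonneg_left (hL x s hs) (abs_nonneg c)

theorem grad_bounded {u v : G → ℝ} (hu : u ∈ lipHarm T) (hv : v ∈ lipHarm T) :
    ∃ M, ∀ x, |grad T u v x| ≤ M := by
  obtain ⟨-, -, L, hL⟩ := hu
  obtain ⟨-, -, L', hL'⟩ := hv
  refine ⟨(∑ s ∈ T, L * L') / T.card, fun x => ?_⟩
  rw [grad, abs_div, Nat.abs_cast]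
  gcongr
  refine (Finset.abs_sum_le_sum_abs _ _).trans (Finset.sum_le_sum fun s hs => ?_)
  rw [abs_mul]
  exact mul_le_mul (hL x s hs) (hL' x s hs) (abs_nonneg _) ((abs_nonneg _).trans (hL x s hs))

theorem grad_self_nonneg (u : G → ℝ) (x : G) : 0 ≤ grad T u u x :=
  div_nonneg (Finset.sum_nonneg fun s _ => mul_self_nonneg _) (by positivity)

theorem grad_add_left (u v w : G → ℝ) (x : G) :
    grad T (u + v) w x = grad T u w x + grad T v w x := by
  simp only [grad, ← add_div, ← Finset.sum_add_distrib, Pi.add_apply]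
  congr 1
  exact Finset.sum_congr rfl fun s _ => by ring

theorem grad_smul_left (c : ℝ) (u w : G → ℝ) (x : G) :
    grad T (c • u) w x = c * grad T u w x := by
  simp only [grad, mul_div_assoc', Finset.mul_sum, Pi.smul_apply, smul_eq_mul]
  congr 1
  exact Finset.sum_congr rfl fun s _ => by ring

theorem grad_comm (u v : G → ℝ) : grad T u v = grad T v u := by
  funext x
  simp only [grad, mul_comm]

theorem sq_diff_le_meanLim {d : ℕ} (hG : PG d G) (hinv : ∀ s ∈ T, s⁻¹ ∈ T) (h1 : (1 : G) ∈ T)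
    (hT : Subgroup.closure (T : Set G) = ⊤) {U : Ultrafilter ℕ} (hU : (U : Filter ℕ) ≤ atTop)
    (hgood : goodTimes T d ∈ U) {u : G → ℝ} (hu : u ∈ lipHarm T) (g : G) {s : G} (hs : s ∈ T) :
    (u (g * s) - u g) ^ 2 ≤
      2 * T.card * (T.card + 1) * (d + 1) * meanLim T U (grad T u u) := by
  obtain ⟨M, hM⟩ := grad_bounded hu hu
  have t1 := tendsto_meanLim hinv h1 U (F := fun x => grad T u u (g * x)) ⟨M, fun x => hM _⟩
  rw [meanLim_translate hG hinv h1 hT hU ⟨M, hM⟩] at t1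
  refine ge_of_tendsto (t1.const_mul _) ?_
  filter_upwards [hgood] with n hn
  refine (hu.1.sq_diff_le hinv h1 n g hs).trans ?_
  have h0 : 0 ≤ ∑ k ∈ Finset.range (n + 1), walkE T k fun x => grad T u u (g * x) :=
    Finset.sum_nonneg fun k _ => tsum_nonneg fun x =>
      mul_nonneg (walk_nonneg _ _) (grad_self_nonneg _ _)
  have hn' : entropy T (n + 1) - entropy T n ≤ (d + 1) / (n + 1) := hn
  calc _ ≤ 2 * T.card * (T.card + 1) * ((d + 1) / (n + 1) : ℝ) *
        ∑ k ∈ Finset.range (n + 1), walkE T k fun x => grad T u u (g * x) := by gcongr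
    _ = _ := by rw [cesaro]; ring

theorem eq_zero_of_diff_zero {u : G → ℝ} (hT : Subgroup.closure (T : Set G) = ⊤) (hu1 : u 1 = 0)
    (h : ∀ x, ∀ s ∈ T, u (x * s) = u x) : u = 0 := by
  have key : ∀ g x, u (x * g) = u x := by
    intro g
    have hg : g ∈ Subgroup.closure (T : Set G) := hT ▸ Subgroup.mem_top g
    induction hg using Subgroup.closure_induction with
    | mem s hs => exact fun x => h x s hs
    | one => simp
    | mul a b _ _ iha ihb => exact fun x => by rw [← mul_assoc, ihb, iha]
    | inv a _ ih => exact fun x => by rw [← ih (x * a⁻¹)]; simp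
  funext g
  have := key g 1
  simpa [hu1] using this

/-- The mean energy as an inner product. -/
theorem exists_core {d : ℕ} (hG : PG d G) (hinv : ∀ s ∈ T, s⁻¹ ∈ T) (h1 : (1 : G) ∈ T)
    (hT : Subgroup.closure (T : Set G) = ⊤) {U : Ultrafilter ℕ} (hU : (U : Filter ℕ) ≤ atTop)
    (hgood : goodTimes T d ∈ U) :
    ∃ Q : InnerProductSpace.Core ℝ (lipHarm T),
      ∀ u v, Q.inner u v = meanLim T U (grad T (u : G → ℝ) v) :=
  ⟨{  inner := fun u v => meanLim T U (grad T (u : G → ℝ) v)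
      conj_inner_symm := fun u v => by simp [grad_comm]
      re_inner_nonneg := fun u => by
        refine ge_of_tendsto' (tendsto_meanLim hinv h1 U (grad_bounded u.2 u.2)) fun n => ?_
        exact div_nonneg (Finset.sum_nonneg fun k _ => tsum_nonneg fun x =>
          mul_nonneg (walk_nonneg _ _) (grad_self_nonneg _ _)) (by positivity)
      add_left := fun u v w => by
        have t1 := tendsto_meanLim hinv h1 U (grad_bounded (u + v).2 w.2)
        have t2 := (tendsto_meanLim hinv h1 U (grad_bounded u.2 w.2)).add
          (tendsto_meanLim hinv h1 U (grad_bounded v.2 w.2))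
        refine tendsto_nhds_unique t1 (t2.congr fun n => ?_)
        rw [← cesaro_add hinv]
        congr 1
        funext x
        simp [grad_add_left]
      smul_left := fun u w c => by
        have t1 := tendsto_meanLim hinv h1 U (grad_bounded (c • u).2 w.2)
        have t2 := (tendsto_meanLim hinv h1 U (grad_bounded u.2 w.2)).const_mul c
        refine tendsto_nhds_unique t1 (t2.congr fun n => ?_)
        rw [← cesaro_smul]
        congr 1
        funext x
        simp [grad_smul_left]
      definite := fun u hu => by
        refine Subtype.ext (eq_zero_of_diff_zero hT u.2.2.1 fun x s hs => ?_)
        have h := sq_diff_le_meanLim hG hinv h1 hT hU hgood u.2 x hs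
        have hu' : meanLim T U (grad T (u : G → ℝ) u) = 0 := hu
        rw [hu', mul_zero] at h
        have := pow_eq_zero_iff two_ne_zero |>.1 (le_antisymm h (sq_nonneg _))
        linarith }, fun _ _ => rfl⟩

/-- The action on Lipschitz harmonic functions modulo constants. -/
def lipHarmAction (T : Finset G) : G →* Module.End ℝ (lipHarm T) where
  toFun g :=
    { toFun := fun u => ⟨fun x => (u : G → ℝ) (g⁻¹ * x) - (u : G → ℝ) g⁻¹, by
        obtain ⟨hu, hu1, L, hL⟩ := u.2
        refine ⟨fun x => ?_, by simp, L, fun x s hs => ?_⟩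
        · rcases T.eq_empty_or_nonempty with rfl | hne
          · have h : ∀ y, (u : G → ℝ) y = 0 := fun y => by simpa using (hu y).symm
            simp [h]
          · have : (T.card : ℝ) ≠ 0 := by
              have := Finset.card_pos.2 hne
              positivity
            have h2 := hu (g⁻¹ * x)
            simp only [mul_assoc] at h2
            rw [Finset.sum_sub_distrib, sub_div, h2]
            simp [this]
        · simpa [mul_assoc] using hL (g⁻¹ * x) s hs⟩
      map_add' := fun u v => Subtype.ext (funext fun x => by simp; ring)
      map_smul' := fun c u => Subtype.ext (funext fun x => by simp; ring) }
  map_one' := LinearMap.ext fun u => Subtype.ext (funext fun x => by simp [u.2.2.1])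
  map_mul' g h := LinearMap.ext fun u => Subtype.ext (funext fun x => by simp [mul_assoc])

theorem lipHarmAction_apply (g : G) (u : lipHarm T) (x : G) :
    (lipHarmAction T g u : G → ℝ) x = (u : G → ℝ) (g⁻¹ * x) - (u : G → ℝ) g⁻¹ := rfl

theorem exists_harmonic_rep {d : ℕ} (hG : PG d G) (hinv : ∀ s ∈ T, s⁻¹ ∈ T) (h1 : (1 : G) ∈ T)
    (hT : Subgroup.closure (T : Set G) = ⊤) :
    ∃ (m : ℕ) (M : G →* Matrix.unitaryGroup (Fin m) ℝ), ∀ g, M g = 1 → ∀ u ∈ lipHarm T,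
      ∀ x, u (g⁻¹ * x) - u g⁻¹ = u x := by
  obtain ⟨U, hU, hgood⟩ := exists_ultrafilter_good hG hinv h1
  obtain ⟨Q, hQ⟩ := exists_core hG hinv h1 hT hU hgood
  have hq : (0 : ℝ) < T.card := by exact_mod_cast Finset.card_pos.2 ⟨_, h1⟩
  set C : ℝ := 2 * T.card * (T.card + 1) * (d + 1) with hC
  have hbound : ∀ (m : ℕ) (u : Fin m → lipHarm T),
      (∀ i j, Q.inner (u i) (u j) = if i = j then 1 else 0) → m ≤ ⌊C⌋₊ := by
    intro m u hu
    have hpt : ∀ g, ∀ s ∈ T, ∑ i, ((u i : G → ℝ) (g * s) - (u i : G → ℝ) g) ^ 2 ≤ C := by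
      intro g s hs
      set c : Fin m → ℝ := fun i => (u i : G → ℝ) (g * s) - (u i : G → ℝ) g
      set v : lipHarm T := ∑ i, c i • u i
      have hv := sq_diff_le_meanLim hG hinv h1 hT hU hgood v.2 g hs
      rw [← hQ] at hv
      have hvv : Q.inner v v = ∑ i, c i ^ 2 := by
        let _ : NormedAddCommGroup (lipHarm T) := Q.toNormedAddCommGroup
        let _ : InnerProductSpace ℝ (lipHarm T) := InnerProductSpace.ofCore Q.toCore
        have : Orthonormal ℝ u := orthonormal_iff_ite.2 hu
        have h2 := this.inner_sum c c Finset.univ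
        have h3 : Q.inner v v = inner ℝ (∑ i, c i • u i) (∑ i, c i • u i) := rfl
        rw [h3, h2]
        simp [sq]
      have hd : (v : G → ℝ) (g * s) - (v : G → ℝ) g = ∑ i, c i ^ 2 := by
        simp only [v, Submodule.coe_sum, Finset.sum_apply, Submodule.coe_smul, Pi.smul_apply,
          smul_eq_mul, ← Finset.sum_sub_distrib, ← mul_sub, sq, c]
      rw [hd, hvv] at hv
      by_contra! hlt
      have h0 : 0 < ∑ i, c i ^ 2 := lt_of_le_of_lt (by positivity) hlt
      nlinarith
    have hsum : ∀ x, ∑ i, grad T (u i : G → ℝ) (u i) x ≤ C := by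
      intro x
      simp only [grad, ← Finset.sum_div]
      rw [Finset.sum_comm, div_le_iff₀ hq]
      refine (Finset.sum_le_sum fun s hs => ?_).trans (b := ∑ s ∈ T, C) (by simp [mul_comm])
      simpa [sq] using hpt x s hs
    have t : Tendsto (fun n => ∑ i, cesaro T (grad T (u i : G → ℝ) (u i)) n) U
        (nhds (∑ i : Fin m, 1)) :=
      tendsto_finsetSum _ fun i _ => by
        have := tendsto_meanLim hinv h1 U (grad_bounded (u i).2 (u i).2)
        rwa [← hQ, hu, if_pos rfl] at this
    have hle := le_of_tendsto' t (b := C) fun n => by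
      have : ∑ i, cesaro T (grad T (u i : G → ℝ) (u i)) n =
          cesaro T (fun x => ∑ i, grad T (u i : G → ℝ) (u i) x) n := by
        simp only [cesaro, walkE_sum hinv, ← Finset.sum_div]
        rw [Finset.sum_comm]
      rw [this]
      refine (cesaro_mono hinv hsum n).trans ?_
      exact (le_abs_self _).trans (abs_cesaro_le hinv h1
        (fun _ => (abs_of_nonneg (by positivity : 0 ≤ C)).le) n)
    exact Nat.le_floor (by simpa using hle)
  obtain ⟨m, M, hM⟩ := exists_orthogonal_rep Q _ hbound (lipHarmAction T) fun g u v => by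
    rw [hQ, hQ, ← meanLim_translate hG hinv h1 hT hU (grad_bounded u.2 v.2) g⁻¹]
    congr 1
    funext x
    simp [grad, lipHarmAction_apply, mul_assoc]
  refine ⟨m, M, fun g hg u hu x => ?_⟩
  have := congrArg (fun f => (f ⟨u, hu⟩ : G → ℝ) x) (hM g hg)
  simpa [lipHarmAction_apply] using this

end Harmonic

section Existence
variable {G : Type*} [Group G] {T : Finset G}

theorem walk_succ_right (n : ℕ) (x : G) :
    walk T (n + 1) x = (∑ s ∈ T, walk T n (x * s)) / T.card := by
  induction n generalizing x with
  | zero =>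
    simp only [walk]
    congr 1
    refine Finset.sum_congr rfl fun s _ => ?_
    have : s * x = 1 ↔ x * s = 1 := mul_eq_one_comm
    by_cases h : s * x = 1
    · rw [h, this.1 h]
    · rw [Set.indicator_of_notMem (by simpa using h),
        Set.indicator_of_notMem (by simpa using mt this.2 h)]
  | succ n ih =>
    change (∑ s ∈ T, walk T (n + 1) (s * x)) / (T.card : ℝ) = _
    rw [Finset.sum_congr rfl fun s _ => ih (s * x)]
    conv_rhs => simp only [walk]
    simp only [← Finset.sum_div, ← mul_assoc]
    rw [Finset.sum_comm]

end Existence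

section Sums
variable {G : Type*}

theorem summable_mul_of_support {φ ψ : G → ℝ} (hφ : (support φ).Finite) :
    Summable fun x => φ x * ψ x :=
  summable_of_support hφ fun x hx => by simp [hx]

theorem summable_sq_of_support {φ : G → ℝ} (hφ : (support φ).Finite) :
    Summable fun x => φ x ^ 2 :=
  summable_of_support hφ fun x hx => by simp [hx]

theorem tsum_mul_sq_le {φ ψ : G → ℝ} (hφ : (support φ).Finite) (hψ : (support ψ).Finite) :
    (∑' x, φ x * ψ x) ^ 2 ≤ (∑' x, φ x ^ 2) * ∑' x, ψ x ^ 2 := by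
  set B := (hφ.union hψ).toFinset
  have h1 : ∀ x, x ∉ B → φ x = 0 := fun x hx => by
    by_contra h; exact hx (by simp [B, h])
  have h2 : ∀ x, x ∉ B → ψ x = 0 := fun x hx => by
    by_contra h; exact hx (by simp [B, h])
  rw [tsum_eq_sum (s := B) fun x hx => by simp [h1 x hx],
    tsum_eq_sum (s := B) fun x hx => by simp [h1 x hx],
    tsum_eq_sum (s := B) fun x hx => by simp [h2 x hx]]
  exact Finset.sum_mul_sq_le_sq_mul_sq _ _ _

theorem support_sub_finite {φ ψ : G → ℝ} (hφ : (support φ).Finite) (hψ : (support ψ).Finite) :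
    (support fun x => φ x - ψ x).Finite :=
  (hφ.union hψ).subset (support_sub φ ψ)

theorem support_add_finite {φ ψ : G → ℝ} (hφ : (support φ).Finite) (hψ : (support ψ).Finite) :
    (support fun x => φ x + ψ x).Finite :=
  (hφ.union hψ).subset (support_add φ ψ)

end Sums

section Existence
variable {G : Type*} [Group G] {T : Finset G}

theorem support_translate {φ : G → ℝ} (hφ : (support φ).Finite) (g : G) :
    (support fun x => φ (g * x)).Finite := hφ.preimage (mul_right_injective g).injOn

theorem support_translate_right {φ : G → ℝ} (hφ : (support φ).Finite) (g : G) :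
    (support fun x => φ (x * g)).Finite := hφ.preimage (mul_left_injective g).injOn

theorem support_avg_finite {φ : G → ℝ} (hφ : (support φ).Finite) (T : Finset G) :
    (support fun x => (∑ s ∈ T, φ (x * s)) / T.card).Finite := by
  refine (T.finite_toSet.biUnion fun s _ => support_translate_right hφ s).subset fun x hx => ?_
  have : ∑ s ∈ T, φ (x * s) ≠ 0 := fun h => hx (by simp [h])
  obtain ⟨s, hs, hsx⟩ := Finset.exists_ne_zero_of_sum_ne_zero this
  exact mem_biUnion hs hsx

theorem tsum_sq_translate (φ : G → ℝ) (g : G) : ∑' x, φ (g * x) ^ 2 = ∑' x, φ x ^ 2 :=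
  (Equiv.mulLeft g).tsum_eq fun x => φ x ^ 2

theorem tsum_sq_translate_right (φ : G → ℝ) (g : G) : ∑' x, φ (x * g) ^ 2 = ∑' x, φ x ^ 2 :=
  (Equiv.mulRight g).tsum_eq fun x => φ x ^ 2

/-- Laziness bounds the right averaging operator away from `-1`. -/
theorem tsum_sq_le_add_avg (h1 : (1 : G) ∈ T) {h : G → ℝ} (hh : (support h).Finite) :
    4 / (T.card : ℝ) ^ 2 * ∑' x, h x ^ 2 ≤
      ∑' x, (h x + (∑ s ∈ T, h (x * s)) / T.card) ^ 2 := by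
  classical
  have hq : (0 : ℝ) < T.card := by exact_mod_cast Finset.card_pos.2 ⟨_, h1⟩
  have hs1 := summable_sq_of_support hh
  set A : G → ℝ := fun x => (∑ s ∈ T, h (x * s)) / T.card
  have hA : (support A).Finite := support_avg_finite hh T
  have hs2 := summable_sq_of_support (support_add_finite hh hA)
  have hs3 : Summable fun x => h x * A x := summable_mul_of_support hh
  have hs4 : ∀ s, Summable fun x => h (x * s) ^ 2 := fun s =>
    summable_sq_of_support (support_translate_right hh s)
  have e1 : -(T.card - 2) * ∑' x, h x ^ 2 ≤ T.card * ∑' x, h x * A x := by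
    have hle : ∀ x, ∑ s ∈ T.erase 1, -((h x ^ 2 + h (x * s) ^ 2) / 2) + h x ^ 2 ≤
        T.card * (h x * A x) := by
      intro x
      have : T.card * (h x * A x) = ∑ s ∈ T, h x * h (x * s) := by
        simp only [A, ← Finset.mul_sum]; field_simp
      rw [this, ← Finset.sum_erase_add _ _ h1]
      refine add_le_add (Finset.sum_le_sum fun s _ => ?_) (by rw [mul_one, sq])
      nlinarith [sq_nonneg (h x + h (x * s))]
    have hsum : ∀ s ∈ T.erase 1, Summable fun x => -((h x ^ 2 + h (x * s) ^ 2) / 2) := fun s _ =>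
      ((hs1.add (hs4 s)).div_const 2).neg
    have := ((summable_sum hsum).add hs1).tsum_le_tsum hle (hs3.mul_left _)
    rw [tsum_mul_left, (summable_sum hsum).tsum_add hs1, Summable.tsum_finsetSum hsum] at this
    refine le_trans (le_of_eq ?_) this
    have e : ∀ s ∈ T.erase 1, ∑' x, -((h x ^ 2 + h (x * s) ^ 2) / 2) = -∑' x, h x ^ 2 := by
      intro s _
      rw [tsum_neg, tsum_div_const, hs1.tsum_add (hs4 s), tsum_sq_translate_right]
      ring
    rw [Finset.sum_congr rfl e, Finset.sum_const, Finset.card_erase_of_mem h1, nsmul_eq_mul,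
      Nat.cast_sub (Finset.card_pos.2 ⟨_, h1⟩)]
    push_cast
    ring
  have e2 : ∑' x, (h x ^ 2 + h x * A x) ≤
      ∑' x, ((T.card : ℝ)⁻¹ * h x ^ 2 + (T.card : ℝ) / 4 * (h x + A x) ^ 2) := by
    refine (hs1.add hs3).tsum_le_tsum (fun x => ?_) ((hs1.mul_left _).add (hs2.mul_left _))
    have : (T.card : ℝ)⁻¹ * h x ^ 2 + (T.card : ℝ) / 4 * (h x + A x) ^ 2 -
        (h x ^ 2 + h x * A x) = (T.card : ℝ) / 4 * (h x + A x - 2 / T.card * h x) ^ 2 := by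
      field_simp; ring
    have h0 : 0 ≤ (T.card : ℝ) / 4 * (h x + A x - 2 / T.card * h x) ^ 2 := by positivity
    linarith
  rw [hs1.tsum_add hs3, (hs1.mul_left _).tsum_add (hs2.mul_left _), tsum_mul_left,
    tsum_mul_left] at e2
  set H := ∑' x, h x ^ 2
  set K := ∑' x, h x * A x
  set R := ∑' x, (h x + A x) ^ 2
  have e3 : H * (T.card : ℝ) + T.card * K ≤ H + (T.card : ℝ) ^ 2 / 4 * R := by
    have := mul_le_mul_of_nonneg_left e2 hq.le
    have h2 : (T.card : ℝ) * ((T.card : ℝ)⁻¹ * H + T.card / 4 * R) =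
      H + (T.card : ℝ) ^ 2 / 4 * R := by field_simp
    rw [h2] at this
    linarith
  rw [div_mul_eq_mul_div, div_le_iff₀ (by positivity)]
  linarith

/-- Decrement of the squared norm of the walk. -/
noncomputable def energyDrop (T : Finset G) (k : ℕ) : ℝ :=
  ∑' x, walk T k x ^ 2 - ∑' x, walk T (k + 1) x ^ 2

theorem tsum_walk_mul_walk (hinv : ∀ s ∈ T, s⁻¹ ∈ T) (k l : ℕ) :
    ∑' x, walk T (k + 1) x * walk T l x = ∑' x, walk T k x * walk T (l + 1) x := by
  have a := walkE_succ_left' hinv k (walk T l)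
  rw [← walkE_sum hinv, div_eq_inv_mul, ← walkE_smul] at a
  refine a.trans (tsum_congr fun x => ?_)
  simp only [walk]
  ring

theorem energyDrop_eq (hinv : ∀ s ∈ T, s⁻¹ ∈ T) (h1 : (1 : G) ∈ T) (k : ℕ) :
    T.card * energyDrop T k = ∑ s ∈ T, ∑' x, (walk T k (s * x) - walk T (k + 1) x) ^ 2 := by
  have hq : (0 : ℝ) < T.card := by exact_mod_cast Finset.card_pos.2 ⟨_, h1⟩
  have hf := walk_support_finite hinv k
  have hf' := walk_support_finite hinv (k + 1)
  have s1 : ∀ s, Summable fun x => walk T k (s * x) ^ 2 := fun s =>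
    summable_sq_of_support (support_translate hf s)
  have s2 := summable_sq_of_support hf'
  have s3 : ∀ s, Summable fun x => walk T (k + 1) x * walk T k (s * x) := fun s =>
    summable_mul_of_support hf'
  have e : ∀ s ∈ T, ∑' x, (walk T k (s * x) - walk T (k + 1) x) ^ 2 =
      ∑' x, walk T k x ^ 2 + ∑' x, walk T (k + 1) x ^ 2 -
        2 * ∑' x, walk T (k + 1) x * walk T k (s * x) := by
    intro s _
    rw [← tsum_sq_translate (walk T k) s, ← (s1 s).tsum_add s2, ← tsum_mul_left,
      ← ((s1 s).add s2).tsum_sub ((s3 s).mul_left 2)]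
    exact tsum_congr fun x => by ring
  have e2 : ∑ s ∈ T, ∑' x, walk T (k + 1) x * walk T k (s * x) =
      T.card * ∑' x, walk T (k + 1) x ^ 2 := by
    rw [← Summable.tsum_finsetSum fun s _ => s3 s, ← tsum_mul_left]
    refine tsum_congr fun x => ?_
    rw [← Finset.mul_sum]
    simp only [walk]
    field_simp
  rw [Finset.sum_congr rfl e, Finset.sum_sub_distrib, ← Finset.mul_sum, e2, energyDrop]
  simp
  ring

theorem energyDrop_sub (hinv : ∀ s ∈ T, s⁻¹ ∈ T) (k : ℕ) :
    energyDrop T k - energyDrop T (k + 1) = ∑' x, (walk T k x - walk T (k + 2) x) ^ 2 := by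
  have s1 := fun k => summable_sq_of_support (walk_support_finite hinv k)
  have s3 : Summable fun x => walk T k x * walk T (k + 2) x :=
    summable_mul_of_support (walk_support_finite hinv k)
  have e : ∑' x, (walk T k x - walk T (k + 2) x) ^ 2 = ∑' x, walk T k x ^ 2 +
      ∑' x, walk T (k + 2) x ^ 2 - 2 * ∑' x, walk T k x * walk T (k + 2) x := by
    rw [← (s1 _).tsum_add (s1 _), ← tsum_mul_left, ← ((s1 _).add (s1 _)).tsum_sub (s3.mul_left 2)]
    exact tsum_congr fun x => by ring
  rw [e, ← tsum_walk_mul_walk hinv, energyDrop, energyDrop]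
  simp only [← sq]
  ring

theorem abs_walk_sub_le (hinv : ∀ s ∈ T, s⁻¹ ∈ T) (h1 : (1 : G) ∈ T) (k : ℕ) {s : G} (hs : s ∈ T)
    (x : G) : |walk T k (s * x) - walk T k x| ≤ 2 * √(T.card * energyDrop T k) := by
  have key : ∀ s ∈ T, |walk T k (s * x) - walk T (k + 1) x| ≤ √(T.card * energyDrop T k) := by
    intro s hs
    apply Real.abs_le_sqrt
    rw [energyDrop_eq hinv h1]
    refine le_trans ?_ (Finset.single_le_sum
      (f := fun s => ∑' x, (walk T k (s * x) - walk T (k + 1) x) ^ 2)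
      (fun s _ => tsum_nonneg fun x => sq_nonneg _) hs)
    exact (summable_sq_of_support (support_sub_finite (walk_translate_support hinv k s)
      (walk_support_finite hinv _))).le_tsum x (fun _ _ => sq_nonneg _)
  have a := key s hs
  have b := key 1 h1
  rw [one_mul] at b
  rw [abs_le] at a b ⊢
  constructor <;> linarith [a.1, a.2, b.1, b.2]

theorem abs_walk_sub_le_pow (hinv : ∀ s ∈ T, s⁻¹ ∈ T) (h1 : (1 : G) ∈ T) (k n : ℕ) {w : G}
    (hw : w ∈ (T : Set G) ^ n) (x : G) :
    |walk T k (w * x) - walk T k x| ≤ n * (2 * √(T.card * energyDrop T k)) := by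
  induction n generalizing w with
  | zero => simp at hw; simp [hw]
  | succ n ih =>
    rw [pow_succ'] at hw
    obtain ⟨s, hs, v, hv, rfl⟩ := hw
    have a := abs_walk_sub_le hinv h1 k hs (v * x)
    have b := ih hv
    simp only [mul_assoc] at *
    push_cast
    rw [abs_le] at a b ⊢
    constructor <;> linarith [a.1, a.2, b.1, b.2]

theorem pow_ne_pow_succ [Infinite G] (h1 : (1 : G) ∈ T) (hinv : ∀ s ∈ T, s⁻¹ ∈ T)
    (hT : Subgroup.closure (T : Set G) = ⊤) (k : ℕ) :
    ∃ z ∈ (T : Set G) ^ (k + 1), z ∉ (T : Set G) ^ k := by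
  by_contra! hcon
  have hall : ∀ g : G, ∀ x ∈ (T : Set G) ^ k, g * x ∈ (T : Set G) ^ k := by
    intro g
    have hg : g ∈ Subgroup.closure (T : Set G) := hT ▸ Subgroup.mem_top g
    induction hg using Subgroup.closure_induction'' with
    | mem s hs =>
      intro x hx
      exact hcon _ (by rw [pow_succ']; exact Set.mul_mem_mul hs hx)
    | inv_mem s hs =>
      intro x hx
      exact hcon _ (by rw [pow_succ']; exact Set.mul_mem_mul (hinv s hs) hx)
    | one => simp
    | mul a b _ _ iha ihb =>
      intro x hx
      rw [mul_assoc]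
      exact iha _ (ihb _ hx)
  have h1k : (1 : G) ∈ (T : Set G) ^ k := by simpa using Set.pow_mem_pow (n := k) h1
  refine Set.infinite_univ (α := G) ((finite_pow T.finite_toSet k).subset fun g _ => ?_)
  simpa using hall g 1 h1k

theorem inv_mem_pow (hinv : ∀ s ∈ T, s⁻¹ ∈ T) {n : ℕ} {x : G} (hx : x ∈ (T : Set G) ^ n) :
    x⁻¹ ∈ (T : Set G) ^ n := by
  have : (T : Set G)⁻¹ = T := by
    ext s
    exact ⟨fun h => by simpa using hinv _ (Set.mem_inv.1 h), fun h => Set.mem_inv.2 (hinv s h)⟩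
  have h2 : ((T : Set G) ^ n)⁻¹ = (T : Set G) ^ n := by rw [← inv_pow, this]
  rw [← h2]
  exact Set.inv_mem_inv.2 hx

theorem energyDrop_lower [Infinite G] (hinv : ∀ s ∈ T, s⁻¹ ∈ T) (h1 : (1 : G) ∈ T)
    (hT : Subgroup.closure (T : Set G) = ⊤) (k : ℕ) :
    1 ≤ ((T : Set G) ^ k).ncard * ((2 * k + 1) * (2 * √(T.card * energyDrop T k))) := by
  have hfin : ((T : Set G) ^ k).Finite := finite_pow T.finite_toSet k
  obtain ⟨x, hx, hxp⟩ : ∃ x ∈ (T : Set G) ^ k, 1 ≤ ((T : Set G) ^ k).ncard * walk T k x := by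
    by_contra! hcon
    have hone := walkE_const hinv h1 k 1
    have hne : ((T : Set G) ^ k).Nonempty := ⟨1, by simpa using Set.pow_mem_pow (n := k) h1⟩
    rw [walkE, tsum_eq_sum (s := hfin.toFinset) fun x hx => by
      by_contra h
      exact hx (hfin.mem_toFinset.2 (walk_support hinv k x fun h0 => h (by simp [h0])))] at hone
    have hc : ((T : Set G) ^ k).ncard = hfin.toFinset.card := Set.ncard_eq_toFinset_card _ hfin
    have := Finset.sum_lt_sum_of_nonempty ((Set.Finite.toFinset_nonempty hfin).2 hne)
      (fun x hx => hcon x (hfin.mem_toFinset.1 hx))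
    simp only [mul_one] at hone
    rw [← Finset.mul_sum, hone, hc] at this
    simp at this
  obtain ⟨z, hz, hzn⟩ := pow_ne_pow_succ h1 hinv hT k
  have hzp : walk T k z = 0 := by
    by_contra h
    exact hzn (walk_support hinv k z h)
  have hw : z * x⁻¹ ∈ (T : Set G) ^ (2 * k + 1) := by
    have : 2 * k + 1 = (k + 1) + k := by ring
    rw [this, pow_add]
    exact Set.mul_mem_mul hz (inv_mem_pow hinv hx)
  have h := abs_walk_sub_le_pow hinv h1 k _ hw x
  rw [inv_mul_cancel_right, hzp, zero_sub, abs_neg, abs_of_nonneg (walk_nonneg _ _)] at h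
  push_cast at h
  exact hxp.trans (mul_le_mul_of_nonneg_left h (by positivity))

/-- Times at which the energy of the walk decays slowly. -/
theorem exists_slow_energyDrop [Infinite G] {d : ℕ} (hG : PG d G) (hinv : ∀ s ∈ T, s⁻¹ ∈ T)
    (h1 : (1 : G) ∈ T) (hT : Subgroup.closure (T : Set G) = ⊤) {ε : ℝ} (hε : 0 < ε) :
    ∃ k, 0 < energyDrop T k ∧ energyDrop T k - energyDrop T (k + 1) ≤ ε * energyDrop T k := by
  have hq : (0 : ℝ) < T.card := by exact_mod_cast Finset.card_pos.2 ⟨_, h1⟩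
  have hpos : ∀ k, 0 < energyDrop T k := by
    intro k
    by_contra h
    have := energyDrop_lower hinv h1 hT k
    rw [Real.sqrt_eq_zero_of_nonpos (mul_nonpos_of_nonneg_of_nonpos hq.le (not_lt.1 h))] at this
    norm_num at this
  wlog hε1 : ε < 1 generalizing ε
  · obtain ⟨k, hk, hk2⟩ := this (ε := 1 / 2) (by norm_num) (by norm_num)
    exact ⟨k, hk, hk2.trans (by nlinarith [not_lt.1 hε1])⟩
  by_contra! hcon
  have hdec : ∀ k, energyDrop T k ≤ (1 - ε) ^ k * energyDrop T 0 := by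
    intro k
    induction k with
    | zero => simp
    | succ k ih =>
      have := hcon k (hpos k)
      rw [pow_succ]
      nlinarith
  obtain ⟨C, hC⟩ := hG T T.finite_toSet
  have hlow : ∀ k : ℕ, 1 ≤ C ^ 2 * 4 * T.card * energyDrop T 0 * 4 *
      (((k : ℝ) + 1) ^ (2 * d + 2) * (1 - ε) ^ k) := by
    intro k
    have a := energyDrop_lower hinv h1 hT k
    have b : 1 ≤ (C * ((k : ℝ) + 1) ^ d) * ((2 * k + 1) * (2 * √(T.card * energyDrop T k))) :=
      a.trans (mul_le_mul_of_nonneg_right (hC k) (by positivity))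
    have c := pow_le_pow_left₀ zero_le_one b 2
    have e : ((C * ((k : ℝ) + 1) ^ d) * ((2 * k + 1) * (2 * √(T.card * energyDrop T k)))) ^ 2 =
        C ^ 2 * ((k : ℝ) + 1) ^ (2 * d) * (2 * k + 1) ^ 2 * 4 * (T.card * energyDrop T k) := by
      rw [← Real.sq_sqrt (mul_pos hq (hpos k)).le]
      rw [Real.sqrt_sq (Real.sqrt_nonneg _)]
      ring
    rw [one_pow, e] at c
    refine c.trans ?_
    have e2 : C ^ 2 * 4 * T.card * energyDrop T 0 * 4 *
        (((k : ℝ) + 1) ^ (2 * d + 2) * (1 - ε) ^ k) =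
        C ^ 2 * ((k : ℝ) + 1) ^ (2 * d) * (2 * (k + 1)) ^ 2 * 4 *
          (T.card * ((1 - ε) ^ k * energyDrop T 0)) := by ring
    rw [e2]
    have := mul_pos hq (hpos k)
    gcongr
    · linarith
    · exact hdec k
  have ht : Tendsto (fun k : ℕ => ((k : ℝ) + 1) ^ (2 * d + 2) * (1 - ε) ^ k) atTop (nhds 0) := by
    have := (tendsto_pow_const_mul_const_pow_of_abs_lt_one (2 * d + 2)
      (show |1 - ε| < 1 by rw [abs_lt]; constructor <;> linarith)).comp (tendsto_add_atTop_nat 1)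
    have := this.mul_const (1 - ε)⁻¹
    rw [zero_mul] at this
    refine this.congr fun k => ?_
    have : (1 - ε) ≠ 0 := by linarith
    simp only [Function.comp, pow_succ (1 - ε), Nat.cast_add, Nat.cast_one]
    field_simp
  have := ge_of_tendsto' (ht.const_mul (C ^ 2 * 4 * T.card * energyDrop T 0 * 4)) hlow
  rw [mul_zero] at this
  linarith

/-- Normalised almost harmonic functions. -/
theorem exists_almost_harmonic [Infinite G] {d : ℕ} (hG : PG d G) (hinv : ∀ s ∈ T, s⁻¹ ∈ T)
    (h1 : (1 : G) ∈ T) (hT : Subgroup.closure (T : Set G) = ⊤) {ε : ℝ} (hε : 0 < ε) :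
    ∃ u : G → ℝ, u 1 = 0 ∧ (∀ x, ∀ s ∈ T, |u (x * s) - u x| ≤ 1) ∧
      (∀ x, |(∑ s ∈ T, u (x * s)) / T.card - u x| ≤ ε) ∧ ∃ s ∈ T, u s = 1 := by
  have hq : (0 : ℝ) < T.card := by exact_mod_cast Finset.card_pos.2 ⟨_, h1⟩
  obtain ⟨k, hk, hslow⟩ := exists_slow_energyDrop hG hinv h1 hT
    (show 0 < ε ^ 2 * (4 / T.card ^ 2 : ℝ) by positivity)
  set f : G → ℝ := fun x => walk T k x + walk T (k + 1) x with hf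
  have hps := walk_support_finite hinv k
  have hfs : (support f).Finite := support_add_finite hps (walk_support_finite hinv (k + 1))
  set e : G → ℝ := fun s => ∑' x, (f x - f (s * x)) ^ 2 with he
  have hE : ∀ s, 4 / (T.card : ℝ) ^ 2 * ∑' x, (walk T k (s * x) - walk T k x) ^ 2 ≤ e s := by
    intro s
    refine (tsum_sq_le_add_avg h1
      (support_sub_finite (support_translate hps s) hps)).trans (le_of_eq ?_)
    refine tsum_congr fun x => ?_
    simp only [hf, walk_succ_right k, Finset.sum_sub_distrib, mul_assoc]
    ring
  have hvar : T.card * energyDrop T k ≤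
      ∑ s ∈ T, ∑' x, (walk T k (s * x) - walk T k x) ^ 2 := by
    rw [energyDrop_eq hinv h1]
    have s1 : ∀ s ∈ T, Summable fun x => (walk T k (s * x) - walk T (k + 1) x) ^ 2 := fun s _ =>
      summable_sq_of_support (support_sub_finite (support_translate hps s)
        (walk_support_finite hinv (k + 1)))
    have s2 : ∀ s ∈ T, Summable fun x => (walk T k (s * x) - walk T k x) ^ 2 := fun s _ =>
      summable_sq_of_support (support_sub_finite (support_translate hps s) hps)
    rw [← Summable.tsum_finsetSum s1, ← Summable.tsum_finsetSum s2]
    refine (summable_sum s1).tsum_le_tsum (fun x => ?_) (summable_sum s2)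
    have hm : ∑ s ∈ T, (walk T k (s * x) - walk T (k + 1) x) = 0 := by
      simp only [walk, Finset.sum_sub_distrib, Finset.sum_const, nsmul_eq_mul]
      field_simp
      simp
    have e1 : ∀ s ∈ T, (walk T k (s * x) - walk T k x) ^ 2 =
        (walk T k (s * x) - walk T (k + 1) x) ^ 2 + 2 * (walk T (k + 1) x - walk T k x) *
          (walk T k (s * x) - walk T (k + 1) x) + (walk T (k + 1) x - walk T k x) ^ 2 :=
      fun s _ => by ring
    rw [Finset.sum_congr rfl e1, Finset.sum_add_distrib, Finset.sum_add_distrib, ← Finset.mul_sum,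
      hm]
    have : 0 ≤ ∑ s ∈ T, (walk T (k + 1) x - walk T k x) ^ 2 :=
      Finset.sum_nonneg fun _ _ => sq_nonneg _
    linarith
  obtain ⟨s, hs, hmax⟩ := Finset.exists_max_image T e ⟨1, h1⟩
  have hes : 4 / (T.card : ℝ) ^ 2 * energyDrop T k ≤ e s := by
    have a : 4 / (T.card : ℝ) ^ 2 * (T.card * energyDrop T k) ≤ T.card * e s := by
      refine (mul_le_mul_of_nonneg_left hvar (by positivity)).trans ?_
      rw [Finset.mul_sum]
      refine (Finset.sum_le_sum fun t ht => (hE t).trans (hmax t ht)).trans ?_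
      simp
    have b : 4 / (T.card : ℝ) ^ 2 * (T.card * energyDrop T k) =
        T.card * (4 / (T.card : ℝ) ^ 2 * energyDrop T k) := by ring
    rw [b] at a
    exact le_of_mul_le_mul_left a hq
  have hes0 : 0 < e s := lt_of_lt_of_le (by positivity) hes
  have hvs : (support fun y => f y - f (s * y)).Finite :=
    support_sub_finite hfs (support_translate hfs s)
  have hcs : ∀ (φ : G → ℝ), (support φ).Finite → ∀ B, 0 ≤ B → ∑' y, φ y ^ 2 ≤ B ^ 2 * e s →
      |(∑' y, φ y * (f y - f (s * y))) / e s| ≤ B := by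
    intro φ hφ B hB h
    rw [abs_div, abs_of_pos hes0, div_le_iff₀ hes0]
    apply abs_le_of_sq_le_sq _ (by positivity)
    refine (tsum_mul_sq_le hφ hvs).trans ?_
    calc _ ≤ (B ^ 2 * e s) * e s := mul_le_mul_of_nonneg_right h hes0.le
      _ = _ := by ring
  have hsub : ∀ φ ψ : G → ℝ, (support φ).Finite → (support ψ).Finite →
      (∑' y, φ y * (f y - f (s * y))) / e s - (∑' y, ψ y * (f y - f (s * y))) / e s =
      (∑' y, (φ y - ψ y) * (f y - f (s * y))) / e s := by
    intro φ ψ hφ hψ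
    rw [← sub_div, ← (summable_mul_of_support hφ).tsum_sub (summable_mul_of_support hψ)]
    simp only [sub_mul]
  have hw : ∀ x : G, (support fun y => f y - f (x⁻¹ * y)).Finite := fun x =>
    support_sub_finite hfs (support_translate hfs _)
  refine ⟨fun x => (∑' y, (f y - f (x⁻¹ * y)) * (f y - f (s * y))) / e s, by simp, ?_, ?_,
    s⁻¹, hinv s hs, ?_⟩
  · intro x t ht
    rw [hsub _ _ (hw _) (hw _)]
    refine hcs _ (support_sub_finite (hw _) (hw _)) 1 zero_le_one ?_
    rw [one_pow, one_mul]
    refine le_trans (le_of_eq ?_) (hmax _ (hinv t ht))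
    rw [he]
    dsimp only
    rw [← (Equiv.mulLeft x⁻¹).tsum_eq fun y => (f y - f (t⁻¹ * y)) ^ 2]
    refine tsum_congr fun y => ?_
    simp only [Equiv.coe_mulLeft, mul_inv_rev, mul_assoc]
    ring
  · intro x
    have hP : ∀ z, ∑ t ∈ T, f (t⁻¹ * z) = T.card * (walk T (k + 1) z + walk T (k + 2) z) := by
      intro z
      have : ∑ t ∈ T, f (t⁻¹ * z) = ∑ t ∈ T, f (t * z) :=
        Finset.sum_nbij' (fun s => s⁻¹) (fun s => s⁻¹) (by simpa using hinv) (by simpa using hinv)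
          (by simp) (by simp) (by simp)
      have hz : ∀ n, ∑ s ∈ T, walk T n (s * z) = T.card * walk T (n + 1) z := by
        intro n
        simp only [walk]
        field_simp
      rw [this, hf, Finset.sum_add_distrib, hz, hz]
      ring
    have hQ : (∑ t ∈ T, (∑' y, (f y - f ((x * t)⁻¹ * y)) * (f y - f (s * y))) / e s) / T.card =
        (∑' y, (f y - (walk T (k + 1) (x⁻¹ * y) + walk T (k + 2) (x⁻¹ * y))) *
          (f y - f (s * y))) / e s := by
      rw [← Finset.sum_div, div_right_comm,
        ← Summable.tsum_finsetSum fun t _ => summable_mul_of_support (hw (x * t)), ← tsum_div_const]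
      congr 1
      refine tsum_congr fun y => ?_
      rw [← Finset.sum_mul, Finset.sum_sub_distrib]
      simp only [mul_inv_rev, mul_assoc, hP]
      simp only [Finset.sum_const, nsmul_eq_mul]
      field_simp
    have hw2 : (support fun y => f y - (walk T (k + 1) (x⁻¹ * y) +
        walk T (k + 2) (x⁻¹ * y))).Finite :=
      support_sub_finite hfs (support_add_finite
        (support_translate (walk_support_finite hinv _) _)
        (support_translate (walk_support_finite hinv _) _))
    rw [hQ, hsub _ _ hw2 (hw _)]
    refine hcs _ (support_sub_finite hw2 (hw _)) ε hε.le ?_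
    calc _ = ∑' y, (walk T k y - walk T (k + 2) y) ^ 2 := by
          rw [← (Equiv.mulLeft x⁻¹).tsum_eq fun y => (walk T k y - walk T (k + 2) y) ^ 2]
          refine tsum_congr fun y => ?_
          simp only [hf, Equiv.coe_mulLeft]
          ring
      _ ≤ ε ^ 2 * (4 / T.card ^ 2 : ℝ) * energyDrop T k := by
          rw [← energyDrop_sub hinv]; exact hslow
      _ ≤ ε ^ 2 * e s := by
          rw [mul_assoc]; exact mul_le_mul_of_nonneg_left hes (by positivity)
  · simp only [inv_inv, ← sq]
    exact div_self hes0.ne'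

/-- An infinite group of polynomial growth carries a nonconstant Lipschitz harmonic function. -/
theorem exists_lipHarm_ne_zero [Infinite G] {d : ℕ} (hG : PG d G) (hinv : ∀ s ∈ T, s⁻¹ ∈ T)
    (h1 : (1 : G) ∈ T) (hT : Subgroup.closure (T : Set G) = ⊤) :
    ∃ u ∈ lipHarm T, u ≠ 0 := by
  have hq : (0 : ℝ) < T.card := by exact_mod_cast Finset.card_pos.2 ⟨_, h1⟩
  choose u hu1 hulip huharm hus using fun n : ℕ =>
    exists_almost_harmonic hG hinv h1 hT (Nat.one_div_pos_of_nat (α := ℝ) (n := n))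
  have hbd : ∀ g : G, ∃ B, ∀ n y, |u n (y * g) - u n y| ≤ B := by
    intro g
    have hg : g ∈ Subgroup.closure (T : Set G) := hT ▸ Subgroup.mem_top g
    induction hg using Subgroup.closure_induction with
    | mem s hs => exact ⟨1, fun n y => hulip n y s hs⟩
    | one => exact ⟨0, by simp⟩
    | mul a b _ _ iha ihb =>
      obtain ⟨A, hA⟩ := iha
      obtain ⟨B, hB⟩ := ihb
      refine ⟨A + B, fun n y => ?_⟩
      have e : u n (y * (a * b)) - u n y =
          (u n (y * a) - u n y) + (u n (y * a * b) - u n (y * a)) := by rw [mul_assoc]; ring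
      rw [e]
      exact (abs_add_le _ _).trans (add_le_add (hA n y) (hB n _))
    | inv a _ ih =>
      obtain ⟨A, hA⟩ := ih
      refine ⟨A, fun n y => ?_⟩
      have := hA n (y * a⁻¹)
      rwa [inv_mul_cancel_right, abs_sub_comm] at this
  let U : Ultrafilter ℕ := hyperfilter ℕ
  have hU : (U : Filter ℕ) ≤ atTop := Nat.hyperfilter_le_atTop
  have hlim : ∀ g, ∃ a, Tendsto (fun n => u n g) U (nhds a) := by
    intro g
    obtain ⟨B, hB⟩ := hbd g
    obtain ⟨a, -, ha⟩ := (isCompact_Icc (a := -B) (b := B)).ultrafilter_le_nhds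
      (U.map fun n => u n g) (by
        rw [le_principal_iff]
        refine Filter.mem_map.2 (Eventually.of_forall fun n => abs_le.1 ?_)
        simpa [hu1] using hB n 1)
    exact ⟨a, ha⟩
  choose v hv using hlim
  refine ⟨v, ⟨fun x => ?_, ?_, 1, fun x s hs => ?_⟩, ?_⟩
  · have t1 : Tendsto (fun n => (∑ s ∈ T, u n (x * s)) / T.card - u n x) U
        (nhds ((∑ s ∈ T, v (x * s)) / T.card - v x)) :=
      ((tendsto_finsetSum _ fun s _ => hv (x * s)).div_const _).sub (hv x)
    have t2 : Tendsto (fun n => (∑ s ∈ T, u n (x * s)) / T.card - u n x) U (nhds 0) :=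
      (squeeze_zero_norm (fun n => huharm n x) tendsto_one_div_add_atTop_nhds_zero_nat).mono_left hU
    exact sub_eq_zero.1 (tendsto_nhds_unique t1 t2)
  · refine tendsto_nhds_unique (hv 1) ?_
    simp [hu1]
  · exact le_of_tendsto' ((hv _).sub (hv _)).abs fun n => hulip n x s hs
  · rintro rfl
    have t : Tendsto (fun n => ∑ s ∈ T, |u n s|) U (nhds (∑ s ∈ T, |(0 : G → ℝ) s|)) :=
      tendsto_finsetSum _ fun s _ => (hv s).abs
    have h := ge_of_tendsto' t (b := 1) fun n => by
      obtain ⟨s, hs, h⟩ := hus n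
      have := Finset.single_le_sum (f := fun s => |u n s|) (fun s _ => abs_nonneg _) hs
      simpa [h] using this
    norm_num at h

end Existence

open scoped commutatorElement
set_option linter.unusedSectionVars false

section Unitary
variable {E : Type*} [NormedRing E] [NormedAlgebra ℝ E] [StarRing E] [CStarRing E]

theorem norm_unitary_mul_sub (u v w : unitary E) : ‖((u * v : unitary E) : E) - (u * w : unitary E)‖ = ‖(v : E) - w‖ := by
  rw [Submonoid.coe_mul, Submonoid.coe_mul, ← mul_sub, CStarRing.norm_coe_unitary_mul]

theorem norm_mul_unitary_sub (u v w : unitary E) : ‖((v * u : unitary E) : E) - (w * u : unitary E)‖ = ‖(v : E) - w‖ := by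
  rw [Submonoid.coe_mul, Submonoid.coe_mul, ← sub_mul, CStarRing.norm_mul_coe_unitary]

/-- Distance of a unitary to the identity. -/
noncomputable def dev (u : unitary E) : ℝ := ‖(u : E) - 1‖

theorem dev_nonneg (u : unitary E) : 0 ≤ dev u := norm_nonneg _

theorem dev_one : dev (1 : unitary E) = 0 := by simp [dev]

theorem dev_eq_zero {u : unitary E} : dev u = 0 ↔ u = 1 := by
  rw [dev, norm_eq_zero, sub_eq_zero]
  exact ⟨fun h => Subtype.ext h, fun h => by rw [h]; rfl⟩

theorem dev_inv_mul (u v : unitary E) : dev (u⁻¹ * v) = ‖(v : E) - u‖ := by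
  rw [← norm_unitary_mul_sub u⁻¹ v u, inv_mul_cancel]; rfl

theorem dev_mul_inv (u v : unitary E) : dev (u * v⁻¹) = ‖(u : E) - v‖ := by
  rw [← norm_mul_unitary_sub v⁻¹ u v, mul_inv_cancel]; rfl

theorem dev_inv (u : unitary E) : dev u⁻¹ = dev u := by
  rw [← mul_one u⁻¹, dev_inv_mul, dev, norm_sub_rev]; rfl

theorem dev_mul_le (u v : unitary E) : dev (u * v) ≤ dev u + dev v := by
  have h := dev_mul_inv u v⁻¹
  rw [inv_inv] at h
  rw [h, ← dev_inv v, dev, dev, ← norm_neg ((v⁻¹ : unitary E) - 1 : E), neg_sub]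
  exact norm_sub_le_norm_sub_add_norm_sub _ _ _

theorem dev_pow_le (u : unitary E) (n : ℕ) : dev (u ^ n) ≤ n * dev u := by
  induction n with
  | zero => simp [dev_one]
  | succ n ih =>
    rw [pow_succ]
    refine (dev_mul_le _ _).trans ?_
    push_cast
    linarith

theorem dev_conj (a h : unitary E) : dev (a * h * a⁻¹) = dev h := by
  rw [dev_mul_inv, ← mul_one a, mul_assoc, norm_unitary_mul_sub, one_mul]; rfl

theorem dev_commutator_le (a h : unitary E) : dev ⁅a, h⁆ ≤ 2 * dev a * dev h := by
  have : ⁅a, h⁆ = a * h * (h * a)⁻¹ := by rw [commutatorElement_def]; group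
  rw [this, dev_mul_inv]
  have e : ((a * h : unitary E) : E) - (h * a : unitary E) =
      ((a : E) - 1) * (h - 1) - (h - 1) * (a - 1) := by
    push_cast
    noncomm_ring
  rw [e]
  refine (norm_sub_le _ _).trans ?_
  have h1 := norm_mul_le ((a : E) - 1) (h - 1)
  have h2 := norm_mul_le ((h : E) - 1) (a - 1)
  simp only [dev]
  linarith

theorem le_dev_pow (u : unitary E) (n : ℕ) :
    n * dev u - n ^ 2 * dev u ^ 2 ≤ dev (u ^ n) := by
  have key : ‖((u ^ n : unitary E) : E) - 1 - n * ((u : E) - 1)‖ ≤ n ^ 2 * dev u ^ 2 := by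
    induction n with
    | zero => simp
    | succ n ih =>
      have e : ((u ^ (n + 1) : unitary E) : E) - 1 - (n + 1 : ℕ) * ((u : E) - 1) =
          (((u ^ n : unitary E) : E) - 1) * ((u : E) - 1) +
            (((u ^ n : unitary E) : E) - 1 - n * ((u : E) - 1)) := by
        push_cast
        rw [pow_succ]
        noncomm_ring
      rw [e]
      refine (norm_add_le _ _).trans ?_
      have h1 := norm_mul_le (((u ^ n : unitary E) : E) - 1) (u - 1)
      have h2 := mul_le_mul_of_nonneg_right (dev_pow_le u n) (dev_nonneg u)
      simp only [dev] at *
      rw [Nat.cast_succ]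
      have := sq_nonneg ‖(u : E) - 1‖
      have := mul_nonneg (Nat.cast_nonneg (α := ℝ) n) this
      nlinarith
  have h3 : ‖(n : E) * ((u : E) - 1)‖ = n * dev u := by
    rw [← nsmul_eq_mul, RCLike.norm_nsmul ℝ, nsmul_eq_mul]; rfl
  have h4 := norm_sub_norm_le ((n : E) * ((u : E) - 1)) (((u ^ n : unitary E) : E) - 1)
  rw [norm_sub_rev ((n : E) * _)] at h4
  have : dev (u ^ n) = ‖((u ^ n : unitary E) : E) - 1‖ := rfl
  linarith

theorem eq_one_of_dev_pow_le {z : unitary E} (h : ∀ n : ℕ, dev (z ^ n) ≤ 1 / 8) : z = 1 := by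
  have key : ∀ k : ℕ, (3 / 2 : ℝ) ^ k * dev z ≤ dev (z ^ 2 ^ k) := by
    intro k
    induction k with
    | zero => simp
    | succ k ih =>
      have h1 := le_dev_pow (z ^ 2 ^ k) 2
      rw [← pow_mul, ← pow_succ] at h1
      have h2 := h (2 ^ k)
      have h3 := dev_nonneg (z ^ 2 ^ k)
      push_cast at h1
      rw [pow_succ]
      nlinarith
  by_contra hz
  have hpos : 0 < dev z := (dev_nonneg z).lt_of_ne' (mt dev_eq_zero.1 hz)
  obtain ⟨k, hk⟩ := pow_unbounded_of_one_lt (1 / dev z) (by norm_num : (1 : ℝ) < 3 / 2)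
  rw [div_lt_iff₀ hpos] at hk
  linarith [key k, h (2 ^ k)]

theorem commutator_eq_one_of_commute {a h : unitary E} (hh : dev h ≤ 1 / 16)
    (ha : Commute a ⁅a, h⁆) : ⁅a, h⁆ = 1 := by
  apply eq_one_of_dev_pow_le
  intro n
  have e : a ^ n * h * (a ^ n)⁻¹ = ⁅a, h⁆ ^ n * h := by
    induction n with
    | zero => simp
    | succ n ih =>
      have h1 : a ^ (n + 1) * h * (a ^ (n + 1))⁻¹ = a * (a ^ n * h * (a ^ n)⁻¹) * a⁻¹ := by
        rw [pow_succ']; group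
      rw [h1, ih, ← mul_assoc, (ha.pow_right n).eq, pow_succ, commutatorElement_def]
      group
  have h2 : ⁅a, h⁆ ^ n = a ^ n * h * (a ^ n)⁻¹ * h⁻¹ := by rw [e, mul_inv_cancel_right]
  rw [h2]
  refine (dev_mul_le _ _).trans ?_
  rw [dev_conj, dev_inv]
  linarith

variable {G : Type*} [Group G]

theorem exists_noncommuting_chain (M : G →* unitary E) {ε : ℝ} (hε : ε ≤ 1 / 16) {a b : G}
    (ha : dev (M a) < ε) (hb : dev (M b) < ε) (hab : ¬ Commute (M a) (M b)) :
    ∃ A : Set G, A.Finite ∧ 1 ∈ A ∧ ∃ h : ℕ → G, ∀ k, h k ∈ A ^ 4 ^ k ∧ 0 < dev (M (h k)) ∧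
      dev (M (h k)) < ε ∧ dev (M (h (k + 1))) ≤ 2 * ε * dev (M (h k)) := by
  set A : Set G := {1, a, a⁻¹, b, b⁻¹} with hA
  let P : ℕ → G → Prop := fun k h => h⁻¹ ∈ A ^ 4 ^ k ∧ h ∈ A ^ 4 ^ k ∧ dev (M h) < ε ∧
    ¬ (Commute (M a) (M h) ∧ Commute (M b) (M h))
  have h1A : (1 : G) ∈ A := by simp [hA]
  have step : ∀ k h, P k h → ∃ h', P (k + 1) h' ∧ dev (M h') ≤ 2 * ε * dev (M h) := by
    rintro k h ⟨hi, hm, hd, hc⟩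
    obtain ⟨x, hx, hx', hxd, hxc⟩ : ∃ x, x ∈ A ∧ x⁻¹ ∈ A ∧ dev (M x) < ε ∧ ¬ Commute (M x) (M h) ∧
        (Commute (M a) (M ⁅x, h⁆) ∧ Commute (M b) (M ⁅x, h⁆) → Commute (M x) (M ⁅x, h⁆)) := by
      by_cases hca : Commute (M a) (M h)
      · exact ⟨b, by simp [hA], by simp [hA], hb, fun h => hc ⟨hca, h⟩, fun h => h.2⟩
      · exact ⟨a, by simp [hA], by simp [hA], ha, hca, fun h => h.1⟩
    have hle : A ^ (1 + 4 ^ k + 1 + 4 ^ k) ⊆ A ^ 4 ^ (k + 1) := by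
      refine Set.pow_subset_pow_right h1A ?_
      have := Nat.one_le_pow k 4 (by norm_num)
      rw [pow_succ 4 k]
      omega
    have hdev : dev (M ⁅x, h⁆) ≤ 2 * ε * dev (M h) := by
      rw [map_commutatorElement]
      refine (dev_commutator_le _ _).trans ?_
      have := dev_nonneg (M h)
      gcongr
    refine ⟨⁅x, h⁆, ⟨hle ?_, hle ?_, ?_, fun hcc => hxc.1 ?_⟩, hdev⟩
    · rw [commutatorElement_inv, commutatorElement_def]
      have : A ^ (1 + 4 ^ k + 1 + 4 ^ k) = A ^ 4 ^ k * A * A ^ 4 ^ k * A := by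
        simp only [← pow_succ, ← pow_add]; congr 1; omega
      rw [this]
      exact Set.mul_mem_mul (Set.mul_mem_mul (Set.mul_mem_mul hm hx) hi) hx'
    · rw [commutatorElement_def, pow_add, pow_add, pow_add, pow_one]
      exact Set.mul_mem_mul (Set.mul_mem_mul (Set.mul_mem_mul hx hm) hx') hi
    · have := dev_nonneg (M h)
      nlinarith
    · rw [← commutatorElement_eq_one_iff_commute]
      have h2 := hxc.2 hcc
      rw [map_commutatorElement] at h2
      exact commutator_eq_one_of_commute (hd.le.trans hε) h2
  choose! f hf using step
  let h : ℕ → G := fun k => Nat.rec b f k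
  have hP : ∀ k, P k (h k) := by
    intro k
    induction k with
    | zero => exact ⟨by simp [hA, h], by simp [hA, h], hb, fun h => hab h.1⟩
    | succ k ih => exact (hf k _ ih).1
  refine ⟨A, by simp [hA], h1A, h, fun k => ⟨(hP k).2.1, ?_, (hP k).2.2.1, (hf k _ (hP k)).2⟩⟩
  refine (dev_nonneg _).lt_of_ne' fun h0 => (hP k).2.2.2 ?_
  rw [dev_eq_zero.1 h0]
  exact ⟨Commute.one_right _, Commute.one_right _⟩

theorem exists_many_products (M : G →* unitary E) {ε : ℝ} {m : ℕ} (hm : 1 ≤ m)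
    (hε : 16 * m * ε < 1) {A : Set G} (h1 : 1 ∈ A) {h : ℕ → G}
    (hh : ∀ k, h k ∈ A ^ 4 ^ k ∧ 0 < dev (M (h k)) ∧
      dev (M (h k)) < ε ∧ dev (M (h (k + 1))) ≤ 2 * ε * dev (M (h k))) (n : ℕ) :
    ∀ k, ∃ X : Finset G, X.card = (m + 1) ^ n ∧ (∃ e, e + m * 4 ^ k ≤ m * 4 ^ (k + n) ∧
      ∀ x ∈ X, x ∈ A ^ e) ∧ (∀ x ∈ X, dev (M x) ≤ 2 * m * dev (M (h k))) ∧ InjOn M X := by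
  classical
  have hm' : (1 : ℝ) ≤ m := by exact_mod_cast hm
  induction n with
  | zero =>
    intro k
    exact ⟨{1}, by simp, ⟨0, by simp, by simp⟩, by
      simpa [dev_one] using mul_nonneg (by positivity : (0 : ℝ) ≤ 2 * m) (dev_nonneg _), by simp⟩
  | succ n ih =>
    intro k
    obtain ⟨X, hXc, ⟨e, he, hXe⟩, hXd, hXi⟩ := ih (k + 1)
    obtain ⟨hkA, hk0, hkε, hk1⟩ := hh k
    have hε0 : 0 < ε := hk0.trans hkε
    have hd2 : ∀ x ∈ X, dev (M x) ≤ 2 * m * (2 * ε * dev (M (h k))) := fun x hx =>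
      (hXd x hx).trans (by gcongr)
    let F : ℕ × G → G := fun p => h k ^ p.1 * p.2
    have key : ∀ i j x y, i ≤ j → j ≤ m → x ∈ X → y ∈ X → M (F (i, x)) = M (F (j, y)) →
        i = j ∧ x = y := by
      intro i j x y hij hjm hx hy hF
      obtain ⟨r, rfl⟩ := Nat.exists_eq_add_of_le hij
      have e1 : M x = M (h k) ^ r * M y := by
        simp only [F, map_mul, map_pow, pow_add, mul_assoc] at hF
        exact mul_left_cancel hF
      rcases Nat.eq_zero_or_pos r with rfl | hr
      · refine ⟨rfl, hXi hx hy ?_⟩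
        simpa using e1
      exfalso
      have e2 : M (h k) ^ r = M x * (M y)⁻¹ := by rw [e1, mul_inv_cancel_right]
      have e3 := dev_mul_le (M x) (M y)⁻¹
      rw [dev_inv, ← e2] at e3
      have e4 := le_dev_pow (M (h k)) r
      have hrm : (r : ℝ) ≤ m := by exact_mod_cast (by omega : r ≤ m)
      have hr1 : (1 : ℝ) ≤ r := by exact_mod_cast hr
      have e5 := hd2 x hx
      have e6 := hd2 y hy
      have e7 : (r : ℝ) * dev (M (h k)) ≤ m * ε := by gcongr
      have e8 : (r : ℝ) ^ 2 * dev (M (h k)) ^ 2 ≤ (m * ε) * (r * dev (M (h k))) := by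
        rw [← mul_pow, sq]; gcongr
      have e9 : (m * ε) * (r * dev (M (h k))) ≤ 1 / 16 * (r * dev (M (h k))) := by
        gcongr; linarith
      have e10 : (m * ε) * dev (M (h k)) ≤ 1 / 16 * dev (M (h k)) := by
        gcongr; linarith
      have e11 : dev (M (h k)) ≤ r * dev (M (h k)) := le_mul_of_one_le_left hk0.le hr1
      nlinarith
    have key' : ∀ p ∈ Finset.range (m + 1) ×ˢ X, ∀ p' ∈ Finset.range (m + 1) ×ˢ X,
        M (F p) = M (F p') → p = p' := by
      rintro ⟨i, x⟩ hp ⟨j, y⟩ hp' hF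
      simp only [Finset.mem_product, Finset.mem_range, Nat.lt_succ_iff] at hp hp'
      rcases le_total i j with hij | hij
      · obtain ⟨rfl, rfl⟩ := key i j x y hij hp'.1 hp.2 hp'.2 hF; rfl
      · obtain ⟨rfl, rfl⟩ := key j i y x hij hp.1 hp'.2 hp.2 hF.symm; rfl
    refine ⟨(Finset.range (m + 1) ×ˢ X).image F, ?_, ⟨m * 4 ^ k + e, ?_, ?_⟩, ?_, ?_⟩
    · rw [Finset.card_image_of_injOn fun p hp p' hp' hF => key' p hp p' hp' (by
        rw [show F p = F p' from hF]), Finset.card_product, Finset.card_range, hXc, pow_succ']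
    · have e1 : k + 1 + n = k + (n + 1) := by omega
      rw [e1, pow_succ 4 k, ← mul_assoc] at he
      omega
    · simp only [Finset.mem_image, Finset.mem_product, Finset.mem_range, Nat.lt_succ_iff]
      rintro _ ⟨⟨i, x⟩, ⟨hi, hx⟩, rfl⟩
      rw [pow_add]
      refine Set.mul_mem_mul ?_ (hXe x hx)
      refine Set.pow_subset_pow_right h1 (Nat.mul_le_mul_right (4 ^ k) hi) ?_
      rw [mul_comm, pow_mul]
      exact Set.pow_mem_pow hkA
    · simp only [Finset.mem_image, Finset.mem_product, Finset.mem_range, Nat.lt_succ_iff]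
      rintro _ ⟨⟨i, x⟩, ⟨hi, hx⟩, rfl⟩
      simp only [F, map_mul, map_pow]
      refine (dev_mul_le _ _).trans ?_
      have e1 := dev_pow_le (M (h k)) i
      have e2 := hd2 x hx
      have hi' : (i : ℝ) ≤ m := by exact_mod_cast hi
      have e3 : (i : ℝ) * dev (M (h k)) ≤ m * dev (M (h k)) := by gcongr
      have e4 : ε ≤ 1 / 16 := by nlinarith
      have e5 : ε * (m * dev (M (h k))) ≤ 1 / 16 * (m * dev (M (h k))) := by gcongr
      have e6 : 0 ≤ m * dev (M (h k)) := by positivity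
      nlinarith
    · intro u hu v hv huv
      obtain ⟨p, hp, rfl⟩ := Finset.mem_image.1 hu
      obtain ⟨p', hp', rfl⟩ := Finset.mem_image.1 hv
      rw [key' p hp p' hp' huv]

/-- In a group of polynomial growth, elements acting by unitaries close to the identity have
commuting images. -/
theorem commute_of_dev_lt {d : ℕ} (hG : PG d G) (M : G →* unitary E) :
    ∃ ε : ℝ, 0 < ε ∧ ∀ a b : G, dev (M a) < ε → dev (M b) < ε → Commute (M a) (M b) := by
  set m : ℕ := 4 ^ d with hm
  have hm1 : 1 ≤ m := Nat.one_le_pow _ _ (by norm_num)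
  have hm1' : (1 : ℝ) ≤ m := by exact_mod_cast hm1
  refine ⟨1 / (17 * m), by positivity, fun a b ha hb => ?_⟩
  by_contra hab
  have hε : 1 / (17 * m : ℝ) ≤ 1 / 16 := by
    rw [div_le_div_iff₀] <;> linarith
  obtain ⟨A, hA, h1A, h, hh⟩ := exists_noncommuting_chain M hε ha hb hab
  obtain ⟨C, hC⟩ := hG A hA
  have hbound : ∀ n : ℕ, (((m : ℝ) + 1) / m) ^ n ≤ C * (m + 1) ^ d := by
    intro n
    obtain ⟨X, hXc, ⟨e, he, hXe⟩, -, -⟩ := exists_many_products M hm1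
      (by rw [mul_one_div, div_lt_one] <;> nlinarith) h1A hh n 0
    have h1 : (X.card : ℝ) ≤ ((A ^ (m * 4 ^ n)).ncard : ℝ) := by
      rw [← Set.ncard_coe_finset]
      exact_mod_cast Set.ncard_le_ncard (fun x hx => Set.pow_subset_pow_right h1A
        (by rw [zero_add] at he; omega) (hXe x hx)) (finite_pow hA _)
    have h2 := h1.trans (hC _)
    rw [hXc] at h2
    push_cast at h2
    have hC0 : 0 ≤ C := by
      have := (Nat.cast_nonneg _).trans (hC 0)
      simpa using this
    rw [div_pow, div_le_iff₀ (by positivity)]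
    refine h2.trans ?_
    rw [mul_assoc]
    refine mul_le_mul_of_nonneg_left ?_ hC0
    have h3 : (m : ℝ) ^ n = (4 ^ n) ^ d := by rw [hm]; push_cast; rw [← pow_mul, ← pow_mul, mul_comm]
    rw [h3, ← mul_pow]
    gcongr
    have : (1 : ℝ) ≤ 4 ^ n := one_le_pow₀ (by norm_num)
    nlinarith
  obtain ⟨n, hn⟩ := pow_unbounded_of_one_lt (C * (m + 1) ^ d)
    (by rw [one_lt_div] <;> linarith : (1 : ℝ) < ((m : ℝ) + 1) / m)
  exact absurd (hbound n) (not_le.2 hn)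

theorem exists_finiteIndex_commute [ProperSpace E] {d : ℕ} (hG : PG d G) (M : G →* unitary E) :
    ∃ H : Subgroup G, H.FiniteIndex ∧ ∀ a ∈ H, ∀ b ∈ H, Commute (M a) (M b) := by
  obtain ⟨ε, hε, hc⟩ := commute_of_dev_lt hG M
  refine ⟨Subgroup.closure {g | dev (M g) < ε}, ?_, fun a ha b hb => ?_⟩
  · set H := Subgroup.closure {g | dev (M g) < ε}
    have hb : TotallyBounded (Set.range fun g => ((M g : unitary E) : E)) := by
      refine ((isCompact_closedBall (0 : E) ‖(1 : E)‖).totallyBounded).subset ?_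
      rintro _ ⟨g, rfl⟩
      rw [mem_closedBall_zero_iff]
      change ‖((M g : unitary E) : E)‖ ≤ _
      rw [← mul_one ((M g : unitary E) : E),
        CStarRing.norm_coe_unitary_mul]
    obtain ⟨t, ht, htf, hcov⟩ := Metric.finite_approx_of_totallyBounded hb ε hε
    have ht' : ∀ y ∈ t, ∃ g, ((M g : unitary E) : E) = y := fun y hy => ht hy
    choose! s hs using ht'
    have hfin : (Set.range (fun g : G => (g : G ⧸ H))).Finite := by
      refine (htf.image fun y => ((s y : G) : G ⧸ H)).subset ?_
      rintro _ ⟨g, rfl⟩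
      obtain ⟨y, hy, hgy⟩ := Set.mem_iUnion₂.1 (hcov ⟨g, rfl⟩)
      refine ⟨y, hy, QuotientGroup.eq.2 (Subgroup.subset_closure ?_)⟩
      rw [Set.mem_ofPred_eq, map_mul, map_inv, dev_inv_mul]
      rw [Metric.mem_ball, ← hs y hy, dist_eq_norm] at hgy
      exact hgy
    have : Finite (G ⧸ H) := by
      rw [← Set.finite_univ_iff]
      refine hfin.subset fun q _ => ?_
      obtain ⟨g, rfl⟩ := QuotientGroup.mk_surjective q
      exact ⟨g, rfl⟩
    exact Subgroup.finiteIndex_of_finite_quotient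
  · induction ha, hb using Subgroup.closure_induction₂ with
    | mem x y hx hy => exact hc x y hx hy
    | one_left x hx => simp
    | one_right x hx => simp
    | mul_left x y z _ _ _ h1 h2 => rw [map_mul]; exact h1.mul_left h2
    | mul_right y z x _ _ _ h1 h2 => rw [map_mul]; exact h1.mul_right h2
    | inv_left x y _ _ h => rw [map_inv]; exact h.inv_left
    | inv_right x y _ _ h => rw [map_inv]; exact h.inv_right

end Unitary

section IntegerQuotient
set_option linter.unusedSectionVars false

theorem exists_surjective_int_of_addCommGroup (A : Type*) [AddCommGroup A] [AddGroup.FG A]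
    [Infinite A] : ∃ φ : A →+ ℤ, Surjective φ := by
  obtain ⟨n, ι, _, p, hp, e, ⟨E⟩⟩ := AddCommGroup.equiv_free_prod_directSum_zmod A
  rcases n with _ | n
  · exfalso
    have : ∀ i, NeZero (p i ^ e i) := fun i => ⟨pow_ne_zero _ (hp i).ne_zero⟩
    classical
    have : Finite (DirectSum ι fun i => ZMod (p i ^ e i)) :=
      Finite.of_equiv _ (DirectSum.addEquivProd fun i => ZMod (p i ^ e i)).symm.toEquiv
    have : Finite A := Finite.of_equiv _ E.symm.toEquiv
    exact not_finite A
  · refine ⟨((Finsupp.applyAddHom (0 : Fin (n + 1))).comp (AddMonoidHom.fst _ _)).comp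
      E.toAddMonoidHom, fun z => ⟨E.symm (Finsupp.single 0 z, 0), ?_⟩⟩
    simp

theorem exists_surjective_int {H A : Type*} [Group H] [Group.FG H] [Group A] (f : H →* A)
    (hc : ∀ a b, Commute (f a) (f b)) (hf : (Set.range f).Infinite) :
    ∃ φ : H →* Multiplicative ℤ, Surjective φ := by
  let _ : CommGroup f.range :=
    { (inferInstance : Group f.range) with
      mul_comm := by
        rintro ⟨_, a, rfl⟩ ⟨_, b, rfl⟩
        exact Subtype.ext (hc a b) }
  have : Group.FG f.range := Group.fg_range f
  have : AddGroup.FG (Additive f.range) := inferInstance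
  have : Infinite f.range := hf.to_subtype
  have : Infinite (Additive f.range) := inferInstance
  obtain ⟨φ, hφ⟩ := exists_surjective_int_of_addCommGroup (Additive f.range)
  exact ⟨(AddMonoidHom.toMultiplicativeRight φ).comp f.rangeRestrict,
    hφ.comp f.rangeRestrict_surjective⟩

variable {G : Type*} [Group G] {T : Finset G}

theorem Harm.eq_of_isMax (hinv : ∀ s ∈ T, s⁻¹ ∈ T) (hT : Subgroup.closure (T : Set G) = ⊤)
    {u : G → ℝ} (hu : Harm T u) {x₀ : G} (hx₀ : ∀ x, u x ≤ u x₀) (x : G) : u x = u x₀ := by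
  have step : ∀ s ∈ T, ∀ x, u x = u x₀ → u (x * s) = u x₀ := by
    intro s hs x hx
    have hq : (0 : ℝ) < T.card := by exact_mod_cast Finset.card_pos.2 ⟨_, hs⟩
    have h := hu x
    rw [hx, div_eq_iff hq.ne', mul_comm, ← nsmul_eq_mul, ← Finset.sum_const] at h
    exact (Finset.sum_eq_sum_iff_of_le fun s _ => hx₀ (x * s)).1 h s hs
  have key : ∀ g x, u x = u x₀ ↔ u (x * g) = u x₀ := by
    intro g
    have hg : g ∈ Subgroup.closure (T : Set G) := hT ▸ Subgroup.mem_top g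
    induction hg using Subgroup.closure_induction with
    | mem s hs =>
      exact fun x => ⟨step s hs x, fun h => by simpa using step _ (hinv s hs) _ h⟩
    | one => simp
    | mul a b _ _ ha hb => exact fun x => by rw [ha, hb, mul_assoc]
    | inv a _ ih => exact fun x => by rw [ih (x * a⁻¹), inv_mul_cancel_right]
  simpa using (key (x₀⁻¹ * x) x₀).1 rfl

/-- An infinite finitely generated group of polynomial growth virtually surjects onto `ℤ`. -/
theorem exists_finiteIndex_surjective_int [Infinite G] [Group.FG G] {d : ℕ} (hG : PG d G) :
    ∃ H : Subgroup G, H.FiniteIndex ∧ ∃ φ : H →* Multiplicative ℤ, Surjective φ := by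
  classical
  obtain ⟨T, hT, hinv, h1⟩ : ∃ T : Finset G, Subgroup.closure (T : Set G) = ⊤ ∧
      (∀ s ∈ T, s⁻¹ ∈ T) ∧ (1 : G) ∈ T := by
    obtain ⟨S, hS, hSf⟩ := Group.fg_iff.1 (inferInstance : Group.FG G)
    refine ⟨hSf.toFinset ∪ hSf.toFinset⁻¹ ∪ {1}, ?_, ?_, by simp⟩
    · rw [eq_top_iff, ← hS]
      refine Subgroup.closure_mono fun x hx => ?_
      simp [hx]
    · intro s
      simp only [Finset.mem_union, Finset.mem_inv', Finset.mem_singleton]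
      rintro ((h | h) | rfl)
      · simp [h]
      · simp [h]
      · simp
  obtain ⟨u, hu, hu0⟩ := exists_lipHarm_ne_zero hG hinv h1 hT
  obtain ⟨m, M, hM⟩ := exists_harmonic_rep hG hinv h1 hT
  by_cases hK : M.ker.FiniteIndex
  · refine ⟨M.ker, hK, ?_⟩
    have hadd : ∀ h ∈ M.ker, ∀ x, u (h * x) = u h + u x := by
      intro h hh x
      have := hM h⁻¹ (by rw [map_inv, MonoidHom.mem_ker.1 hh, inv_one]) u hu x
      rw [inv_inv] at this
      linarith
    have hne : ∃ h ∈ M.ker, u h ≠ 0 := by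
      by_contra! hz
      have hfin : (Set.range u).Finite := by
        have : Finite (Quotient (QuotientGroup.rightRel M.ker)) :=
          Finite.of_equiv _ (QuotientGroup.quotientRightRelEquivQuotientLeftRel M.ker).symm
        refine (Set.finite_range (Quotient.lift (s := QuotientGroup.rightRel M.ker) u ?_)).subset ?_
        · intro a b hab
          have hab' := QuotientGroup.rightRel_apply.1 hab
          have := hadd _ hab' a
          rw [inv_mul_cancel_right, hz _ hab', zero_add] at this
          exact this.symm
        · rintro _ ⟨x, rfl⟩
          exact ⟨Quotient.mk _ x, rfl⟩
      obtain ⟨_, ⟨x₀, rfl⟩, hx₀⟩ := hfin.exists_maximal ⟨u 1, 1, rfl⟩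
      have hmax : ∀ x, u x ≤ u x₀ := fun x => (le_total (u x) (u x₀)).elim id fun h => hx₀ ⟨x, rfl⟩ h
      have hc := Harm.eq_of_isMax hinv hT hu.1 hmax
      refine hu0 (funext fun x => ?_)
      rw [hc x, ← hc 1, hu.2.1]; rfl
    obtain ⟨h, hh, hne⟩ := hne
    let f : M.ker →* Multiplicative ℝ :=
      { toFun := fun x => Multiplicative.ofAdd (u x)
        map_one' := by rw [Subgroup.coe_one, hu.2.1]; rfl
        map_mul' := fun a b => by rw [Subgroup.coe_mul, hadd _ a.2]; rfl }
    refine exists_surjective_int f (fun a b => Commute.all _ _) ?_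
    have hinj : Injective fun n : ℕ => f (⟨h, hh⟩ ^ n) := by
      intro a b hab
      have hab' : (a : ℕ) • u h = b • u h := by
        have := congrArg Multiplicative.toAdd hab
        simp only [map_pow, toAdd_pow] at this
        exact this
      rw [nsmul_eq_mul, nsmul_eq_mul] at hab'
      exact_mod_cast mul_right_cancel₀ hne hab'
    exact (Set.infinite_range_of_injective hinj).mono (by rintro _ ⟨n, rfl⟩; exact ⟨_, rfl⟩)
  · open Matrix.Norms.L2Operator in
    have : ProperSpace (Matrix (Fin m) (Fin m) ℝ) := FiniteDimensional.proper ℝ _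
    obtain ⟨H, hH, hc⟩ := exists_finiteIndex_commute hG M
    refine ⟨H, hH, exists_surjective_int (M.comp H.subtype) (fun a b => hc a a.2 b b.2) ?_⟩
    intro hfin
    apply hK
    have h1 : (M.comp H.subtype).ker.index ≠ 0 := by
      rw [Subgroup.index_ker]
      have : Finite (M.comp H.subtype).range := hfin.to_subtype
      exact Nat.card_pos.ne'
    have h2 : (M.ker ⊓ H).index ≠ 0 := by
      rw [← Subgroup.relIndex_mul_index (inf_le_right : M.ker ⊓ H ≤ H), Subgroup.inf_relIndex_right]
      exact mul_ne_zero h1 hH.index_ne_zero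
    have : (M.ker ⊓ H).FiniteIndex := ⟨h2⟩
    exact Subgroup.finiteIndex_of_le (inf_le_left : M.ker ⊓ H ≤ M.ker)

end IntegerQuotient

section Unipotent
open Polynomial

theorem norm_lt_two_of_pow_eq_sum {z : ℂ} {n : ℕ} {ε : ℕ → ℤ} (hε : ∀ j, |ε j| ≤ 1)
    (h : z ^ n = ∑ j ∈ Finset.range n, (ε j : ℂ) * z ^ j) : ‖z‖ < 2 := by
  by_contra! hz
  have h1 : ‖z‖ ^ n ≤ ∑ j ∈ Finset.range n, ‖z‖ ^ j := by
    rw [← norm_pow, h]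
    refine (norm_sum_le _ _).trans (Finset.sum_le_sum fun j _ => ?_)
    rw [norm_mul, norm_pow]
    refine mul_le_of_le_one_left (by positivity) ?_
    rw [Complex.norm_intCast]
    exact_mod_cast hε j
  have h2 := mul_geom_sum ‖z‖ n
  have h3 : (0 : ℝ) ≤ ∑ j ∈ Finset.range n, ‖z‖ ^ j := by positivity
  nlinarith

theorem dvd_X_pow_sub_one_pow {P : ℂ[X]} (hP : P ≠ 0) {m : ℕ} (h : ∀ z ∈ P.roots, z ^ m = 1) :
    P ∣ (X ^ m - 1) ^ P.natDegree := by
  have hs := IsAlgClosed.splits P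
  have e := hs.eq_prod_roots
  have hc : P.roots.card = P.natDegree := hs.natDegree_eq_card_roots.symm
  have h1 : (P.roots.map fun a => X - C a).prod ∣ (X ^ m - 1) ^ P.natDegree := by
    rw [← hc, ← Multiset.prod_replicate, ← Multiset.map_const']
    refine Multiset.prod_dvd_prod_of_dvd _ _ fun a ha => ?_
    rw [dvd_iff_isRoot]
    simp [IsRoot, h a ha]
  obtain ⟨Q, hQ⟩ := h1
  refine ⟨C (P.leadingCoeff)⁻¹ * Q, ?_⟩
  have h0 : P.leadingCoeff ≠ 0 := leadingCoeff_ne_zero.2 hP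
  have h1 : C P.leadingCoeff * C P.leadingCoeff⁻¹ = 1 := by
    rw [← C_mul, mul_inv_cancel₀ h0, C_1]
  rw [hQ]
  calc _ = (C P.leadingCoeff * (P.roots.map fun a => X - C a).prod) *
        (C P.leadingCoeff⁻¹ * Q) := by
        linear_combination (-((P.roots.map fun a => X - C a).prod * Q)) * h1
    _ = _ := by rw [← e]

theorem exists_pow_eq_one_of_conjugates {z : ℂ} (hz0 : z ≠ 0) (hz : IsIntegral ℤ z)
    (h : ∀ w : ℂ, aeval w (minpoly ℚ z) = 0 → ‖w‖ ≤ 1) : ∃ n, 0 < n ∧ z ^ n = 1 := by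
  have hzQ : IsIntegral ℚ z := hz.tower_top
  let K := IntermediateField.adjoin ℚ {z}
  have : FiniteDimensional ℚ K := IntermediateField.adjoin.finiteDimensional hzQ
  have : NumberField K := ⟨⟩
  let x : K := IntermediateField.AdjoinSimple.gen ℚ z
  have hx : algebraMap K ℂ x = z := IntermediateField.AdjoinSimple.algebraMap_gen ℚ z
  have hinj := (algebraMap K ℂ).injective
  obtain ⟨n, hn, hn1⟩ := NumberField.Embeddings.pow_eq_one_of_norm_le_one K ℂ (x := x)
    (by rintro h0; rw [h0, map_zero] at hx; exact hz0 hx.symm)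
    (by
      rw [← hx] at hz
      exact (isIntegral_algebraMap_iff hinj).1 hz)
    (fun φ => h _ (by
      have h1 : aeval x (minpoly ℚ z) = 0 := by
        have : algebraMap K ℂ (aeval x (minpoly ℚ z)) = 0 := by
          rw [← aeval_algebraMap_apply, hx, minpoly.aeval]
        exact hinj (by rw [this, map_zero])
      have : aeval (φ.toRatAlgHom x) (minpoly ℚ z) = 0 := by
        rw [aeval_algHom_apply, h1, map_zero]
      exact this))
  refine ⟨n, hn, ?_⟩
  rw [← hx, ← map_pow, hn1, map_one]

theorem exists_pow_sub_one_pow_eq_zero_of_free {A : Type*} [AddCommGroup A] [Module.Free ℤ A]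
    [Module.Finite ℤ A] (φ : Module.End ℤ A) (hφ : Injective φ)
    (h : ∀ m : ℕ, 1 ≤ m → ∃ q : ℤ[X], q.Monic ∧ aeval (φ ^ m) q = 0 ∧
      ∀ z : ℂ, aeval z q = 0 → ‖z‖ < 2) :
    ∃ m k : ℕ, 1 ≤ m ∧ (φ ^ m - 1) ^ k = 0 := by
  classical
  let ι := Module.Free.ChooseBasisIndex ℤ A
  let b : Module.Basis ι ℤ A := Module.Free.chooseBasis ℤ A
  let ψ : Module.End ℤ A →ₐ[ℤ] Matrix ι ι ℚ :=
    ((Algebra.ofId ℤ ℚ).mapMatrix).comp (LinearMap.toMatrixAlgEquiv b).toAlgHom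
  have hψ : Injective ψ := by
    refine Injective.comp (g := (Algebra.ofId ℤ ℚ).mapMatrix) ?_
      (LinearMap.toMatrixAlgEquiv b).injective
    intro M N hMN
    ext i j
    have := congrFun (congrFun hMN i) j
    simpa [Algebra.ofId_apply] using this
  have haev : ∀ (f : Module.End ℤ A) (q : ℤ[X]),
      aeval f q = 0 ↔ aeval (ψ f) (q.map (Int.castRingHom ℚ)) = 0 := by
    intro f q
    have : aeval (ψ f) (q.map (Int.castRingHom ℚ)) = ψ (aeval f q) := by
      rw [← aeval_algHom_apply, ← algebraMap_int_eq, aeval_map_algebraMap]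
    rw [this, map_eq_zero_iff ψ hψ]
  set P : ℚ[X] := minpoly ℚ (ψ φ) with hPdef
  have hInt : IsIntegral ℚ (ψ φ) := Algebra.IsIntegral.isIntegral _
  have hP0 : P ≠ 0 := minpoly.ne_zero hInt
  have hroot : ∀ z : ℂ, aeval z P = 0 → ∀ m, 1 ≤ m → ∃ q : ℤ[X], q.Monic ∧
      aeval (z ^ m) q = 0 ∧ ‖z ^ m‖ < 2 := by
    intro z hz m hm
    obtain ⟨q, hq, hq0, hqz⟩ := h m hm
    have h1 : P ∣ (q.map (Int.castRingHom ℚ)).comp (X ^ m) := by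
      apply minpoly.dvd
      rw [aeval_comp]
      simp only [map_pow, aeval_X]
      rw [← map_pow]
      exact (haev _ _).1 hq0
    obtain ⟨R, hR⟩ := h1
    have h2 : aeval (z ^ m) q = 0 := by
      have := congrArg (aeval z) hR
      rw [map_mul, hz, zero_mul, aeval_comp, ← algebraMap_int_eq, aeval_map_algebraMap] at this
      simpa using this
    exact ⟨q, hq, h2, hqz _ h2⟩
  have hle : ∀ z : ℂ, aeval z P = 0 → ‖z‖ ≤ 1 := by
    intro z hz
    by_contra! h1
    obtain ⟨m, hm⟩ := pow_unbounded_of_one_lt 2 h1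
    rcases Nat.eq_zero_or_pos m with rfl | hm0
    · norm_num at hm
    obtain ⟨-, -, -, h2⟩ := hroot z hz m hm0
    rw [norm_pow] at h2
    linarith
  have hne : ∀ z : ℂ, aeval z P = 0 → z ≠ 0 := by
    rintro z hz rfl
    have h0 : P.coeff 0 = 0 := by
      rw [← coeff_zero_eq_aeval_zero'] at hz
      simpa using hz
    obtain ⟨Q, hQ⟩ := X_dvd_iff.2 h0
    have h1 : ψ φ * aeval (ψ φ) Q = 0 := by
      have := congrArg (aeval (ψ φ)) hQ
      rw [hPdef, minpoly.aeval, map_mul, aeval_X] at this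
      exact this.symm
    have hunit : IsUnit (ψ φ) := by
      rw [Matrix.isUnit_iff_isUnit_det]
      have : (ψ φ).det = ((LinearMap.toMatrix b b φ).det : ℤ) := by
        change ((Algebra.ofId ℤ ℚ).mapMatrix (LinearMap.toMatrix b b φ)).det = _
        rw [← AlgHom.map_det]; simp
      rw [this, LinearMap.det_toMatrix, isUnit_iff_ne_zero, Int.cast_ne_zero]
      intro hd
      obtain ⟨v, hv, hv0⟩ := LinearMap.bot_lt_ker_of_det_eq_zero hd |> SetLike.exists_of_lt
      exact hv0 (by rw [LinearMap.ker_eq_bot.2 hφ] at hv; exact hv)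
    have h2 : aeval (ψ φ) Q = 0 := by
      have := hunit.mul_right_eq_zero.1 h1
      exact this
    have h3 := minpoly.dvd ℚ (ψ φ) h2
    rw [← hPdef, hQ] at h3
    have hQ0 : Q ≠ 0 := by rintro rfl; exact hP0 (by rw [hQ, mul_zero])
    have h4 := degree_le_of_dvd h3 hQ0
    rw [degree_mul, degree_X, degree_eq_natDegree hQ0] at h4
    norm_cast at h4
    omega
  have hunity : ∀ z : ℂ, aeval z P = 0 → ∃ n, 0 < n ∧ z ^ n = 1 := by
    intro z hz
    refine exists_pow_eq_one_of_conjugates (hne z hz) ?_ fun w hw => hle w ?_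
    · obtain ⟨q, hq, hqz, -⟩ := hroot z hz 1 le_rfl
      rw [pow_one] at hqz
      exact ⟨q, hq, hqz⟩
    · obtain ⟨R, hR⟩ := minpoly.dvd ℚ z hz
      rw [hR, map_mul, hw, zero_mul]
  choose! n hn hn1 using hunity
  set PC : ℂ[X] := P.map (algebraMap ℚ ℂ) with hPC
  have hPC0 : PC ≠ 0 := (Polynomial.map_ne_zero_iff (algebraMap ℚ ℂ).injective).2 hP0
  have hPCr : ∀ z ∈ PC.roots, aeval z P = 0 := by
    intro z hz
    rw [mem_roots hPC0, IsRoot, hPC, eval_map_algebraMap] at hz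
    exact hz
  set m : ℕ := ∏ z ∈ PC.roots.toFinset, n z with hm
  refine ⟨m, PC.natDegree, Finset.prod_pos fun z hz => hn z (hPCr z (Multiset.mem_toFinset.1 hz)), ?_⟩
  have h1 : PC ∣ (X ^ m - 1) ^ PC.natDegree := by
    refine dvd_X_pow_sub_one_pow hPC0 fun z hz => ?_
    obtain ⟨r, hr⟩ := Finset.dvd_prod_of_mem n (Multiset.mem_toFinset.2 hz)
    rw [hm, hr, pow_mul, hn1 z (hPCr z hz), one_pow]
  have h2 : P ∣ (X ^ m - 1) ^ PC.natDegree := by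
    rw [← map_dvd_map' (algebraMap ℚ ℂ)]
    simpa using h1
  have h3 : aeval φ (((X : ℤ[X]) ^ m - 1) ^ PC.natDegree) = 0 := by
    rw [haev]
    obtain ⟨R, hR⟩ := h2
    have : ((((X : ℤ[X]) ^ m - 1) ^ PC.natDegree).map (Int.castRingHom ℚ)) = P * R := by
      rw [← hR]; simp
    rw [this, map_mul, hPdef, minpoly.aeval, zero_mul]
  simpa using h3

theorem exists_annihilator {A : Type*} [AddCommGroup A] [Module.Finite ℤ A] (φ : Module.End ℤ A)
    (h : ∀ a : A, ∃ (n : ℕ) (ε : ℕ → ℤ), (∀ j, |ε j| ≤ 1) ∧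
      (φ ^ n) a = ∑ j ∈ Finset.range n, ε j • (φ ^ j) a) :
    ∃ q : ℤ[X], q.Monic ∧ aeval φ q = 0 ∧ ∀ z : ℂ, aeval z q = 0 → ‖z‖ < 2 := by
  have single : ∀ a : A, ∃ q : ℤ[X], q.Monic ∧ aeval φ q a = 0 ∧
      ∀ z : ℂ, aeval z q = 0 → ‖z‖ < 2 := by
    intro a
    obtain ⟨n, ε, hε, ha⟩ := h a
    refine ⟨X ^ n - ∑ j ∈ Finset.range n, C (ε j) * X ^ j, monic_X_pow_sub ?_, ?_, fun z hz => ?_⟩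
    · rw [Finset.sum_range]
      exact degree_sum_fin_lt fun j : Fin n => ε j
    · simp [ha, LinearMap.sum_apply]
    · refine norm_lt_two_of_pow_eq_sum hε (n := n) ?_
      simpa [sub_eq_zero] using hz
  choose q hq hqa hqz using single
  obtain ⟨s, hs⟩ := Module.Finite.fg_top (R := ℤ) (M := A)
  refine ⟨∏ a ∈ s, q a, monic_prod_of_monic _ _ fun a _ => hq a, ?_, fun z hz => ?_⟩
  · apply LinearMap.ext_on hs
    intro a ha
    obtain ⟨r, hr⟩ := Finset.dvd_prod_of_mem q ha
    rw [hr, mul_comm, map_mul, Module.End.mul_apply, hqa, map_zero, LinearMap.zero_apply]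
  · rw [map_prod, Finset.prod_eq_zero_iff] at hz
    obtain ⟨a, -, ha⟩ := hz
    exact hqz a z ha

theorem sub_one_pow_apply_mem {A : Type*} [AddCommGroup A] (φ : Module.End ℤ A) (m l k : ℕ)
    (B : Submodule ℤ A) (hB : ∀ x ∈ B, φ x ∈ B) {a : A} (h : ((φ ^ m - 1) ^ k) a ∈ B) :
    ((φ ^ (m * l) - 1) ^ k) a ∈ B := by
  have hc : ∀ q : ℤ[X], ∀ x ∈ B, aeval φ q x ∈ B := by
    intro q
    induction q using Polynomial.induction_on' with
    | add p q hp hq => intro x hx; rw [map_add]; exact B.add_mem (hp x hx) (hq x hx)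
    | monomial n c =>
      intro x hx
      rw [aeval_monomial, Module.End.mul_apply, Module.algebraMap_end_apply]
      refine B.smul_mem _ ?_
      induction n with
      | zero => simpa
      | succ n ih => rw [pow_succ', Module.End.mul_apply]; exact hB _ ih
  obtain ⟨r, hr⟩ : (X ^ m - 1 : ℤ[X]) ^ k ∣ (X ^ (m * l) - 1) ^ k := by
    apply pow_dvd_pow_of_dvd
    rw [pow_mul]
    simpa using sub_dvd_pow_sub_pow (X ^ m : ℤ[X]) 1 l
  have e := congrArg (aeval φ) hr
  rw [mul_comm ((X ^ m - 1 : ℤ[X]) ^ k) r, map_mul] at e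
  simp only [map_pow, map_sub, aeval_X, map_one] at e
  rw [e, Module.End.mul_apply]
  exact hc r _ h

/-- An injective endomorphism of a finitely generated abelian group, all of whose powers satisfy
orbit relations with coefficients in `{-1, 0, 1}`, is virtually unipotent. -/
theorem exists_pow_sub_one_pow_eq_zero {A : Type*} [AddCommGroup A] [Module.Finite ℤ A]
    (φ : Module.End ℤ A) (hφ : Injective φ)
    (h : ∀ m : ℕ, 1 ≤ m → ∀ a : A, ∃ (n : ℕ) (ε : ℕ → ℤ), (∀ j, |ε j| ≤ 1) ∧
      ((φ ^ m) ^ n) a = ∑ j ∈ Finset.range n, ε j • ((φ ^ m) ^ j) a) :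
    ∃ m k : ℕ, 1 ≤ m ∧ (φ ^ m - 1) ^ k = 0 := by
  set F := Submodule.torsion ℤ A with hF
  have hFφ : ∀ x, φ x ∈ F ↔ x ∈ F := by
    intro x
    simp only [hF, Submodule.mem_torsion_iff]
    refine exists_congr fun n => ?_
    rw [Submonoid.smul_def, Submonoid.smul_def, ← map_smul, map_eq_zero_iff φ hφ]
  have hFle : F ≤ F.comap φ := fun x hx => (hFφ x).2 hx
  let φF : Module.End ℤ (A ⧸ F) := F.mapQ F φ hFle
  have hmk : ∀ (n : ℕ) (x : A), (φF ^ n) (F.mkQ x) = F.mkQ ((φ ^ n) x) := by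
    intro n
    induction n with
    | zero => simp
    | succ n ih =>
      intro x
      rw [pow_succ', pow_succ', Module.End.mul_apply, Module.End.mul_apply, ih]
      rfl
  obtain ⟨m, k, hm, hk⟩ := exists_pow_sub_one_pow_eq_zero_of_free φF (by
      rw [injective_iff_map_eq_zero]
      intro y
      obtain ⟨x, rfl⟩ := F.mkQ_surjective y
      intro hx
      have : F.mkQ (φ x) = 0 := hx
      rw [Submodule.mkQ_apply, Submodule.Quotient.mk_eq_zero] at this ⊢
      exact (hFφ x).1 this) (by
      intro m hm
      refine exists_annihilator _ fun y => ?_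
      obtain ⟨x, rfl⟩ := F.mkQ_surjective y
      obtain ⟨n, ε, hε, hx⟩ := h m hm x
      refine ⟨n, ε, hε, ?_⟩
      simp only [← pow_mul] at hx ⊢
      rw [hmk, hx, map_sum]
      simp only [map_smul, hmk])
  have hFfin : Finite F := by
    have := Submodule.torsion_isTorsion (R := ℤ) (M := A)
    exact Module.finite_of_fg_torsion F this
  let σ : Equiv.Perm F := Equiv.ofBijective (fun x => ⟨φ x, (hFφ x).2 x.2⟩)
    (Finite.injective_iff_bijective.1 fun x y hxy => Subtype.ext (hφ (congrArg Subtype.val hxy)))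
  have hσ : ∀ (n : ℕ) (x : F), ((σ ^ n) x : A) = (φ ^ n) x := by
    intro n
    induction n with
    | zero => simp
    | succ n ih =>
      intro x
      rw [pow_succ', pow_succ', Module.End.mul_apply, Equiv.Perm.mul_apply, ← ih]
      rfl
  obtain ⟨l, hl, hl1⟩ := (isOfFinOrder_of_finite σ).exists_pow_eq_one
  refine ⟨m * l, k + 1, Nat.mul_pos hm hl, LinearMap.ext fun a => ?_⟩
  have h1 : ((φ ^ m - 1) ^ k) a ∈ F := by
    rw [← Submodule.Quotient.mk_eq_zero, ← Submodule.mkQ_apply]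
    have : ∀ (k : ℕ) (a : A), F.mkQ (((φ ^ m - 1) ^ k) a) = ((φF ^ m - 1) ^ k) (F.mkQ a) := by
      intro k
      induction k with
      | zero => simp
      | succ k ih =>
        intro a
        rw [pow_succ, pow_succ, Module.End.mul_apply, Module.End.mul_apply, ih]
        rw [LinearMap.sub_apply, LinearMap.sub_apply, map_sub, hmk]
        rfl
    rw [this, hk, LinearMap.zero_apply]
  have h2 := sub_one_pow_apply_mem φ m l k F hFle h1
  have h3 : (φ ^ (m * l)) (((φ ^ (m * l) - 1) ^ k) a) = ((φ ^ (m * l) - 1) ^ k) a := by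
    have h3 := hσ (m * l) ⟨_, h2⟩
    have hσ1 : σ ^ (m * l) = 1 := by rw [mul_comm, pow_mul, hl1, one_pow]
    rw [hσ1, Equiv.Perm.one_apply] at h3
    exact h3.symm
  rw [pow_succ', Module.End.mul_apply, LinearMap.sub_apply, h3]
  simp

end Unipotent

section Kernel

variable {G : Type*} [Group G]

/-- Products of subfamilies of `y 0, …, y (n - 1)`, in increasing order. -/
def subprods (y : ℕ → G) : ℕ → Set G
  | 0 => {1}
  | n + 1 => subprods y n ∪ (· * y n) '' subprods y n

theorem subprods_finite (y : ℕ → G) (n : ℕ) : (subprods y n).Finite := by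
  induction n with
  | zero => exact finite_singleton _
  | succ n ih => exact ih.union (ih.image _)

theorem PG.exists_subprods_relation {d : ℕ} (hG : PG d G) (x t : G) :
    ∃ n, ∃ a ∈ subprods (fun j => t ^ j * x * (t ^ j)⁻¹) n,
      ∃ b ∈ subprods (fun j => t ^ j * x * (t ^ j)⁻¹) n, b * (t ^ n * x * (t ^ n)⁻¹) = a := by
  set y : ℕ → G := fun j => t ^ j * x * (t ^ j)⁻¹ with hy
  by_contra! h
  have hcard : ∀ n, (subprods y n).ncard = 2 ^ n := by
    intro n
    induction n with
    | zero => simp [subprods]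
    | succ n ih =>
      rw [subprods, ncard_union_eq _ (subprods_finite y n) ((subprods_finite y n).image _),
        ncard_image_of_injective _ (mul_left_injective _), ih, pow_succ]
      · ring
      · rw [Set.disjoint_left]
        rintro a ha ⟨b, hb, hab⟩
        exact h n a ha b hb hab
  set A : Set G := {1, x, t} with hA
  have hAfin : A.Finite := by simp [hA]
  have hsub : ∀ n, (· * t ^ n) '' subprods y n ⊆ A ^ (3 * n) := by
    intro n
    induction n with
    | zero => simp [subprods]
    | succ n ih =>
      have h2 : A ^ (3 * (n + 1)) = A ^ (3 * n) * (A * A * A) := by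
        rw [mul_add, pow_add, mul_one, pow_succ A 2, pow_two]
      rw [h2]
      have h1 : (1 : G) ∈ A := by simp [hA]
      have hx : x ∈ A := by simp [hA]
      have ht : t ∈ A := by simp [hA]
      rintro _ ⟨a, ha | ⟨b, hb, rfl⟩, rfl⟩
      · refine mem_mul.2 ⟨a * t ^ n, ih ⟨a, ha, rfl⟩, 1 * 1 * t, mul_mem_mul (mul_mem_mul h1 h1) ht, ?_⟩
        simp [pow_succ, mul_assoc]
      · refine mem_mul.2 ⟨b * t ^ n, ih ⟨b, hb, rfl⟩, 1 * x * t, mul_mem_mul (mul_mem_mul h1 hx) ht, ?_⟩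
        simp [hy, pow_succ, mul_assoc]
  obtain ⟨C, hC⟩ := hG A hAfin
  have hle : ∀ n : ℕ, (2 : ℝ) ^ n ≤ C * 3 ^ d * ((n : ℝ) + 1) ^ d := by
    intro n
    have h1 : (subprods y n).ncard ≤ (A ^ (3 * n)).ncard := by
      rw [← ncard_image_of_injective _ (mul_left_injective (t ^ n))]
      exact ncard_le_ncard (hsub n) (finite_pow hAfin _)
    have h2 : ((2 ^ n : ℕ) : ℝ) ≤ C * (((3 * n : ℕ) : ℝ) + 1) ^ d :=
      le_trans (by rw [← hcard n]; exact_mod_cast h1) (hC _)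
    have hC0 : 0 ≤ C := by
      have := hC 0
      simp only [Nat.cast_zero, zero_add, one_pow, mul_one] at this
      exact le_trans (by positivity) this
    refine le_trans (by push_cast at h2 ⊢; exact h2) ?_
    rw [mul_assoc, ← mul_pow]
    gcongr
    linarith
  have hlim := (tendsto_pow_const_div_const_pow_of_one_lt d (r := (2 : ℝ)) (by norm_num)).comp
    (tendsto_add_atTop_nat 1)
  have h0 : 0 ≤ C * 3 ^ d := by
    have := hle 0
    simp only [pow_zero, Nat.cast_zero, zero_add, one_pow, mul_one] at this
    linarith
  obtain ⟨n, hn⟩ := (hlim.eventually (gt_mem_nhds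
    (show (0 : ℝ) < 1 / (4 * (C * 3 ^ d + 1)) by positivity))).exists
  have h3 := hle n
  simp only [Function.comp_apply] at hn
  rw [div_lt_div_iff₀ (by positivity) (by positivity), pow_succ] at hn
  push_cast at hn
  have h4 : (0 : ℝ) < 2 ^ n := by positivity
  have h5 : (0 : ℝ) < ((n : ℝ) + 1) ^ d := by positivity
  nlinarith

theorem subprods_subset_closure (y : ℕ → G) (n : ℕ) :
    subprods y n ⊆ Subgroup.closure (y '' Iio n) := by
  induction n with
  | zero => simp [subprods]
  | succ n ih =>
    have h1 : (Subgroup.closure (y '' Iio n) : Set G) ⊆ Subgroup.closure (y '' Iio (n + 1)) :=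
      Subgroup.closure_mono (image_mono (Iio_subset_Iio (Nat.le_succ n)))
    refine union_subset (ih.trans h1) ?_
    rintro _ ⟨b, hb, rfl⟩
    exact mul_mem (h1 (ih hb)) (Subgroup.subset_closure ⟨n, Nat.lt_succ_self n, rfl⟩)

theorem PG.exists_conj_mem_closure {d : ℕ} (hG : PG d G) (x t : G) :
    ∃ n, ∀ m, t ^ m * x * (t ^ m)⁻¹ ∈
      Subgroup.closure ((fun j : ℕ => t ^ j * x * (t ^ j)⁻¹) '' Iio n) := by
  obtain ⟨n, a, ha, b, hb, hab⟩ := hG.exists_subprods_relation x t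
  refine ⟨n, ?_⟩
  set y : ℕ → G := fun j => t ^ j * x * (t ^ j)⁻¹ with hy
  set L := Subgroup.closure (y '' Iio n) with hL
  have hn : y n ∈ L := by
    have : y n = b⁻¹ * a := by rw [← hab]; simp [hy]
    rw [this]
    exact mul_mem (inv_mem (subprods_subset_closure y n hb)) (subprods_subset_closure y n ha)
  have hyt : ∀ j, t * y j * t⁻¹ = y (j + 1) := by intro j; simp [hy, pow_succ', mul_assoc]
  have hle : L ≤ L.comap (MulAut.conj t).toMonoidHom := by
    rw [hL, Subgroup.closure_le]
    rintro _ ⟨j, hj, rfl⟩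
    change t * y j * t⁻¹ ∈ L
    rw [hyt]
    rcases Nat.lt_or_eq_of_le (Nat.succ_le_of_lt hj) with h | h
    · exact Subgroup.subset_closure ⟨j + 1, h, rfl⟩
    · rw [← Nat.succ_eq_add_one, h]; exact hn
  have hmem : ∀ m, y m ∈ L := by
    intro m
    induction m with
    | zero =>
      rcases Nat.eq_zero_or_pos n with h | h
      · rw [← h]; exact hn
      · exact Subgroup.subset_closure ⟨0, h, rfl⟩
    | succ m ih => rw [← hyt]; exact hle ih
  exact hmem

theorem PG.fg_ker {d : ℕ} (hG : PG d G) [Group.FG G] (φ : G →* Multiplicative ℤ)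
    (hφ : Surjective φ) : φ.ker.FG := by
  obtain ⟨S, hS, hSfin⟩ := (Group.fg_iff (G := G)).1 inferInstance
  obtain ⟨t, ht⟩ := hφ (Multiplicative.ofAdd 1)
  have htz : ∀ k : ℤ, φ (t ^ k) = Multiplicative.ofAdd k := by
    intro k; rw [map_zpow, ht, ← ofAdd_zsmul]; simp
  set x : G → G := fun s => s * (t ^ (Multiplicative.toAdd (φ s)))⁻¹ with hx
  have hxk : ∀ s, φ (x s) = 1 := by
    intro s; simp only [hx, map_mul, map_inv, htz]; simp
  choose n hn using fun s => hG.exists_conj_mem_closure (x s) t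
  choose p hp using fun s => hG.exists_conj_mem_closure (x s) t⁻¹
  set Y : Set G := ⋃ s ∈ S, ((fun j : ℕ => t ^ j * x s * (t ^ j)⁻¹) '' Iio (n s) ∪
    (fun j : ℕ => (t⁻¹) ^ j * x s * ((t⁻¹) ^ j)⁻¹) '' Iio (p s)) with hY
  have hYfin : Y.Finite := hSfin.biUnion fun s _ =>
    ((finite_Iio _).image _).union ((finite_Iio _).image _)
  rw [Subgroup.fg_iff]
  refine ⟨Y, le_antisymm ?_ ?_, hYfin⟩
  · rw [Subgroup.closure_le]
    simp only [hY, iUnion_subset_iff, union_subset_iff]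
    intro s hs
    constructor <;>
    · rintro _ ⟨j, -, rfl⟩
      simp [MonoidHom.mem_ker, hxk]
  · set L := Subgroup.closure Y
    have hconj : ∀ s ∈ S, ∀ k : ℤ, t ^ k * x s * (t ^ k)⁻¹ ∈ L := by
      intro s hs k
      obtain ⟨m, rfl | rfl⟩ := k.eq_nat_or_neg
      · rw [zpow_natCast]
        refine Subgroup.closure_mono ?_ (hn s m)
        exact subset_union_left.trans (subset_biUnion_of_mem (u := fun s =>
          ((fun j : ℕ => t ^ j * x s * (t ^ j)⁻¹) '' Iio (n s) ∪
            (fun j : ℕ => (t⁻¹) ^ j * x s * ((t⁻¹) ^ j)⁻¹) '' Iio (p s))) hs)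
      · rw [zpow_neg, zpow_natCast, ← inv_pow]
        refine Subgroup.closure_mono ?_ (hp s m)
        exact subset_union_right.trans (subset_biUnion_of_mem (u := fun s =>
          ((fun j : ℕ => t ^ j * x s * (t ^ j)⁻¹) '' Iio (n s) ∪
            (fun j : ℕ => (t⁻¹) ^ j * x s * ((t⁻¹) ^ j)⁻¹) '' Iio (p s))) hs)
    have hnorm : ∀ k : ℤ, ∀ l ∈ L, t ^ k * l * (t ^ k)⁻¹ ∈ L := by
      intro k
      have : L ≤ L.comap (MulAut.conj (t ^ k)).toMonoidHom := by
        rw [Subgroup.closure_le]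
        simp only [hY, iUnion_subset_iff, union_subset_iff]
        intro s hs
        constructor
        · rintro _ ⟨j, -, rfl⟩
          change t ^ k * (t ^ j * x s * (t ^ j)⁻¹) * (t ^ k)⁻¹ ∈ L
          have := hconj s hs (k + j)
          rw [zpow_add, zpow_natCast] at this
          simpa [mul_assoc] using this
        · rintro _ ⟨j, -, rfl⟩
          change t ^ k * (t⁻¹ ^ j * x s * (t⁻¹ ^ j)⁻¹) * (t ^ k)⁻¹ ∈ L
          have := hconj s hs (k - j)
          rw [zpow_sub, zpow_natCast] at this
          simpa [mul_assoc] using this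
      exact fun l hl => this hl
    have hall : ∀ g : G, g * (t ^ (Multiplicative.toAdd (φ g)))⁻¹ ∈ L := by
      intro g
      have hg : g ∈ Subgroup.closure S := by rw [hS]; trivial
      induction hg using Subgroup.closure_induction with
      | mem s hs => simpa using hconj s hs 0
      | one => simp
      | mul a b _ _ iha ihb =>
        have := mul_mem iha (hnorm (Multiplicative.toAdd (φ a)) _ ihb)
        rw [map_mul, toAdd_mul, zpow_add]
        simpa [mul_assoc] using this
      | inv a _ ih =>
        have := hnorm (-(Multiplicative.toAdd (φ a))) _ (inv_mem ih)
        rw [map_inv, toAdd_inv]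
        simpa [mul_assoc] using this
    intro g hg
    have := hall g
    rw [MonoidHom.mem_ker] at hg
    simpa [hg] using this

theorem PG.ker {d : ℕ} (hG : PG d G) (φ : G →* Multiplicative ℤ) (hφ : Surjective φ) :
    ∃ e, d = e + 1 ∧ PG e φ.ker := by
  obtain ⟨t, ht⟩ := hφ (Multiplicative.ofAdd 1)
  have htz : ∀ k : ℕ, φ (t ^ k) = Multiplicative.ofAdd (k : ℤ) := by
    intro k; rw [map_pow, ht, ← ofAdd_nsmul]; simp
  have key : ∀ A : Set φ.ker, A.Finite → ∃ C : ℝ, 0 ≤ C ∧ ∀ n : ℕ,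
      ((A ^ n).ncard : ℝ) * ((n : ℝ) + 1) ≤ C * ((n : ℝ) + 1) ^ d := by
    intro A hA
    set B : Set G := φ.ker.subtype '' A ∪ {1, t} with hB
    have hBfin : B.Finite := (hA.image _).union (by simp)
    obtain ⟨C, hC⟩ := hG B hBfin
    have hC0 : 0 ≤ C := by
      have := hC 0
      simp only [Nat.cast_zero, zero_add, one_pow, mul_one] at this
      exact le_trans (by positivity) this
    refine ⟨C * 2 ^ d, by positivity, fun n => ?_⟩
    have hAB : φ.ker.subtype '' (A ^ n) ⊆ B ^ n := by
      rw [image_pow]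
      exact pow_le_pow_left' (show φ.ker.subtype '' A ≤ B from subset_union_left) n
    have htB : ∀ i ≤ n, t ^ i ∈ B ^ n := by
      intro i hi
      have h1 : (1 : G) ∈ B := by simp [hB]
      have ht : t ∈ B := by simp [hB]
      exact pow_subset_pow_right h1 hi (pow_mem_pow ht)
    have hinj : InjOn (fun p : φ.ker × ℕ => (p.1 : G) * t ^ p.2) ((A ^ n) ×ˢ (Iic n)) := by
      rintro ⟨a, i⟩ - ⟨b, j⟩ - hab
      simp only at hab
      have h1 := congrArg φ hab
      rw [map_mul, map_mul, htz, htz, MonoidHom.mem_ker.1 a.2, MonoidHom.mem_ker.1 b.2, one_mul,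
        one_mul] at h1
      have h2 : i = j := by exact_mod_cast Multiplicative.ofAdd.injective h1
      subst h2
      simpa using hab
    have hsub : (fun p : φ.ker × ℕ => (p.1 : G) * t ^ p.2) '' ((A ^ n) ×ˢ (Iic n)) ⊆ B ^ (2 * n) := by
      rintro _ ⟨⟨a, i⟩, ⟨ha, hi⟩, rfl⟩
      rw [two_mul, pow_add]
      exact mul_mem_mul (hAB ⟨a, ha, rfl⟩) (htB i hi)
    have h1 := ncard_le_ncard hsub (finite_pow hBfin _)
    rw [hinj.ncard_image, ncard_prod, ncard_eq_toFinset_card' (Iic n)] at h1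
    simp only [toFinset_Iic, Nat.card_Iic] at h1
    have h2 : ((A ^ n).ncard : ℝ) * ((n : ℝ) + 1) ≤ ((B ^ (2 * n)).ncard : ℝ) := by exact_mod_cast h1
    refine h2.trans ((hC _).trans ?_)
    rw [mul_assoc, ← mul_pow]
    gcongr
    push_cast
    linarith
  cases d with
  | zero =>
    obtain ⟨C, hC0, hC⟩ := key {1} (finite_singleton _)
    obtain ⟨n, hn⟩ := exists_nat_gt C
    have := hC n
    simp only [singleton_pow, one_pow, ncard_singleton, pow_zero] at this
    push_cast at this
    linarith
  | succ e =>
    refine ⟨e, rfl, fun A hA => ?_⟩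
    obtain ⟨C, hC0, hC⟩ := key A hA
    refine ⟨C, fun n => ?_⟩
    have := hC n
    rw [pow_succ, ← mul_assoc] at this
    exact le_of_mul_le_mul_right this (by positivity)

end Kernel

section Nilpotent
open scoped commutatorElement

variable {G : Type*} [Group G]

theorem commutator_mem_of_closure {Z : Subgroup G} [Z.Normal] {x : G} {S : Set G}
    (h : ∀ s ∈ S, ⁅x, s⁆ ∈ Z) : ∀ g ∈ Subgroup.closure S, ⁅x, g⁆ ∈ Z := by
  have key : ∀ g, ⁅x, g⁆ ∈ Z ↔
      (QuotientGroup.mk' Z) g ∈ Subgroup.centralizer {(QuotientGroup.mk' Z) x} := by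
    intro g
    rw [Subgroup.mem_centralizer_singleton_iff, ← (QuotientGroup.eq_one_iff (N := Z) ⁅x, g⁆),
      ← QuotientGroup.mk'_apply, map_commutatorElement, commutatorElement_eq_one_iff_mul_comm]
    exact eq_comm
  have : Subgroup.closure S ≤ (Subgroup.centralizer {(QuotientGroup.mk' Z) x}).comap
      (QuotientGroup.mk' Z) := by
    rw [Subgroup.closure_le]
    exact fun s hs => (key s).1 (h s hs)
  exact fun g hg => (key g).2 (this hg)

theorem commutator_mem_symm {Z : Subgroup G} {x y : G} (h : ⁅x, y⁆ ∈ Z) : ⁅y, x⁆ ∈ Z := by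
  rw [← commutatorElement_inv]; exact inv_mem h

/-- The factors of the lower central series of a finitely generated group are finitely
generated. -/
theorem exists_lowerCentralSeries_le_closure_sup [Group.FG G] (i : ℕ) :
    ∃ F : Set G, F.Finite ∧ F ⊆ (⊤ : Subgroup G).lowerCentralSeries i ∧
      (⊤ : Subgroup G).lowerCentralSeries i ≤
        Subgroup.closure F ⊔ (⊤ : Subgroup G).lowerCentralSeries (i + 1) := by
  obtain ⟨S, hS, hSfin⟩ := (Group.fg_iff (G := G)).1 inferInstance
  set γ := (⊤ : Subgroup G).lowerCentralSeries with hγ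
  have hsucc : ∀ i, γ (i + 1) = ⁅γ i, ⊤⁆ := fun i => Subgroup.lowerCentralSeries_succ _ i
  have hmem : ∀ i, ∀ x ∈ γ i, ∀ g, ⁅x, g⁆ ∈ γ (i + 1) := fun i x hx g => by
    rw [hsucc]; exact Subgroup.commutator_mem_commutator hx trivial
  have hanti := (⊤ : Subgroup G).lowerCentralSeries_antitone
  induction i with
  | zero =>
    refine ⟨S, hSfin, fun x _ => trivial, ?_⟩
    rw [hS]; exact le_sup_of_le_left le_top
  | succ i ih =>
    obtain ⟨F, hF, hFγ, hle⟩ := ih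
    refine ⟨image2 (fun a s => ⁅a, s⁆) F S, hF.image2 _ hSfin, ?_, ?_⟩
    · rintro _ ⟨a, ha, s, -, rfl⟩
      exact hmem i a (hFγ ha) s
    set L := Subgroup.closure (image2 (fun a s => ⁅a, s⁆) F S) ⊔ γ (i + 1 + 1) with hL
    have hLγ : L ≤ γ (i + 1) := by
      refine sup_le ?_ (hanti (Nat.le_succ _))
      rw [Subgroup.closure_le]
      rintro _ ⟨a, ha, s, -, rfl⟩
      exact hmem i a (hFγ ha) s
    have hLn : L.Normal := by
      refine ⟨fun x hx g => ?_⟩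
      have h1 : g * x * g⁻¹ = ⁅g, x⁆ * x := by simp [commutatorElement_def]
      rw [h1]
      refine mul_mem ?_ hx
      exact (le_sup_right : _ ≤ L) (commutator_mem_symm (hmem (i + 1) x (hLγ hx) g))
    have h1 : ∀ y : G, ∀ x ∈ γ i, ⁅y, x⁆ ∈ L := by
      intro y x hx
      have hcl : x ∈ Subgroup.closure (F ∪ γ (i + 1)) := by
        rw [Subgroup.closure_union, Subgroup.closure_eq]; exact hle hx
      refine commutator_mem_of_closure ?_ x hcl
      rintro s (hs | hs)
      · apply commutator_mem_symm
        refine commutator_mem_of_closure (S := S) ?_ y (by rw [hS]; trivial)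
        intro t ht
        exact (le_sup_left : _ ≤ L) (Subgroup.subset_closure ⟨s, hs, t, ht, rfl⟩)
      · exact (le_sup_right : _ ≤ L) (commutator_mem_symm (hmem (i + 1) s hs y))
    rw [hsucc i, Subgroup.commutator_le]
    intro x hx y _
    exact commutator_mem_symm (h1 y x hx)

/-- A group generated by a normal subgroup `N` with a central filtration and an element acting
unipotently on its factors is nilpotent. -/
theorem isNilpotent_of_unipotent {N : Subgroup G} [N.Normal] {s : G}
    (hsup : N ⊔ Subgroup.zpowers s = ⊤) (γ : ℕ → Subgroup G) (hn : ∀ i, (γ i).Normal)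
    (h0 : γ 0 = N) (c : ℕ) (hc : γ c = ⊥) (hcomm : ∀ i, ∀ x ∈ γ i, ∀ g ∈ N, ⁅x, g⁆ ∈ γ (i + 1))
    (huni : ∀ i, ∃ k, ∀ x ∈ γ i, (fun x => ⁅s, x⁆)^[k] x ∈ γ (i + 1)) : Group.IsNilpotent G := by
  have htop : ∀ g : G, g ∈ Subgroup.closure ((N : Set G) ∪ {s}) := by
    intro g
    rw [Subgroup.closure_union, Subgroup.closure_eq, ← Subgroup.zpowers_eq_closure, hsup]
    trivial
  have key : ∀ j, ∃ l, γ (c - j) ≤ Subgroup.upperCentralSeries G l := by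
    intro j
    induction j with
    | zero => exact ⟨0, by simp [hc]⟩
    | succ j ih =>
      obtain ⟨l, hl⟩ := ih
      rcases le_or_gt c j with hcj | hcj
      · exact ⟨l, by rwa [Nat.sub_eq_zero_of_le (hcj.trans j.le_succ),
          ← Nat.sub_eq_zero_of_le hcj]⟩
      obtain ⟨i, hi⟩ : ∃ i, i = c - (j + 1) := ⟨_, rfl⟩
      rw [show c - j = i + 1 by omega] at hl
      rw [← hi]
      obtain ⟨k, hk⟩ := huni i
      have : ∀ p, ∀ x ∈ γ i, (fun x => ⁅s, x⁆)^[p] x ∈ γ (i + 1) →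
          x ∈ Subgroup.upperCentralSeries G (l + p) := by
        intro p
        induction p with
        | zero => exact fun x _ hx => hl hx
        | succ p ihp =>
          intro x hx hpx
          rw [Function.iterate_succ_apply] at hpx
          have hsx : ⁅s, x⁆ ∈ γ i := by
            rw [commutatorElement_def]
            exact mul_mem ((hn i).conj_mem x hx s) (inv_mem hx)
          have h1 := ihp _ hsx hpx
          rw [← add_assoc, Subgroup.mem_upperCentralSeries_succ_iff]
          intro y
          refine commutator_mem_of_closure ?_ y (htop y)
          rintro g (hg | rfl)
          · exact Subgroup.upperCentralSeries_mono G (Nat.le_add_right l p)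
              (hl (hcomm i x hx g hg))
          · exact commutator_mem_symm h1
      exact ⟨l + k, fun x hx => this k x hx (hk x hx)⟩
  obtain ⟨L, hL⟩ := key c
  rw [Nat.sub_self, h0] at hL
  have hs : s ∈ Subgroup.upperCentralSeries G (L + 1) := by
    rw [Subgroup.mem_upperCentralSeries_succ_iff]
    intro y
    refine commutator_mem_of_closure ?_ y (htop y)
    rintro g (hg | rfl)
    · apply hL
      rw [commutatorElement_def]
      exact mul_mem (Subgroup.Normal.conj_mem inferInstance g hg s) (inv_mem hg)
    · simp
  refine ⟨⟨L + 1, ?_⟩⟩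
  rw [eq_top_iff, ← hsup]
  refine sup_le (hL.trans (Subgroup.upperCentralSeries_mono G L.le_succ)) ?_
  rwa [Subgroup.zpowers_le]

/-- A finite index subgroup of a finitely generated group contains a characteristic subgroup of
finite index. -/
theorem exists_characteristic_le [Group.FG G] (M : Subgroup G) [M.FiniteIndex] :
    ∃ N : Subgroup G, N.Characteristic ∧ N.FiniteIndex ∧ N ≤ M := by
  let P := Equiv.Perm (G ⧸ M)
  have hfin : Finite (G ⧸ M) := Subgroup.finite_quotient_of_finiteIndex
  have hP : Finite P := inferInstance
  obtain ⟨S, hS, hSfin⟩ := (Group.fg_iff (G := G)).1 inferInstance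
  have : Finite S := hSfin
  have hhom : Finite (G →* P) := by
    refine Finite.of_injective (fun f : G →* P => fun s : S => f s) fun f g hfg => ?_
    refine MonoidHom.eq_of_eqOn_dense hS fun s hs => congrFun hfg ⟨s, hs⟩
  refine ⟨⨅ f : G →* P, f.ker, ?_, ?_, ?_⟩
  · rw [Subgroup.characteristic_iff_le_comap]
    intro φ x hx
    simp only [Subgroup.mem_iInf, Subgroup.mem_comap, MonoidHom.mem_ker] at hx ⊢
    exact fun f => hx (f.comp φ.toMonoidHom)
  · exact Subgroup.finiteIndex_iInf fun f => Subgroup.finiteIndex_ker f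
  · intro x hx
    have h1 := (Subgroup.mem_iInf.1 hx) (MulAction.toPermHom G (G ⧸ M))
    have h2 : (MulAction.toPermHom G (G ⧸ M) x) ((1 : G) : G ⧸ M) = ((1 : G) : G ⧸ M) := by
      rw [MonoidHom.mem_ker.1 h1]; rfl
    rw [MulAction.toPermHom_apply, MulAction.toPerm_apply, MulAction.Quotient.smul_coe,
      smul_eq_mul, mul_one, eq_comm, QuotientGroup.eq] at h2
    simpa using h2

end Nilpotent

section VirtuallyNilpotent
open scoped commutatorElement

universe v

variable {G : Type v} [Group G]

/-- A presentation of the abelian quotient of nested normal subgroups `B ≤ A`, written additively,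
with the endomorphism induced by conjugation by `t`. -/
theorem exists_abelian_quotient (t : G) (A B : Subgroup G) [A.Normal] [B.Normal]
    (hAB : ∀ x ∈ A, ∀ y ∈ A, ⁅x, y⁆ ∈ B) :
    ∃ (Q : Type v) (_ : AddCommGroup Q) (π : A → Q) (φ : Q →+ Q), Surjective π ∧
      (∀ x y, π (x * y) = π x + π y) ∧ (∀ x, π x = 0 ↔ (x : G) ∈ B) ∧
      ∀ x y : A, (y : G) = t * x * t⁻¹ → φ (π x) = π y := by
  let BA := B.subgroupOf A
  let c : A →* A := MulAut.conjNormal (H := A) t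
  have hc : ∀ x : A, (c x : G) = t * x * t⁻¹ := fun x => MulAut.conjNormal_apply t x
  let Q := A ⧸ BA
  let _ : CommGroup Q := { (inferInstance : Group Q) with
    mul_comm := by
      intro a b
      obtain ⟨x, rfl⟩ := QuotientGroup.mk'_surjective BA a
      obtain ⟨y, rfl⟩ := QuotientGroup.mk'_surjective BA b
      have h1 : ⁅x, y⁆ ∈ BA := hAB x x.2 y y.2
      rw [← QuotientGroup.eq_one_iff, ← QuotientGroup.mk'_apply, map_commutatorElement,
        commutatorElement_eq_one_iff_mul_comm] at h1
      exact h1 }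
  let f : Q →* Q := QuotientGroup.map BA BA c (by
    intro x hx
    change ((c x : A) : G) ∈ B
    rw [hc]
    exact Subgroup.Normal.conj_mem inferInstance (x : G) hx t)
  refine ⟨Additive Q, inferInstance, fun x => Additive.ofMul (QuotientGroup.mk' BA x),
    MonoidHom.toAdditive f, ?_, ?_, ?_, ?_⟩
  · exact Additive.ofMul.surjective.comp (QuotientGroup.mk'_surjective BA)
  · exact fun x y => rfl
  · intro x
    exact QuotientGroup.eq_one_iff x
  · intro x y hxy
    have : y = c x := Subtype.ext (by rw [hxy, hc])
    rw [this]
    rfl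

theorem exists_eq_sum_of_mem_subprods {A : Subgroup G} {Q : Type*} [AddCommGroup Q] (π : A → Q)
    (hπ : ∀ x y, π (x * y) = π x + π y) (y : ℕ → A) (n : ℕ) :
    ∀ a ∈ subprods (fun j => (y j : G)) n, ∃ (ha : a ∈ A) (ε : ℕ → ℤ),
      (∀ j, ε j = 0 ∨ ε j = 1) ∧ π ⟨a, ha⟩ = ∑ j ∈ Finset.range n, ε j • π (y j) := by
  have h1 : π 1 = 0 := by simpa using hπ 1 1
  induction n with
  | zero =>
    rintro a rfl
    exact ⟨one_mem _, 0, fun j => Or.inl rfl, h1⟩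
  | succ n ih =>
    rintro a (ha | ⟨b, hb, rfl⟩)
    · obtain ⟨haA, ε, hε, h⟩ := ih a ha
      refine ⟨haA, Function.update ε n 0, fun j => ?_, ?_⟩
      · rcases eq_or_ne j n with rfl | hj <;> simp [*]
      · rw [Finset.sum_range_succ, Function.update_self, zero_smul, add_zero, h]
        exact Finset.sum_congr rfl fun j hj => by
          rw [Function.update_of_ne (Finset.mem_range.1 hj).ne]
    · obtain ⟨hbA, ε, hε, h⟩ := ih b hb
      refine ⟨mul_mem hbA (y n).2, Function.update ε n 1, fun j => ?_, ?_⟩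
      · rcases eq_or_ne j n with rfl | hj <;> simp [*]
      · rw [Finset.sum_range_succ, Function.update_self, one_smul]
        have : (⟨b * y n, mul_mem hbA (y n).2⟩ : A) = ⟨b, hbA⟩ * y n := rfl
        rw [this, hπ, h]
        congr 1
        exact Finset.sum_congr rfl fun j hj => by
          rw [Function.update_of_ne (Finset.mem_range.1 hj).ne]

theorem PG.exists_iterate_commutator_mem {d : ℕ} (hG : PG d G) (t : G) (A B : Subgroup G)
    [A.Normal] [B.Normal] (hBA : B ≤ A) (hAB : ∀ x ∈ A, ∀ y ∈ A, ⁅x, y⁆ ∈ B) {F : Set G} (hF : F.Finite)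
    (hFA : F ⊆ A) (hle : A ≤ Subgroup.closure F ⊔ B) :
    ∃ m k, 1 ≤ m ∧ ∀ l, ∀ x ∈ A, (fun x => ⁅t ^ (m * l), x⁆)^[k] x ∈ B := by
  obtain ⟨Q, _, π, φ₀, hsurj, hmul, hker, hφ₀⟩ := exists_abelian_quotient t A B hAB
  let πh : Additive A →+ Q := AddMonoidHom.mk' (fun x => π x.toMul) fun x y => hmul _ _
  have hπh : ∀ x, π x = πh (Additive.ofMul x) := fun x => rfl
  have hfin : Module.Finite ℤ Q := by
    rw [Module.Finite.iff_addGroup_fg, AddGroup.fg_iff]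
    refine ⟨π '' ((↑) ⁻¹' F), ?_, (hF.preimage Subtype.val_injective.injOn).image _⟩
    rw [eq_top_iff]
    intro q _
    obtain ⟨⟨x, hx⟩, rfl⟩ := hsurj q
    set L := AddSubgroup.closure (π '' ((↑) ⁻¹' F)) with hL
    have h1 : x ∈ Subgroup.closure (F ∪ B) := by
      rw [Subgroup.closure_union, Subgroup.closure_eq]; exact hle hx
    suffices h2 : ∀ y ∈ Subgroup.closure (F ∪ B), ∀ hy : y ∈ A, π ⟨y, hy⟩ ∈ L by
      exact h2 x h1 hx
    have hcl : Subgroup.closure (F ∪ B) ≤ A := by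
      rw [Subgroup.closure_le]; exact union_subset hFA hBA
    intro y hy
    induction hy using Subgroup.closure_induction with
    | mem s hs =>
      intro hsA
      rcases hs with hs | hs
      · exact AddSubgroup.subset_closure ⟨⟨s, hsA⟩, hs, rfl⟩
      · rw [(hker ⟨s, hsA⟩).2 hs]; exact zero_mem _
    | one => intro h; rw [(hker ⟨1, h⟩).2 (one_mem _)]; exact zero_mem _
    | mul a b ha hb iha ihb =>
      intro h
      have : (⟨a * b, h⟩ : A) = ⟨a, hcl ha⟩ * ⟨b, hcl hb⟩ := rfl
      rw [this, hmul]
      exact add_mem (iha _) (ihb _)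
    | inv a ha ih =>
      intro h
      have : π ⟨a⁻¹, h⟩ = - π ⟨a, hcl ha⟩ := by
        rw [hπh, hπh, ← map_neg]; rfl
      rw [this]
      exact neg_mem (ih _)
  let φ : Module.End ℤ Q := φ₀.toIntLinearMap
  have hφ : ∀ x y : A, (y : G) = t * x * t⁻¹ → φ (π x) = π y := hφ₀
  have hA : A.Normal := inferInstance
  have hconj : ∀ (n : ℕ) (x : A), (φ ^ n) (π x) =
      π ⟨t ^ n * x * (t ^ n)⁻¹, hA.conj_mem x x.2 _⟩ := by
    intro n
    induction n with
    | zero => intro x; simp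
    | succ n ih =>
      intro x
      rw [pow_succ', Module.End.mul_apply, ih]
      refine hφ _ _ ?_
      simp [pow_succ', mul_assoc]
  have hinj : Injective φ := by
    rw [injective_iff_map_eq_zero]
    intro q hq
    obtain ⟨x, rfl⟩ := hsurj q
    have := hconj 1 x
    rw [pow_one, hq, eq_comm, hker, pow_one] at this
    rw [hker]
    simpa [mul_assoc] using Subgroup.Normal.conj_mem inferInstance _ this t⁻¹
  obtain ⟨m, k, hm, hk⟩ := exists_pow_sub_one_pow_eq_zero φ hinj (by
    intro m hm q
    obtain ⟨x, rfl⟩ := hsurj q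
    obtain ⟨n, a, ha, b, hb, hab⟩ := hG.exists_subprods_relation (x : G) (t ^ m)
    let y : ℕ → A := fun j => ⟨(t ^ m) ^ j * x * ((t ^ m) ^ j)⁻¹, hA.conj_mem x x.2 _⟩
    have hy : ∀ j, π (y j) = ((φ ^ m) ^ j) (π x) := by
      intro j
      rw [← pow_mul, hconj]
      simp only [y, ← pow_mul]
    obtain ⟨haA, ε, hε, h1⟩ := exists_eq_sum_of_mem_subprods π hmul y n a ha
    obtain ⟨hbA, δ, hδ, h2⟩ := exists_eq_sum_of_mem_subprods π hmul y n b hb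
    refine ⟨n, fun j => ε j - δ j, fun j => ?_, ?_⟩
    · rcases hε j with h | h <;> rcases hδ j with h' | h' <;> simp [h, h']
    · have h3 : (⟨a, haA⟩ : A) = ⟨b, hbA⟩ * y n := Subtype.ext hab.symm
      rw [h3, hmul, h2, hy] at h1
      simp only [sub_smul, Finset.sum_sub_distrib, ← hy] at h1 ⊢
      rw [← h1]; abel)
  refine ⟨m, k, hm, fun l x hx => ?_⟩
  have hzero : ∀ q : Q, ((φ ^ (m * l) - 1) ^ k) q = 0 := by
    intro q
    have := sub_one_pow_apply_mem φ m l k ⊥ (by simp) (a := q) (by rw [hk]; simp)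
    simpa using this
  have hit : ∀ p, ∀ x ∈ A, ∃ hx : (fun x => ⁅t ^ (m * l), x⁆)^[p] x ∈ A,
      ∀ hx' : x ∈ A, π ⟨_, hx⟩ = ((φ ^ (m * l) - 1) ^ p) (π ⟨x, hx'⟩) := by
    intro p
    induction p with
    | zero => intro x hx; exact ⟨hx, fun _ => by simp⟩
    | succ p ih =>
      intro x hx
      have hx1 : ⁅t ^ (m * l), x⁆ ∈ A := by
        rw [commutatorElement_def]
        exact mul_mem (hA.conj_mem x hx _) (inv_mem hx)
      obtain ⟨h1, h2⟩ := ih _ hx1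
      refine ⟨h1, fun _ => ?_⟩
      have h3 : π ⟨⁅t ^ (m * l), x⁆, hx1⟩ = (φ ^ (m * l) - 1) (π ⟨x, hx⟩) := by
        rw [LinearMap.sub_apply, hconj, Module.End.one_apply, sub_eq_add_neg]
        have h4 : - π ⟨x, hx⟩ = π ⟨x, hx⟩⁻¹ := by rw [hπh, hπh, ← map_neg]; rfl
        rw [h4, ← hmul]
        rfl
      have h5 := h2 hx1
      rw [h3] at h5
      rw [pow_succ, Module.End.mul_apply, ← h5]
      rfl
  obtain ⟨h1, h2⟩ := hit k x hx
  rw [← hker ⟨_, h1⟩, h2 hx, hzero]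

end VirtuallyNilpotent

section Gromov
open scoped commutatorElement

universe v

variable {G : Type v} [Group G]

theorem PG.exists_isNilpotent_sup {d : ℕ} (hG : PG d G) (t : G) (N : Subgroup G) [N.Normal]
    [Group.FG N] [Group.IsNilpotent N] :
    ∃ m, 1 ≤ m ∧ Group.IsNilpotent (N ⊔ Subgroup.zpowers (t ^ m) : Subgroup G) := by
  set γ := N.lowerCentralSeries with hγ
  have hmem : ∀ i, ∀ x ∈ γ i, ∀ g ∈ N, ⁅x, g⁆ ∈ γ (i + 1) := fun i x hx g hg => by
    rw [hγ, Subgroup.lowerCentralSeries_succ]; exact Subgroup.commutator_mem_commutator hx hg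
  have hanti : Antitone γ := N.lowerCentralSeries_antitone
  have hnorm : ∀ i, (γ i).Normal := fun i => inferInstance
  have hγN : ∀ i, γ i ≤ N := fun i => N.lowerCentralSeries_le_self i
  have hmap : ∀ i, ((⊤ : Subgroup N).lowerCentralSeries i).map N.subtype = γ i := by
    intro i
    rw [Subgroup.map_lowerCentralSeries, ← MonoidHom.range_eq_map, Subgroup.range_subtype]
  have hfg : ∀ i, ∃ F : Set G, F.Finite ∧ F ⊆ γ i ∧ γ i ≤ Subgroup.closure F ⊔ γ (i + 1) := by
    intro i
    obtain ⟨F, hF, hFγ, hle⟩ := exists_lowerCentralSeries_le_closure_sup (G := N) i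
    refine ⟨N.subtype '' F, hF.image _, ?_, ?_⟩
    · rw [← hmap i]; exact image_mono hFγ
    · rw [← hmap i, ← hmap (i + 1), ← MonoidHom.map_closure, ← Subgroup.map_sup]
      exact Subgroup.map_mono hle
  obtain ⟨c, hc⟩ : ∃ c, γ c = ⊥ := by
    obtain ⟨c, hc⟩ := (Subgroup.nilpotent_iff_lowerCentralSeries (G := N)).1 inferInstance
    exact ⟨c, by rw [← hmap c, hc, Subgroup.map_bot]⟩
  have huni : ∀ i, ∃ m k, 1 ≤ m ∧ ∀ l, ∀ x ∈ γ i, (fun x => ⁅t ^ (m * l), x⁆)^[k] x ∈ γ (i + 1) := by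
    intro i
    obtain ⟨F, hF, hFγ, hle⟩ := hfg i
    exact hG.exists_iterate_commutator_mem t (γ i) (γ (i + 1)) (hanti i.le_succ)
      (fun x hx y hy => hmem i x hx y (hγN i hy)) hF hFγ hle
  choose m k hm hk using huni
  set M := ∏ i ∈ Finset.range c, m i with hM
  refine ⟨M, Finset.one_le_prod' fun i _ => hm i, ?_⟩
  set L : Subgroup G := N ⊔ Subgroup.zpowers (t ^ M) with hL
  have hs : t ^ M ∈ L := (le_sup_right : _ ≤ L) (Subgroup.mem_zpowers _)
  have hNL : N ≤ L := le_sup_left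
  refine isNilpotent_of_unipotent (N := N.subgroupOf L) (s := ⟨t ^ M, hs⟩) ?_
    (fun i => (γ i).subgroupOf L) (fun i => inferInstance) rfl c ?_ ?_ ?_
  · have h1 : Subgroup.zpowers (⟨t ^ M, hs⟩ : L) = (Subgroup.zpowers (t ^ M)).subgroupOf L := by
      apply Subgroup.map_injective L.subtype_injective
      rw [MonoidHom.map_zpowers, Subgroup.subgroupOf_map_subtype, inf_eq_left.2]
      · rfl
      · exact le_sup_right
    rw [h1, ← Subgroup.subgroupOf_sup hNL le_sup_right, ← hL, Subgroup.subgroupOf_self]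
  · rw [hc, Subgroup.bot_subgroupOf]
  · intro i x hx g hg
    exact hmem i x hx g hg
  · intro i
    have hcoe : ∀ p (x : L), (((fun x : L => ⁅(⟨t ^ M, hs⟩ : L), x⁆)^[p] x : L) : G) =
        (fun x => ⁅t ^ M, x⁆)^[p] (x : G) := by
      intro p
      induction p with
      | zero => exact fun x => rfl
      | succ p ih =>
        intro x
        rw [Function.iterate_succ_apply, Function.iterate_succ_apply, ih]
        rfl
    rcases lt_or_ge i c with hi | hi
    · refine ⟨k i, fun x hx => ?_⟩
      obtain ⟨l, hl⟩ := Finset.dvd_prod_of_mem m (Finset.mem_range.2 hi)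
      have h1 := hk i l x hx
      rw [← hl, ← hM, ← hcoe] at h1
      exact h1
    · refine ⟨0, fun x hx => ?_⟩
      have : (x : G) ∈ γ c := hanti hi hx
      rw [hc, Subgroup.mem_bot] at this
      change (x : G) ∈ γ (i + 1)
      rw [this]
      exact one_mem _

theorem finiteIndex_sup_zpowers (φ : G →* Multiplicative ℤ) {t : G}
    (ht : φ t = Multiplicative.ofAdd 1) (N : Subgroup G) [N.Normal]
    [(N.subgroupOf φ.ker).FiniteIndex] {m : ℕ} (hm : 1 ≤ m) :
    (N ⊔ Subgroup.zpowers (t ^ m)).FiniteIndex := by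
  set L := N ⊔ Subgroup.zpowers (t ^ m) with hL
  have hfin : Finite (φ.ker ⧸ N.subgroupOf φ.ker) := Subgroup.finite_quotient_of_finiteIndex
  have : NeZero m := ⟨by omega⟩
  let f : (φ.ker ⧸ N.subgroupOf φ.ker) × Fin m → G ⧸ L := fun p =>
    (((p.1.out : φ.ker) : G) * t ^ (p.2 : ℕ) : G)
  have hf : Surjective f := by
    intro q
    obtain ⟨g, rfl⟩ := QuotientGroup.mk_surjective q
    set z : ℤ := Multiplicative.toAdd (φ g) with hz
    have hzg : φ g = Multiplicative.ofAdd z := rfl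
    have htz : ∀ k : ℤ, φ (t ^ k) = Multiplicative.ofAdd k := by
      intro k; rw [map_zpow, ht, ← ofAdd_zsmul]; simp
    have hk : g * (t ^ z)⁻¹ ∈ φ.ker := by
      rw [MonoidHom.mem_ker, map_mul, map_inv, htz, hzg, mul_inv_cancel]
    have hr0 : 0 ≤ z % m := Int.emod_nonneg _ (by omega)
    have hr1 : z % m < m := Int.emod_lt_of_pos _ (by omega)
    obtain ⟨r, hr⟩ := Int.eq_ofNat_of_zero_le hr0
    set kq : φ.ker ⧸ N.subgroupOf φ.ker := QuotientGroup.mk ⟨g * (t ^ z)⁻¹, hk⟩ with hkq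
    refine ⟨(kq, ⟨r, by omega⟩), ?_⟩
    have h1 : QuotientGroup.mk kq.out = kq := Quotient.out_eq _
    rw [hkq, QuotientGroup.eq, ← hkq] at h1
    have h2 : (kq.out : G)⁻¹ * (g * (t ^ z)⁻¹) ∈ N := h1
    simp only [f]
    rw [QuotientGroup.eq]
    have h3 : t ^ z = t ^ r * (t ^ m) ^ (z / m) := by
      rw [← zpow_natCast t m, ← zpow_mul, ← zpow_natCast t r, ← zpow_add]
      congr 1
      rw [← hr]
      have := Int.emod_add_mul_ediv z m
      omega
    have h4 : ((kq.out : G) * t ^ r)⁻¹ * g = ((t ^ r)⁻¹ * ((kq.out : G)⁻¹ * (g * (t ^ z)⁻¹)) *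
        ((t ^ r)⁻¹)⁻¹) * (t ^ m) ^ (z / m) := by
      rw [h3]; group
    rw [h4]
    refine mul_mem ((le_sup_left : N ≤ L) (Subgroup.Normal.conj_mem inferInstance _ h2 _)) ?_
    exact (le_sup_right : _ ≤ L) (Subgroup.zpow_mem_zpowers _ _)
  have : Finite (G ⧸ L) := Finite.of_surjective f hf
  exact Subgroup.finiteIndex_of_finite_quotient

/-- Gromov's theorem: a finitely generated group of polynomial growth is virtually nilpotent. -/
theorem PG.exists_finiteIndex_isNilpotent {d : ℕ} [Group.FG G] (hG : PG d G) :
    ∃ N : Subgroup G, N.FiniteIndex ∧ Group.IsNilpotent N := by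
  induction d using Nat.strong_induction_on generalizing G with
  | _ d ih =>
  rcases finite_or_infinite G with hfin | hinf
  · exact ⟨⊥, inferInstance, inferInstance⟩
  obtain ⟨H, hH, φ, hφ⟩ := exists_finiteIndex_surjective_int hG
  have hGH : PG d H := hG.of_injective H.subtype H.subtype_injective
  obtain ⟨e, rfl, he⟩ := hGH.ker φ hφ
  have hKfg : Group.FG φ.ker := (Group.fg_iff_subgroup_fg _).2 (hGH.fg_ker φ hφ)
  obtain ⟨M, hM, hMn⟩ := ih e (Nat.lt_succ_self e) he
  obtain ⟨N₀, hN₀c, hN₀f, hN₀M⟩ := exists_characteristic_le M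
  set N : Subgroup H := N₀.map φ.ker.subtype with hN
  have hNn : N.Normal := ConjAct.normal_of_characteristic_of_normal
  have hsub : N.subgroupOf φ.ker = N₀ := by
    rw [hN, Subgroup.subgroupOf, Subgroup.comap_map_eq_self_of_injective φ.ker.subtype_injective]
  let eN : N₀ ≃* N := N₀.equivMapOfInjective _ φ.ker.subtype_injective
  have hN₀n : Group.IsNilpotent N₀ := by
    have : Group.IsNilpotent (N₀.subgroupOf M) := inferInstance
    exact (Group.isNilpotent_congr (Subgroup.subgroupOfEquivOfLe hN₀M)).1 this
  have hNnil : Group.IsNilpotent N := (Group.isNilpotent_congr eN).1 hN₀n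
  have hN₀fg : Group.FG N₀ := inferInstance
  have hNfg : Group.FG N := Group.fg_of_surjective (f := eN.toMonoidHom) eN.surjective
  obtain ⟨t, ht⟩ := hφ (Multiplicative.ofAdd 1)
  obtain ⟨m, hm, hnil⟩ := hGH.exists_isNilpotent_sup t N
  have hfi : (N.subgroupOf φ.ker).FiniteIndex := by rw [hsub]; exact hN₀f
  have hLfi := finiteIndex_sup_zpowers φ ht N hm
  set L : Subgroup H := N ⊔ Subgroup.zpowers (t ^ m) with hL
  refine ⟨L.map H.subtype, ?_, ?_⟩
  · refine ⟨?_⟩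
    rw [Subgroup.index_map_subtype]
    exact mul_ne_zero hLfi.index_ne_zero hH.index_ne_zero
  · exact (Group.isNilpotent_congr (L.equivMapOfInjective _ H.subtype_injective)).1 hnil

end Gromov

section Cost

variable {G : Type*} [Group G]

/-- `Cost L s x c`: the element `x` is a word in the letters of `L` and their inverses, of total
cost at most `c`, where a letter of weight `w` costs `s ^ w`. -/
inductive Cost (L : List (G × ℕ)) (s : ℝ) : G → ℝ → Prop
  | one {c : ℝ} (hc : 0 ≤ c) : Cost L s 1 c
  | letter_mul {p : G × ℕ} {x : G} {c : ℝ} (hp : p ∈ L) (h : Cost L s x c) :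
      Cost L s (p.1 * x) (s ^ p.2 + c)
  | inv_letter_mul {p : G × ℕ} {x : G} {c : ℝ} (hp : p ∈ L) (h : Cost L s x c) :
      Cost L s (p.1⁻¹ * x) (s ^ p.2 + c)

/-- The subgroup generated by the letters of `L`. -/
def gen (L : List (G × ℕ)) : Subgroup G := Subgroup.closure {x | ∃ w, (x, w) ∈ L}

theorem mem_gen {L : List (G × ℕ)} {p : G × ℕ} (hp : p ∈ L) : p.1 ∈ gen L :=
  Subgroup.subset_closure ⟨p.2, hp⟩

theorem gen_mono {L L' : List (G × ℕ)} (h : L ⊆ L') : gen L ≤ gen L' :=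
  Subgroup.closure_mono fun _ ⟨w, hw⟩ => ⟨w, h hw⟩

namespace Cost

variable {L : List (G × ℕ)} {s : ℝ} {x y : G} {c c' : ℝ}

theorem mono (h : Cost L s x c) (hc : c ≤ c') : Cost L s x c' := by
  induction h generalizing c' with
  | one h => exact .one (h.trans hc)
  | @letter_mul p x c hp h ih =>
    have := letter_mul hp (ih (c' := c' - s ^ p.2) (by linarith))
    rwa [add_sub_cancel] at this
  | @inv_letter_mul p x c hp h ih =>
    have := inv_letter_mul hp (ih (c' := c' - s ^ p.2) (by linarith))
    rwa [add_sub_cancel] at this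

theorem mul (hx : Cost L s x c) (hy : Cost L s y c') : Cost L s (x * y) (c + c') := by
  induction hx with
  | one h => rw [one_mul]; exact hy.mono (by linarith)
  | letter_mul hp h ih => rw [mul_assoc, add_assoc]; exact .letter_mul hp ih
  | inv_letter_mul hp h ih => rw [mul_assoc, add_assoc]; exact .inv_letter_mul hp ih

theorem letter {p : G × ℕ} (hp : p ∈ L) : Cost L s p.1 (s ^ p.2) := by
  simpa using letter_mul hp (.one (L := L) (s := s) le_rfl)

theorem inv_letter {p : G × ℕ} (hp : p ∈ L) : Cost L s p.1⁻¹ (s ^ p.2) := by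
  simpa using inv_letter_mul hp (.one (L := L) (s := s) le_rfl)

theorem inv (hx : Cost L s x c) : Cost L s x⁻¹ c := by
  induction hx with
  | one h => rw [inv_one]; exact .one h
  | letter_mul hp h ih => rw [mul_inv_rev, add_comm]; exact ih.mul (inv_letter hp)
  | inv_letter_mul hp h ih =>
    rw [mul_inv_rev, add_comm, inv_inv]; exact ih.mul (letter hp)

theorem subset {L' : List (G × ℕ)} (hL : L ⊆ L') (hx : Cost L s x c) : Cost L' s x c := by
  induction hx with
  | one h => exact .one h
  | letter_mul hp h ih => exact .letter_mul (hL hp) ih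
  | inv_letter_mul hp h ih => exact .inv_letter_mul (hL hp) ih

theorem npow (hx : Cost L s x c) (n : ℕ) : Cost L s (x ^ n) (n * c) := by
  induction n with
  | zero => simpa using .one le_rfl
  | succ n ih =>
    rw [pow_succ]
    exact (ih.mul hx).mono (by push_cast; linarith)

theorem zpow (hx : Cost L s x c) (n : ℤ) : Cost L s (x ^ n) (|(n : ℝ)| * c) := by
  obtain ⟨m, rfl | rfl⟩ := n.eq_nat_or_neg
  · simpa using hx.npow m
  · simpa using (hx.npow m).inv

theorem conj {e : G} {M : ℝ} (hM : 0 ≤ M)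
    (he : ∀ p ∈ L, Cost L s (e * p.1 * e⁻¹) (M * s ^ p.2)) (hx : Cost L s x c) :
    Cost L s (e * x * e⁻¹) (M * c) := by
  induction hx with
  | one h => simpa using .one (mul_nonneg hM h)
  | @letter_mul p x c hp h ih =>
    have h1 : e * (p.1 * x) * e⁻¹ = (e * p.1 * e⁻¹) * (e * x * e⁻¹) := by group
    rw [h1, mul_add]
    exact (he p hp).mul ih
  | @inv_letter_mul p x c hp h ih =>
    have h1 : e * (p.1⁻¹ * x) * e⁻¹ = (e * p.1 * e⁻¹)⁻¹ * (e * x * e⁻¹) := by group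
    rw [h1, mul_add]
    exact (he p hp).inv.mul ih

theorem conj_pow {e : G} {M : ℝ} (hM : 0 ≤ M)
    (he : ∀ p ∈ L, Cost L s (e * p.1 * e⁻¹) (M * s ^ p.2)) (hx : Cost L s x c) (n : ℕ) :
    Cost L s (e ^ n * x * (e ^ n)⁻¹) (M ^ n * c) := by
  induction n with
  | zero => simpa using hx
  | succ n ih =>
    have h1 : e ^ (n + 1) * x * (e ^ (n + 1))⁻¹ = e * (e ^ n * x * (e ^ n)⁻¹) * e⁻¹ := by
      rw [pow_succ', mul_inv_rev]; simp only [mul_assoc]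
    rw [h1]
    exact (ih.conj hM he).mono (by rw [pow_succ', mul_assoc])

end Cost

theorem exists_cost {L : List (G × ℕ)} {w : ℕ} (hw : ∀ p ∈ L, w ≤ p.2) {x : G} (hx : x ∈ gen L) :
    ∃ C : ℝ, 0 ≤ C ∧ ∀ s : ℝ, 0 < s → s ≤ 1 → Cost L s x (C * s ^ w) := by
  induction hx using Subgroup.closure_induction with
  | mem x hx =>
    obtain ⟨v, hv⟩ := hx
    refine ⟨1, zero_le_one, fun s hs hs1 => (Cost.letter hv).mono ?_⟩
    rw [one_mul]
    exact pow_le_pow_of_le_one hs.le hs1 (hw _ hv)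
  | one => exact ⟨0, le_rfl, fun s hs hs1 => by simpa using Cost.one le_rfl⟩
  | mul x y _ _ ihx ihy =>
    obtain ⟨C, hC, hx⟩ := ihx
    obtain ⟨C', hC', hy⟩ := ihy
    exact ⟨C + C', by positivity, fun s hs hs1 => by
      rw [add_mul]; exact (hx s hs hs1).mul (hy s hs hs1)⟩
  | inv x _ ih =>
    obtain ⟨C, hC, hx⟩ := ih
    exact ⟨C, hC, fun s hs hs1 => (hx s hs hs1).inv⟩

/-- Letters sorted by weight, each acting on the later ones with controlled distortion. -/
def Good : List (G × ℕ) → Prop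
  | [] => True
  | p :: L => Good L ∧ (∀ q ∈ L, p.2 ≤ q.2) ∧ ∃ κ : ℝ, 0 ≤ κ ∧ ∀ s : ℝ, 0 < s → s ≤ 1 → ∀ q ∈ L,
      Cost L s (p.1 * q.1 * p.1⁻¹) ((1 + κ * s ^ p.2) * s ^ q.2) ∧
      Cost L s (p.1⁻¹ * q.1 * p.1⁻¹⁻¹) ((1 + κ * s ^ p.2) * s ^ q.2)

/-- Powers of the letters are realised, modulo the later letters, by short words in `T`. -/
def Low (T : Set G) : List (G × ℕ) → Prop
  | [] => True
  | p :: L => Low T L ∧ ∃ C : ℕ, ∀ r : ℕ, 1 ≤ r → ∀ a : ℕ, a ≤ r ^ p.2 →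
      ∃ u ∈ T ^ (C * r), u⁻¹ * p.1 ^ a ∈ gen L

theorem Cost.collect {e : G} {w : ℕ} {L : List (G × ℕ)} {κ s : ℝ} (hκ : 0 ≤ κ) (hs : 0 < s)
    (he : ∀ q ∈ L, Cost L s (e * q.1 * e⁻¹) ((1 + κ * s ^ w) * s ^ q.2) ∧
      Cost L s (e⁻¹ * q.1 * e⁻¹⁻¹) ((1 + κ * s ^ w) * s ^ q.2)) {x : G} {c c₀ : ℝ}
    (h : Cost ((e, w) :: L) s x c) (hc : c ≤ c₀) :
    ∃ (a : ℤ) (y : G), x = e ^ a * y ∧ |(a : ℝ)| * s ^ w ≤ c ∧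
      Cost L s y (Real.exp (κ * c₀) * c) := by
  have hM : 0 ≤ 1 + κ * s ^ w := by positivity
  have hconj : ∀ (a : ℤ) (q : G × ℕ), q ∈ L → |(a : ℝ)| * s ^ w ≤ c₀ →
      Cost L s ((e ^ a)⁻¹ * q.1 * e ^ a) (Real.exp (κ * c₀) * s ^ q.2) := by
    intro a q hq ha
    have hb : ∀ n : ℕ, (n : ℝ) * s ^ w ≤ c₀ →
        (1 + κ * s ^ w) ^ n * s ^ q.2 ≤ Real.exp (κ * c₀) * s ^ q.2 := by
      intro n hn
      refine mul_le_mul_of_nonneg_right ?_ (by positivity)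
      calc (1 + κ * s ^ w) ^ n ≤ (Real.exp (κ * s ^ w)) ^ n := by
            gcongr; rw [add_comm]; exact Real.add_one_le_exp _
        _ = Real.exp (κ * (n * s ^ w)) := by rw [← Real.exp_nat_mul]; congr 1; ring
        _ ≤ _ := by gcongr
    obtain ⟨n, rfl | rfl⟩ := a.eq_nat_or_neg
    · have := (Cost.letter hq).conj_pow hM (fun q hq => (he q hq).2) n
      simpa using this.mono (hb n (by simpa using ha))
    · have := (Cost.letter hq).conj_pow hM (fun q hq => (he q hq).1) n
      simpa using this.mono (hb n (by simpa using ha))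
  induction h with
  | @one c h => exact ⟨0, 1, by simp, by simpa using h, .one (by positivity)⟩
  | @letter_mul p x c hp h ih =>
    have hsp : 0 < s ^ p.2 := by positivity
    obtain ⟨a, y, rfl, ha, hy⟩ := ih (by linarith)
    rcases List.mem_cons.1 hp with rfl | hp
    · refine ⟨1 + a, y, by rw [zpow_add, zpow_one, mul_assoc], ?_, hy.mono ?_⟩
      · have : |((1 + a : ℤ) : ℝ)| ≤ 1 + |(a : ℝ)| := by
          push_cast; exact (abs_add_le _ _).trans (by simp)
        simp only at hsp ⊢
        nlinarith
      · gcongr; linarith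
    · refine ⟨a, ((e ^ a)⁻¹ * p.1 * e ^ a) * y, by group, by linarith, ?_⟩
      rw [mul_add]
      exact (hconj a p hp (by linarith)).mul hy
  | @inv_letter_mul p x c hp h ih =>
    have hsp : 0 < s ^ p.2 := by positivity
    obtain ⟨a, y, rfl, ha, hy⟩ := ih (by linarith)
    rcases List.mem_cons.1 hp with rfl | hp
    · refine ⟨-1 + a, y, by rw [zpow_add, zpow_neg_one, mul_assoc], ?_, hy.mono ?_⟩
      · have : |((-1 + a : ℤ) : ℝ)| ≤ 1 + |(a : ℝ)| := by
          push_cast; exact (abs_add_le _ _).trans (by simp)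
        simp only at hsp ⊢
        nlinarith
      · gcongr; linarith
    · refine ⟨a, ((e ^ a)⁻¹ * p.1 * e ^ a)⁻¹ * y, by group, by linarith, ?_⟩
      rw [mul_add]
      exact (hconj a p hp (by linarith)).inv.mul hy

end Cost

section Count

variable {G : Type*} [Group G]

theorem Cost.exists_growth_bounds {T : Set G} (hT : T.Finite)
    (L : List (G × ℕ)) (hg : Good L) (hl : Low T L) :
    ∃ D : ℕ, (∀ κ : ℝ, ∃ C : ℝ, ∀ s : ℝ, 0 < s → s ≤ 1 →
      {x | Cost L s x κ}.Finite ∧ ({x | Cost L s x κ}.ncard : ℝ) * s ^ D ≤ C) ∧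
      ∃ c : ℝ, 0 < c ∧ ∃ k : ℕ, ∀ r : ℕ, 1 ≤ r →
        c * (r : ℝ) ^ D ≤ ((T ^ (k * r) ∩ (gen L : Set G)).ncard : ℝ) := by
  induction L with
  | nil =>
    have hsub : ∀ κ s, {x : G | Cost [] s x κ} ⊆ {1} := by
      intro κ s x hx
      cases hx with
      | one => rfl
      | letter_mul hp => simp at hp
      | inv_letter_mul hp => simp at hp
    refine ⟨0, fun κ => ⟨1, fun s _ _ => ⟨(finite_singleton _).subset (hsub κ s), ?_⟩⟩,
      1, one_pos, 0, fun r _ => ?_⟩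
    · rw [pow_zero, mul_one]
      have := ncard_le_ncard (hsub κ s) (finite_singleton _)
      rw [ncard_singleton] at this
      exact_mod_cast this
    · have : (T ^ (0 * r) ∩ (gen ([] : List (G × ℕ)) : Set G)) = {1} := by
        rw [zero_mul, pow_zero]
        ext x
        simp only [mem_inter_iff, Set.mem_one, mem_singleton_iff, SetLike.mem_coe,
          and_iff_left_iff_imp]
        rintro rfl
        exact one_mem _
      rw [this]; simp
  | cons p L ih =>
    obtain ⟨e, w⟩ := p
    obtain ⟨hgL, hw, κ₀, hκ₀, hκ⟩ := hg
    obtain ⟨hlL, C₁, hC₁⟩ := hl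
    obtain ⟨D, hup, c, hc, k, hlow⟩ := ih hgL hlL
    have hsub : L ⊆ (e, w) :: L := List.subset_cons_self _ _
    have he : e ∈ gen ((e, w) :: L) := PolyGrowth.mem_gen (p := (e, w)) List.mem_cons_self
    have hcol : ∀ κ s x, 0 < s → s ≤ 1 → Cost ((e, w) :: L) s x κ → ∃ (a : ℤ) (y : G),
        x = e ^ a * y ∧ |(a : ℝ)| * s ^ w ≤ κ ∧ Cost L s y (Real.exp (κ₀ * κ) * κ) :=
      fun κ s x hs hs1 hx => hx.collect hκ₀ hs (hκ s hs hs1) le_rfl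
    by_cases hinf : ∀ a : ℤ, e ^ a ∈ gen L → a = 0
    · refine ⟨w + D, fun κ => ?_, c, hc, C₁ + k, fun r hr => ?_⟩
      · obtain ⟨C, hC⟩ := hup (Real.exp (κ₀ * κ) * κ)
        refine ⟨(2 * max κ 0 + 1) * C, fun s hs hs1 => ?_⟩
        obtain ⟨hfin, hcard⟩ := hC s hs hs1
        set W := {x | Cost L s x (Real.exp (κ₀ * κ) * κ)}
        have hsw : 0 < s ^ w := by positivity
        set m := ⌊max κ 0 / s ^ w⌋₊
        have hm : (m : ℝ) * s ^ w ≤ max κ 0 := by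
          rw [← le_div_iff₀ hsw]; exact Nat.floor_le (by positivity)
        have hsubs : {x | Cost ((e, w) :: L) s x κ} ⊆
            (fun q : ℤ × G => e ^ q.1 * q.2) '' (Icc (-(m : ℤ)) m ×ˢ W) := by
          intro x hx
          obtain ⟨a, y, rfl, ha, hy⟩ := hcol κ s x hs hs1 hx
          refine ⟨(a, y), ⟨?_, hy⟩, rfl⟩
          have h2 : a.natAbs ≤ m := by
            refine Nat.le_floor ?_
            rw [le_div_iff₀ hsw, Nat.cast_natAbs, Int.cast_abs]
            exact ha.trans (le_max_left _ _)
          simp only [mem_Icc]; omega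
        have hf1 : (Icc (-(m : ℤ)) m ×ˢ W).Finite := (finite_Icc _ _).prod hfin
        refine ⟨(hf1.image _).subset hsubs, ?_⟩
        have h3 : ({x | Cost ((e, w) :: L) s x κ}.ncard : ℝ) ≤ (2 * m + 1) * W.ncard := by
          have := (ncard_le_ncard hsubs (hf1.image _)).trans (ncard_image_le hf1)
          rw [ncard_prod, ← Finset.coe_Icc, ncard_coe_finset, Int.card_Icc] at this
          have h5 : ((m : ℤ) + 1 - -(m : ℤ)).toNat = 2 * m + 1 := by omega
          rw [h5] at this
          exact_mod_cast this
        calc _ ≤ ((2 * m + 1) * W.ncard) * s ^ (w + D) := by gcongr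
          _ = ((2 * m + 1) * s ^ w) * (W.ncard * s ^ D) := by rw [pow_add]; ring
          _ ≤ (2 * max κ 0 + 1) * C := by
            gcongr
            · have : s ^ w ≤ 1 := pow_le_one₀ hs.le hs1
              linarith
      · have hu : ∀ a : ℕ, a < r ^ w → ∃ u ∈ T ^ (C₁ * r), u⁻¹ * e ^ a ∈ gen L :=
          fun a ha => hC₁ r hr a ha.le
        choose! u hu hv using hu
        have hfin : (T ^ ((C₁ + k) * r) ∩ (gen ((e, w) :: L) : Set G)).Finite :=
          (finite_pow hT _).subset inter_subset_left
        have hinj : InjOn (fun q : ℕ × G => u q.1 * q.2)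
            ((Finset.range (r ^ w) : Set ℕ) ×ˢ (T ^ (k * r) ∩ (gen L : Set G))) := by
          rintro ⟨a, y⟩ ⟨ha, hy⟩ ⟨b, z⟩ ⟨hb, hz⟩ hab
          simp only [Finset.coe_range, mem_Iio] at ha hb
          simp only at hab hy hz
          have hab2 : a = b := by
            have h2 := hinf ((a : ℤ) - b) ?_
            · omega
            · have h3 : u a = u b * z * y⁻¹ := by rw [← hab, mul_inv_cancel_right]
              have h4 : e ^ ((a : ℤ) - b) =
                  ((u b)⁻¹ * e ^ b)⁻¹ * z * y⁻¹ * ((u a)⁻¹ * e ^ a) := by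
                rw [h3]; group
              rw [h4]
              exact mul_mem (mul_mem (mul_mem (inv_mem (hv b hb)) hz.2) (inv_mem hy.2)) (hv a ha)
          subst hab2
          simpa using hab
        have himg : (fun q : ℕ × G => u q.1 * q.2) ''
            ((Finset.range (r ^ w) : Set ℕ) ×ˢ (T ^ (k * r) ∩ (gen L : Set G))) ⊆
            T ^ ((C₁ + k) * r) ∩ (gen ((e, w) :: L) : Set G) := by
          rintro _ ⟨⟨a, y⟩, ⟨ha, hy⟩, rfl⟩
          simp only [Finset.coe_range, mem_Iio] at ha
          refine ⟨?_, mul_mem ?_ (gen_mono hsub hy.2)⟩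
          · rw [add_mul, pow_add]; exact mul_mem_mul (hu a ha) hy.1
          · have h2 := mul_mem (pow_mem he a) (inv_mem (gen_mono hsub (hv a ha)))
            simpa using h2
        have h5 := ncard_le_ncard himg hfin
        rw [hinj.ncard_image, ncard_prod, ncard_coe_finset, Finset.card_range] at h5
        calc c * (r : ℝ) ^ (w + D) = (r : ℝ) ^ w * (c * (r : ℝ) ^ D) := by rw [pow_add]; ring
          _ ≤ (r : ℝ) ^ w * ((T ^ (k * r) ∩ (gen L : Set G)).ncard : ℝ) := by
            gcongr; exact hlow r hr
          _ ≤ _ := by exact_mod_cast h5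
    · have hfo : ∃ o : ℕ, 1 ≤ o ∧ e ^ o ∈ gen L := by
        push Not at hinf
        obtain ⟨a, ha, ha0⟩ := hinf
        obtain ⟨n, rfl | rfl⟩ := a.eq_nat_or_neg
        · exact ⟨n, by omega, by simpa using ha⟩
        · exact ⟨n, by omega, by simpa using ha⟩
      obtain ⟨o, ho, heo⟩ := hfo
      obtain ⟨C₂, hC₂, hcost⟩ := exists_cost hw heo
      refine ⟨D, fun κ => ?_, c, hc, k, fun r hr => (hlow r hr).trans ?_⟩
      · obtain ⟨C, hC⟩ := hup (C₂ * κ + Real.exp (κ₀ * κ) * κ)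
        refine ⟨o * C, fun s hs hs1 => ?_⟩
        obtain ⟨hfin, hcard⟩ := hC s hs hs1
        set W := {x | Cost L s x (C₂ * κ + Real.exp (κ₀ * κ) * κ)}
        have hsubs : {x | Cost ((e, w) :: L) s x κ} ⊆
            (fun q : ℕ × G => e ^ q.1 * q.2) '' ((Finset.range o : Set ℕ) ×ˢ W) := by
          intro x hx
          obtain ⟨a, y, rfl, ha, hy⟩ := hcol κ s x hs hs1 hx
          have ho' : (o : ℤ) ≠ 0 := by omega
          have h1 := Int.emod_nonneg a ho'
          have h2 := Int.emod_lt_of_pos a (show (0 : ℤ) < o by omega)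
          refine ⟨((a % o).toNat, (e ^ o) ^ (a / o) * y), ⟨?_, ?_⟩, ?_⟩
          · simp only [Finset.coe_range, mem_Iio]; omega
          · refine Cost.mono (((hcost s hs hs1).zpow (a / o)).mul hy) ?_
            refine add_le_add_left ?_ _
            have h3 : |((a / o : ℤ) : ℝ)| ≤ |(a : ℝ)| := by
              exact_mod_cast Int.abs_ediv_le_abs a o
            calc |((a / o : ℤ) : ℝ)| * (C₂ * s ^ w) ≤ |(a : ℝ)| * (C₂ * s ^ w) := by gcongr
              _ = C₂ * (|(a : ℝ)| * s ^ w) := by ring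
              _ ≤ C₂ * κ := by gcongr
          · simp only
            rw [← mul_assoc, ← zpow_natCast, ← zpow_natCast, ← zpow_mul, ← zpow_add,
              Int.toNat_of_nonneg h1, Int.emod_add_mul_ediv]
        have hf1 : ((Finset.range o : Set ℕ) ×ˢ W).Finite := (Finset.finite_toSet _).prod hfin
        refine ⟨(hf1.image _).subset hsubs, ?_⟩
        have h3 : ({x | Cost ((e, w) :: L) s x κ}.ncard : ℝ) ≤ o * W.ncard := by
          have := (ncard_le_ncard hsubs (hf1.image _)).trans (ncard_image_le hf1)
          rw [ncard_prod, ncard_coe_finset, Finset.card_range] at this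
          exact_mod_cast this
        calc _ ≤ (o * W.ncard) * s ^ D := by gcongr
          _ = o * (W.ncard * s ^ D) := by ring
          _ ≤ _ := by gcongr
      · exact_mod_cast ncard_le_ncard (inter_subset_inter_right _ (gen_mono hsub))
          ((finite_pow hT _).subset inter_subset_left)

end Count

section NilpotentGrowth
open scoped commutatorElement

variable {G : Type*} [Group G]

theorem commutator_commutator_le_of_rotate {H₁ H₂ H₃ N : Subgroup G} [N.Normal]
    (h1 : ⁅⁅H₂, H₃⁆, H₁⁆ ≤ N) (h2 : ⁅⁅H₃, H₁⁆, H₂⁆ ≤ N) : ⁅⁅H₁, H₂⁆, H₃⁆ ≤ N := by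
  have key : ∀ A : Subgroup G, A ≤ N ↔ A.map (QuotientGroup.mk' N) = ⊥ := by
    intro A
    rw [Subgroup.map_eq_bot_iff, QuotientGroup.ker_mk']
  rw [key] at h1 h2 ⊢
  simp only [Subgroup.map_commutator] at h1 h2 ⊢
  exact Subgroup.commutator_commutator_eq_bot_of_rotate h1 h2

theorem commutator_lowerCentralSeries_le (i j : ℕ) :
    ⁅(⊤ : Subgroup G).lowerCentralSeries i, (⊤ : Subgroup G).lowerCentralSeries j⁆ ≤
      (⊤ : Subgroup G).lowerCentralSeries (i + j + 1) := by
  induction j generalizing i with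
  | zero => rfl
  | succ j ih =>
    rw [Subgroup.commutator_comm]
    refine commutator_commutator_le_of_rotate (H₁ := (⊤ : Subgroup G).lowerCentralSeries j)
      (H₂ := ⊤) ?_ ?_
    · rw [Subgroup.commutator_comm ⊤]
      refine (ih (i + 1)).trans (le_of_eq ?_)
      congr 1; ring
    · refine (Subgroup.commutator_mono (ih i) le_rfl).trans (le_of_eq ?_)
      rfl

theorem commutator_pow_pow_of_central {z s : G} (h : ∀ g, Commute ⁅z, s⁆ g) (m n : ℕ) :
    ⁅z ^ m, s ^ n⁆ = ⁅z, s⁆ ^ (m * n) := by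
  have h1 : ∀ n, ⁅z, s ^ n⁆ = ⁅z, s⁆ ^ n := by
    intro n
    induction n with
    | zero => simp
    | succ n ih =>
      have : ⁅z, s ^ (n + 1)⁆ = ⁅z, s ^ n⁆ * (s ^ n * ⁅z, s⁆ * (s ^ n)⁻¹) := by
        simp only [commutatorElement_def, pow_succ]; group
      rw [this, ih, ← (h (s ^ n)).eq, mul_inv_cancel_right, pow_succ]
  induction m with
  | zero => simp
  | succ m ih =>
    have : ⁅z ^ (m + 1), s ^ n⁆ = z * ⁅z ^ m, s ^ n⁆ * z⁻¹ * ⁅z, s ^ n⁆ := by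
      simp only [commutatorElement_def, pow_succ']; group
    rw [this, ih, h1, ← ((h z).pow_left _).eq, mul_inv_cancel_right, ← pow_add]
    congr 1; ring

theorem lowerCentralSeries_commute_mk {j : ℕ} {x : G}
    (hx : x ∈ (⊤ : Subgroup G).lowerCentralSeries j)
    (y : G ⧸ (⊤ : Subgroup G).lowerCentralSeries (j + 1)) :
    Commute (x : G ⧸ (⊤ : Subgroup G).lowerCentralSeries (j + 1)) y := by
  obtain ⟨y, rfl⟩ := QuotientGroup.mk_surjective y
  rw [← commutatorElement_eq_one_iff_commute]
  exact (QuotientGroup.eq_one_iff ⁅x, y⁆).2 (Subgroup.commutator_mem_commutator hx trivial)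

theorem exists_mem_pow {T : Set G} (hinv : T⁻¹ = T) (h1 : 1 ∈ T)
    (hT : Subgroup.closure T = ⊤) (x : G) : ∃ n, x ∈ T ^ n := by
  have hx : x ∈ Subgroup.closure T := hT ▸ Subgroup.mem_top x
  induction hx using Subgroup.closure_induction with
  | mem x hx => exact ⟨1, by rwa [pow_one]⟩
  | one => exact ⟨1, by rwa [pow_one]⟩
  | mul x y _ _ hx hy =>
    obtain ⟨m, hm⟩ := hx
    obtain ⟨n, hn⟩ := hy
    exact ⟨m + n, by rw [pow_add]; exact mul_mem_mul hm hn⟩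
  | inv x _ hx =>
    obtain ⟨n, hn⟩ := hx
    exact ⟨n, by rw [← hinv, inv_pow]; simpa using hn⟩

theorem commutatorElement_mem_pow {T : Set G} (hinv : T⁻¹ = T) {x y : G} {m n : ℕ}
    (hx : x ∈ T ^ m) (hy : y ∈ T ^ n) : ⁅x, y⁆ ∈ T ^ (m + n + m + n) := by
  have key : ∀ {x : G} {m : ℕ}, x ∈ T ^ m → x⁻¹ ∈ T ^ m := by
    intro x m hx
    rw [← hinv, inv_pow]; simpa using hx
  rw [commutatorElement_def]
  simp only [pow_add]
  exact mul_mem_mul (mul_mem_mul (mul_mem_mul hx hy) (key hx)) (key hy)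

theorem exists_short_pow_mod_lowerCentralSeries {T : Set G} (hinv : T⁻¹ = T) (h1 : 1 ∈ T)
    (hT : Subgroup.closure T = ⊤) (j : ℕ) {x : G}
    (hx : x ∈ (⊤ : Subgroup G).lowerCentralSeries j) :
    ∃ C : ℕ, ∀ r : ℕ, 1 ≤ r → ∀ a : ℕ, a ≤ r ^ (j + 1) →
      ∃ u ∈ T ^ (C * r), u⁻¹ * x ^ a ∈ (⊤ : Subgroup G).lowerCentralSeries (j + 1) := by
  have hmono : ∀ {m n : ℕ}, m ≤ n → T ^ m ⊆ T ^ n := fun h => pow_subset_pow_right h1 h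
  induction j generalizing x with
  | zero =>
    obtain ⟨C, hC⟩ := exists_mem_pow hinv h1 hT x
    refine ⟨C, fun r hr a ha => ⟨x ^ a, ?_, by rw [inv_mul_cancel]; exact one_mem _⟩⟩
    have : x ^ a ∈ T ^ (C * a) := by rw [pow_mul]; exact pow_mem_pow hC
    refine hmono ?_ this
    rw [zero_add, pow_one] at ha
    gcongr
  | succ j ih =>
    set N := (⊤ : Subgroup G).lowerCentralSeries (j + 1 + 1) with hN
    simp only [← QuotientGroup.eq] at ih ⊢
    suffices hs : x ∈ (⊤ : Subgroup G).lowerCentralSeries (j + 1) ∧ ∃ C : ℕ, ∀ r : ℕ, 1 ≤ r →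
        ∀ a : ℕ, a ≤ r ^ (j + 1 + 1) → ∃ u ∈ T ^ (C * r), (u : G ⧸ N) = (x ^ a : G) from hs.2
    rw [Subgroup.lowerCentralSeries_succ, Subgroup.commutator_def] at hx
    induction hx using Subgroup.closure_induction with
    | mem x hx =>
      obtain ⟨z, hz, s, -, rfl⟩ := hx
      have hzs : ⁅z, s⁆ ∈ (⊤ : Subgroup G).lowerCentralSeries (j + 1) :=
        Subgroup.commutator_mem_commutator hz trivial
      refine ⟨hzs, ?_⟩
      obtain ⟨C, hC⟩ := ih hz
      obtain ⟨m, hm⟩ := exists_mem_pow hinv h1 hT s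
      obtain ⟨n, hn⟩ := exists_mem_pow hinv h1 hT z
      refine ⟨(C + m + C + m) + (n + m + n + m), fun r hr a ha => ?_⟩
      have hq : a / r ≤ r ^ (j + 1) := by
        refine Nat.div_le_of_le_mul ?_
        rw [← pow_succ']; exact ha
      obtain ⟨u, hu, huz⟩ := hC r hr (a / r) hq
      refine ⟨⁅u, s ^ r⁆ * ⁅z, s ^ (a % r)⁆, ?_, ?_⟩
      · have hsr : s ^ r ∈ T ^ (m * r) := by rw [pow_mul]; exact pow_mem_pow hm
        have hsr' : s ^ (a % r) ∈ T ^ (m * r) :=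
          hmono (Nat.mul_le_mul_left _ (Nat.mod_lt _ hr).le)
            (by rw [pow_mul]; exact pow_mem_pow hm)
        have hz' : z ∈ T ^ (n * r) := hmono (Nat.le_mul_of_pos_right _ hr) hn
        have h2 := mul_mem_mul (commutatorElement_mem_pow hinv hu hsr)
          (commutatorElement_mem_pow hinv hz' hsr')
        rw [← pow_add] at h2
        convert h2 using 2
        ring
      · have hcen := lowerCentralSeries_commute_mk hzs
        rw [QuotientGroup.eq] at huz
        have hcu := lowerCentralSeries_commute_mk huz
        have huz' : (u : G ⧸ N) = (z : G ⧸ N) ^ (a / r) * ((u⁻¹ * z ^ (a / r) : G) : G ⧸ N)⁻¹ := by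
          rw [← QuotientGroup.mk_pow, ← QuotientGroup.mk_inv, ← QuotientGroup.mk_mul]
          congr 1; group
        have hmk : ∀ p q : G, ((⁅p, q⁆ : G) : G ⧸ N) = ⁅(p : G ⧸ N), (q : G ⧸ N)⁆ := fun p q => rfl
        rw [hmk] at hcen
        have hcs : ∀ p c q : G ⧸ N, Commute c (p⁻¹) → Commute c q → ⁅p * c, q⁆ = ⁅p, q⁆ := by
          intro p c q hp hq
          rw [commutatorElement_def, commutatorElement_def, mul_assoc p c q, hq.eq, mul_inv_rev]
          group
        rw [QuotientGroup.mk_mul, hmk, hmk, QuotientGroup.mk_pow, QuotientGroup.mk_pow,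
          QuotientGroup.mk_pow, huz', hcs _ _ _ (hcu _).inv_left (hcu _).inv_left,
          commutator_pow_pow_of_central hcen, hmk]
        have h3 := commutator_pow_pow_of_central hcen 1 (a % r)
        rw [pow_one, one_mul] at h3
        rw [h3, ← pow_add, Nat.div_add_mod']
    | one =>
      refine ⟨one_mem _, 0, fun r hr a ha => ⟨1, by simp, by simp⟩⟩
    | mul x y _ _ hx hy =>
      obtain ⟨hx, C, hC⟩ := hx
      obtain ⟨hy, C', hC'⟩ := hy
      refine ⟨mul_mem hx hy, C + C', fun r hr a ha => ?_⟩
      obtain ⟨u, hu, hux⟩ := hC r hr a ha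
      obtain ⟨v, hv, hvx⟩ := hC' r hr a ha
      refine ⟨u * v, by rw [add_mul, pow_add]; exact mul_mem_mul hu hv, ?_⟩
      rw [QuotientGroup.mk_mul, hux, hvx, QuotientGroup.mk_pow, QuotientGroup.mk_pow,
        QuotientGroup.mk_pow, QuotientGroup.mk_mul, (lowerCentralSeries_commute_mk hx _).mul_pow]
    | inv x _ hx =>
      obtain ⟨hx, C, hC⟩ := hx
      refine ⟨inv_mem hx, C, fun r hr a ha => ?_⟩
      obtain ⟨u, hu, hux⟩ := hC r hr a ha
      refine ⟨u⁻¹, by rw [← hinv, inv_pow]; simpa using hu, ?_⟩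
      rw [QuotientGroup.mk_inv, hux, ← QuotientGroup.mk_inv, inv_pow]

end NilpotentGrowth

section Letters
open scoped commutatorElement

variable {G : Type*} [Group G]

/-- The letters of `L` of weight greater than `j` generate the `j`-th term of the lower central
series (indexed from zero), for all `j ≥ n`. -/
def Full (L : List (G × ℕ)) (n : ℕ) : Prop :=
  ∀ j, n ≤ j → ∃ L' ⊆ L, (∀ q ∈ L', j + 1 ≤ q.2) ∧ (⊤ : Subgroup G).lowerCentralSeries j ≤ gen L'

theorem Full.mono {L L' : List (G × ℕ)} {n : ℕ} (h : Full L n) (hL : L ⊆ L') : Full L' n := by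
  intro j hj
  obtain ⟨L₁, h1, h2⟩ := h j hj
  exact ⟨L₁, List.Subset.trans h1 hL, h2⟩

/-- Letters sorted by weight, adapted to the lower central series. -/
def Adapted : List (G × ℕ) → Prop
  | [] => True
  | p :: L => Adapted L ∧ (∀ q ∈ L, p.2 ≤ q.2) ∧
      (∃ j, p.2 = j + 1 ∧ p.1 ∈ (⊤ : Subgroup G).lowerCentralSeries j) ∧ Full L p.2

theorem Adapted.exists_mem {L : List (G × ℕ)} (h : Adapted L) {p : G × ℕ} (hp : p ∈ L) :
    ∃ j, p.2 = j + 1 ∧ p.1 ∈ (⊤ : Subgroup G).lowerCentralSeries j := by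
  induction L with
  | nil => simp at hp
  | cons q L ih =>
    rcases List.mem_cons.1 hp with rfl | hp
    · exact h.2.2.1
    · exact ih h.1 hp

theorem exists_adapted [Group.FG G] {c : ℕ} (hc : (⊤ : Subgroup G).lowerCentralSeries c = ⊥)
    (m i : ℕ) (him : i + m = c) :
    ∃ L : List (G × ℕ), Adapted L ∧ (∀ q ∈ L, i + 1 ≤ q.2) ∧ Full L i := by
  induction m generalizing i with
  | zero =>
    refine ⟨[], trivial, by simp, fun j hj => ⟨[], by simp, by simp, ?_⟩⟩
    have : (⊤ : Subgroup G).lowerCentralSeries j ≤ ⊥ :=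
      hc ▸ Subgroup.lowerCentralSeries_antitone (⊤ : Subgroup G) (by omega)
    exact this.trans bot_le
  | succ m ih =>
    obtain ⟨L, hL, hw, hf⟩ := ih (i + 1) (by omega)
    obtain ⟨F, hFfin, hF, hle⟩ := exists_lowerCentralSeries_le_closure_sup (G := G) i
    have key : ∀ l : List G, (∀ x ∈ l, x ∈ F) →
        Adapted (l.map (fun x => (x, i + 1)) ++ L) := by
      intro l hl
      induction l with
      | nil => simpa using hL
      | cons x l ih' =>
        refine ⟨ih' fun y hy => hl y (by simp [hy]), ?_, ⟨i, rfl, hF (hl x (by simp))⟩,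
          hf.mono (by simp)⟩
        intro q hq
        rcases List.mem_append.1 hq with hq | hq
        · obtain ⟨y, -, rfl⟩ := List.mem_map.1 hq
          exact le_rfl
        · exact (by omega : i + 1 ≤ i + 1 + 1).trans (hw q hq)
    set L' := hFfin.toFinset.toList.map (fun x => (x, i + 1)) ++ L with hL'
    have hw' : ∀ q ∈ L', i + 1 ≤ q.2 := by
      intro q hq
      rcases List.mem_append.1 hq with hq | hq
      · obtain ⟨y, -, rfl⟩ := List.mem_map.1 hq
        exact le_rfl
      · exact (by omega : i + 1 ≤ i + 1 + 1).trans (hw q hq)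
    refine ⟨L', key _ (by simp), hw', fun j hj => ?_⟩
    rcases hj.eq_or_lt with rfl | hj
    · refine ⟨L', List.Subset.refl _, hw', hle.trans (sup_le ?_ ?_)⟩
      · refine (Subgroup.closure_le _).2 fun x hx => ?_
        refine PolyGrowth.mem_gen (p := (x, i + 1)) (List.mem_append_left _ ?_)
        exact List.mem_map.2 ⟨x, by simpa using hx, rfl⟩
      · obtain ⟨L₁, h1, -, h3⟩ := hf (i + 1) le_rfl
        exact h3.trans (gen_mono (List.Subset.trans h1 (List.subset_append_right _ _)))
    · exact hf.mono (List.subset_append_right _ _) j hj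

theorem exists_uniform_bound {ι : Type*} (L : List ι) {P : ι → ℝ → Prop}
    (hmono : ∀ q a b, a ≤ b → P q a → P q b) (h : ∀ q ∈ L, ∃ κ, P q κ) :
    ∃ κ : ℝ, 0 ≤ κ ∧ ∀ q ∈ L, P q κ := by
  induction L with
  | nil => exact ⟨0, le_rfl, by simp⟩
  | cons q L ih =>
    obtain ⟨κ, hκ, h1⟩ := ih fun p hp => h p (by simp [hp])
    obtain ⟨κ', h2⟩ := h q (by simp)
    refine ⟨max κ κ', hκ.trans (le_max_left _ _), fun p hp => ?_⟩
    rcases List.mem_cons.1 hp with rfl | hp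
    · exact hmono _ _ _ (le_max_right _ _) h2
    · exact hmono _ _ _ (le_max_left _ _) (h1 p hp)

theorem exists_cost_conj {L : List (G × ℕ)} {w v i j : ℕ} {e x : G} (hw : w = i + 1)
    (he : e ∈ (⊤ : Subgroup G).lowerCentralSeries i) (hv : v = j + 1)
    (hx : x ∈ (⊤ : Subgroup G).lowerCentralSeries j) (hL : Full L w) (hxL : (x, v) ∈ L) :
    ∃ κ : ℝ, ∀ s : ℝ, 0 < s → s ≤ 1 → Cost L s (e * x * e⁻¹) ((1 + κ * s ^ w) * s ^ v) := by
  have h1 := commutator_lowerCentralSeries_le i j (Subgroup.commutator_mem_commutator he hx)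
  obtain ⟨L', hL', hw', hgen⟩ := hL (i + j + 1) (by omega)
  obtain ⟨C, hC, hcost⟩ := exists_cost hw' (hgen h1)
  refine ⟨C, fun s hs hs1 => ?_⟩
  have h2 : e * x * e⁻¹ = ⁅e, x⁆ * x := by rw [commutatorElement_def]; group
  rw [h2]
  refine (((hcost s hs hs1).subset hL').mul (Cost.letter hxL)).mono (le_of_eq ?_)
  have : i + j + 1 + 1 = w + v := by omega
  rw [this]
  ring

theorem Adapted.good {L : List (G × ℕ)} (h : Adapted L) : Good L := by
  induction L with
  | nil => trivial
  | cons p L ih =>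
    obtain ⟨hL, hw, ⟨i, hi, he⟩, hf⟩ := h
    refine ⟨ih hL, hw, ?_⟩
    have huni := exists_uniform_bound L (P := fun q κ => ∀ s : ℝ, 0 < s → s ≤ 1 →
      Cost L s (p.1 * q.1 * p.1⁻¹) ((1 + κ * s ^ p.2) * s ^ q.2) ∧
      Cost L s (p.1⁻¹ * q.1 * p.1⁻¹⁻¹) ((1 + κ * s ^ p.2) * s ^ q.2))
      (fun q a b hab hP s hs hs1 =>
        ⟨(hP s hs hs1).1.mono (by gcongr), (hP s hs hs1).2.mono (by gcongr)⟩) fun q hq => by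
      obtain ⟨j, hj, hx⟩ := hL.exists_mem hq
      obtain ⟨κ, h1⟩ := exists_cost_conj hi he hj hx hf hq
      obtain ⟨κ', h2⟩ := exists_cost_conj hi (inv_mem he) hj hx hf hq
      refine ⟨max κ κ', fun s hs hs1 => ⟨(h1 s hs hs1).mono ?_, (h2 s hs hs1).mono ?_⟩⟩
      · gcongr; exact le_max_left _ _
      · gcongr; exact le_max_right _ _
    obtain ⟨κ, hκ, hP⟩ := huni
    exact ⟨κ, hκ, fun s hs hs1 q hq => hP q hq s hs hs1⟩

theorem Adapted.low {T : Set G} (hinv : T⁻¹ = T) (h1 : 1 ∈ T)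
    (hT : Subgroup.closure T = ⊤) {L : List (G × ℕ)} (h : Adapted L) : Low T L := by
  induction L with
  | nil => trivial
  | cons p L ih =>
    obtain ⟨hL, hw, ⟨i, hi, he⟩, hf⟩ := h
    refine ⟨ih hL, ?_⟩
    obtain ⟨C, hC⟩ := exists_short_pow_mod_lowerCentralSeries hinv h1 hT i he
    obtain ⟨L', hL', -, hgen⟩ := hf (i + 1) (by omega)
    refine ⟨C, fun r hr a ha => ?_⟩
    obtain ⟨u, hu, hmem⟩ := hC r hr a (by rwa [← hi])
    exact ⟨u, hu, gen_mono hL' (hgen hmem)⟩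

/-- Two-sided polynomial growth bounds: balls `T ^ r` have size comparable to `r ^ D`. -/
def Growth (T : Set G) (D : ℕ) : Prop :=
  ∃ c C : ℝ, 0 < c ∧ ∀ r : ℕ, 1 ≤ r →
    c * (r : ℝ) ^ D ≤ ((T ^ r).ncard : ℝ) ∧ ((T ^ r).ncard : ℝ) ≤ C * (r : ℝ) ^ D

/-- A weak form of `Growth`, with a change of radius in the lower bound. -/
theorem growth_of_weak {T : Set G} (hTf : T.Finite) (h1 : 1 ∈ T) {D k : ℕ} {c C : ℝ} (hc : 0 < c)
    (hlow : ∀ r : ℕ, 1 ≤ r → c * (r : ℝ) ^ D ≤ ((T ^ (k * r)).ncard : ℝ))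
    (hup : ∀ r : ℕ, 1 ≤ r → ((T ^ r).ncard : ℝ) ≤ C * (r : ℝ) ^ D) : Growth T D := by
  have hpos : ∀ r, (1 : ℝ) ≤ ((T ^ r).ncard : ℝ) := by
    intro r
    have : 0 < (T ^ r).ncard := (ncard_pos (finite_pow hTf r)).2 ⟨1, one_mem_pow h1⟩
    exact_mod_cast this
  set K : ℝ := 2 * (k + 1) with hK
  refine ⟨min c 1 / K ^ D, C, by positivity, fun r hr => ⟨?_, hup r hr⟩⟩
  rw [div_mul_eq_mul_div, div_le_iff₀ (by positivity)]
  by_cases hq : r / (k + 1) = 0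
  · have hlt : r < k + 1 := by
      rcases Nat.div_eq_zero_iff.1 hq with h | h <;> omega
    have h2 : (r : ℝ) ≤ K := by
      have : (r : ℝ) < k + 1 := by exact_mod_cast hlt
      rw [hK]; linarith
    calc min c 1 * (r : ℝ) ^ D ≤ 1 * K ^ D := by
          gcongr; exact min_le_right _ _
      _ ≤ _ := by gcongr; exact hpos r
  · set q := r / (k + 1) with hqd
    have hq1 : 1 ≤ q := Nat.one_le_iff_ne_zero.2 hq
    have h2 : (r : ℝ) ≤ K * q := by
      have h3 : r < (k + 1) * (q + 1) := by
        rw [hqd]; exact Nat.lt_mul_div_succ r (by omega)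
      have h4 : (r : ℝ) < (k + 1) * (q + 1) := by exact_mod_cast h3
      have h5 : (1 : ℝ) ≤ q := by exact_mod_cast hq1
      rw [hK]; nlinarith
    have h6 : k * q ≤ r := by
      have := Nat.div_mul_le_self r (k + 1)
      rw [← hqd] at this
      nlinarith
    calc min c 1 * (r : ℝ) ^ D ≤ c * (K * q) ^ D := by
          gcongr; exact min_le_left _ _
      _ = (c * (q : ℝ) ^ D) * K ^ D := by rw [mul_pow]; ring
      _ ≤ _ := by
        gcongr
        refine (hlow q hq1).trans ?_
        exact_mod_cast ncard_le_ncard (pow_subset_pow_right h1 h6) (finite_pow hTf r)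

theorem exists_growth_of_isNilpotent [Group.IsNilpotent G] {T : Set G} (hTf : T.Finite)
    (hinv : T⁻¹ = T) (h1 : 1 ∈ T) (hT : Subgroup.closure T = ⊤) : ∃ D, Growth T D := by
  have : Group.FG G := (Group.fg_iff).2 ⟨T, hT, hTf⟩
  obtain ⟨c, hc⟩ := (Subgroup.nilpotent_iff_lowerCentralSeries (G := G)).1 inferInstance
  obtain ⟨L, hL, hw, hf⟩ := exists_adapted hc c 0 (by omega)
  obtain ⟨D, hup, c₀, hc₀, k, hlow⟩ := Cost.exists_growth_bounds hTf L hL.good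
    (hL.low hinv h1 hT)
  obtain ⟨L', hL', hw', hgen⟩ := hf 0 le_rfl
  have htop : ∀ x, x ∈ gen L' := fun x => hgen (by simp)
  obtain ⟨κ, hκ, hcost⟩ := exists_uniform_bound hTf.toFinset.toList
    (P := fun x κ => ∀ s : ℝ, 0 < s → s ≤ 1 → Cost L s x (κ * s)) (by
      intro q a b hab h s hs hs1
      exact (h s hs hs1).mono (by gcongr)) (by
      intro x hx
      obtain ⟨C, hC, h⟩ := exists_cost hw' (htop x)
      exact ⟨C, fun s hs hs1 => by simpa using (h s hs hs1).subset hL'⟩)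
  obtain ⟨C, hC⟩ := hup κ
  refine ⟨D, growth_of_weak hTf h1 (k := k) (C := C) hc₀ (fun r hr => ?_) (fun r hr => ?_)⟩
  · refine (hlow r hr).trans ?_
    exact_mod_cast ncard_le_ncard inter_subset_left (finite_pow hTf _)
  · have hr0 : (0 : ℝ) < r := by exact_mod_cast hr
    have hr1 : ((r : ℝ))⁻¹ ≤ 1 := inv_le_one_of_one_le₀ (by exact_mod_cast hr)
    obtain ⟨hfin, hcard⟩ := hC (r : ℝ)⁻¹ (by positivity) hr1
    rw [inv_pow, ← div_eq_mul_inv, div_le_iff₀ (by positivity)] at hcard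
    refine le_trans ?_ hcard
    have hsub : T ^ r ⊆ {x | Cost L (r : ℝ)⁻¹ x κ} := by
      have : ∀ n : ℕ, T ^ n ⊆ {x | Cost L (r : ℝ)⁻¹ x (n * (κ * (r : ℝ)⁻¹))} := by
        intro n
        induction n with
        | zero =>
          intro x hx
          rw [pow_zero, Set.mem_one] at hx
          subst hx
          exact .one (by simp)
        | succ n ih =>
          rw [pow_succ]
          rintro _ ⟨x, hx, y, hy, rfl⟩
          refine (Cost.mul (ih hx) (hcost y (by simpa using hy) _ (by positivity) hr1)).mono ?_
          push_cast; linarith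
      refine (this r).trans fun x hx => ?_
      refine Cost.mono hx (le_of_eq ?_)
      field_simp
    exact_mod_cast ncard_le_ncard hsub hfin

end Letters

section Overgroup

variable {G : Type*} [Group G]

theorem exists_growth_of_finiteIndex {T : Set G} (hTf : T.Finite) (hinv : T⁻¹ = T) (h1 : 1 ∈ T)
    (hT : Subgroup.closure T = ⊤) (N : Subgroup G) [N.FiniteIndex] [Group.IsNilpotent N] :
    ∃ D, Growth T D := by
  have : Group.FG G := (Group.fg_iff).2 ⟨T, hT, hTf⟩
  have : Group.FG N := inferInstance
  obtain ⟨B, hB, hBf⟩ := (Group.fg_iff (G := N)).1 this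
  have hQ : Finite (G ⧸ N) := Subgroup.finite_quotient_of_finiteIndex
  let o : G → G := fun g => Quotient.out (g : G ⧸ N)
  have ho : ∀ g, (o g)⁻¹ * g ∈ N := fun g => by
    rw [← QuotientGroup.eq]; exact QuotientGroup.out_eq' _
  let n : G → N := fun g => ⟨(o g)⁻¹ * g, ho g⟩
  let F : Set G := insert 1 (range (Quotient.out : G ⧸ N → G))
  have hF : F.Finite := (finite_range _).insert 1
  let A₀ : Set N := n '' (T * F) ∪ B
  have hA₀ : A₀.Finite := ((hTf.mul hF).image _).union hBf
  let A : Set N := A₀ ∪ A₀⁻¹ ∪ {1}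
  have hA : A.Finite := (hA₀.union hA₀.inv).union (finite_singleton 1)
  have hA1 : (1 : N) ∈ A := Or.inr rfl
  have hAinv : A⁻¹ = A := by
    simp only [A, union_inv, inv_inv, inv_singleton, inv_one]
    rw [union_comm A₀⁻¹]
  have hAtop : Subgroup.closure A = ⊤ :=
    top_le_iff.1 (hB ▸ Subgroup.closure_mono fun x hx => Or.inl (Or.inl (Or.inr hx)))
  obtain ⟨D, c, C, hc, hgr⟩ := exists_growth_of_isNilpotent hA hAinv hA1 hAtop
  let ι : N →* G := N.subtype
  have hcard : ∀ r, ((ι '' A) ^ r).ncard = (A ^ r).ncard := by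
    intro r
    rw [← image_pow, ncard_image_of_injective _ N.subtype_injective]
  have hstep : T * F ⊆ F * ι '' A := by
    intro x hx
    refine ⟨o x, Or.inr ⟨_, rfl⟩, n x, ⟨n x, Or.inl (Or.inl (Or.inl ⟨x, hx, rfl⟩)), rfl⟩, ?_⟩
    exact mul_inv_cancel_left _ _
  have hsub : ∀ r, T ^ r * F ⊆ F * (ι '' A) ^ r := by
    intro r
    induction r with
    | zero => simp
    | succ r ih =>
      rw [pow_succ', mul_assoc, pow_succ']
      refine (mul_subset_mul_left ih).trans ?_
      rw [← mul_assoc, ← mul_assoc]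
      exact mul_subset_mul_right hstep
  have hfinA : ∀ r, ((ι '' A) ^ r).Finite := finite_pow (hA.image _)
  obtain ⟨k, hk⟩ : ∃ k, ι '' A ⊆ T ^ k := by
    have : ∀ B : Set G, B.Finite → ∃ k, B ⊆ T ^ k := by
      intro B hB
      induction B, hB using Set.Finite.induction_on with
      | empty => exact ⟨0, by simp⟩
      | @insert x B _ _ ih =>
        obtain ⟨k, hk⟩ := ih
        obtain ⟨m, hm⟩ := exists_mem_pow hinv h1 hT x
        exact ⟨k + m, insert_subset (pow_subset_pow_right h1 (by omega) hm)
          (hk.trans (pow_subset_pow_right h1 (by omega)))⟩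
    exact this _ (hA.image _)
  refine ⟨D, growth_of_weak hTf h1 (k := k) (C := F.ncard * C) hc (fun r hr => ?_)
    (fun r hr => ?_)⟩
  · refine (hgr r hr).1.trans ?_
    rw [← hcard, pow_mul]
    exact_mod_cast ncard_le_ncard (pow_subset_pow_left hk) (by
      rw [← pow_mul]; exact finite_pow hTf _)
  · have h2 : (T ^ r).ncard ≤ F.ncard * (A ^ r).ncard := by
      rw [← hcard]
      refine (ncard_le_ncard ?_ (hF.mul (hfinA r))).trans (natCard_mul_le)
      exact fun x hx => hsub r ⟨x, hx, 1, Or.inl rfl, mul_one x⟩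
    calc ((T ^ r).ncard : ℝ) ≤ F.ncard * (A ^ r).ncard := by exact_mod_cast h2
      _ ≤ F.ncard * (C * (r : ℝ) ^ D) := by gcongr; exact (hgr r hr).2
      _ = _ := by ring

theorem PG.exists_growth {d : ℕ} (hG : PG d G) {T : Set G} (hTf : T.Finite) (hinv : T⁻¹ = T)
    (h1 : 1 ∈ T) (hT : Subgroup.closure T = ⊤) : ∃ D, Growth T D := by
  have : Group.FG G := (Group.fg_iff).2 ⟨T, hT, hTf⟩
  obtain ⟨N, hN, hnil⟩ := PG.exists_finiteIndex_isNilpotent hG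
  exact exists_growth_of_finiteIndex hTf hinv h1 hT N

end Overgroup

section Annulus

variable {G : Type*} {δ : G → G → ℕ} {V : ℕ → ℕ}

/-- An integer-valued geodesic doubling metric, all of whose balls of radius `k` have
cardinality `V k`. -/
structure IsWordMetric (δ : G → G → ℕ) (V : ℕ → ℕ) : Prop where
  self (x : G) : δ x x = 0
  symm (x y : G) : δ x y = δ y x
  tri (x y z : G) : δ x z ≤ δ x y + δ y z
  finite (g : G) (k : ℕ) : {x | δ x g ≤ k}.Finite
  ncard_eq (g : G) (k : ℕ) : {x | δ x g ≤ k}.ncard = V k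
  geod (x y : G) (k : ℕ) : k ≤ δ x y → ∃ z, δ z y = k ∧ δ x z + k ≤ δ x y
  doub (m : ℕ) : ∃ K : ℕ, ∀ r, V (m * (r + 1)) ≤ K * V r

/-- The ball with centre `p.1` and radius `p.2`. -/
noncomputable def IsWordMetric.bal (h : IsWordMetric δ V) (p : G × ℕ) : Finset G :=
  (h.finite p.1 p.2).toFinset

namespace IsWordMetric

theorem mem_bal (h : IsWordMetric δ V) {p : G × ℕ} {x : G} : x ∈ h.bal p ↔ δ x p.1 ≤ p.2 := by
  simp [bal]

theorem card_bal (h : IsWordMetric δ V) (p : G × ℕ) : (h.bal p).card = V p.2 := by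
  rw [← h.ncard_eq p.1 p.2, bal, ncard_eq_toFinset_card _ (h.finite p.1 p.2)]

theorem center_mem_bal (h : IsWordMetric δ V) (p : G × ℕ) : p.1 ∈ h.bal p := by
  rw [h.mem_bal, h.self]; exact Nat.zero_le _

theorem mono [Nonempty G] (h : IsWordMetric δ V) : Monotone V := by
  intro a b hab
  obtain ⟨g⟩ := ‹Nonempty G›
  rw [← h.card_bal (g, a), ← h.card_bal (g, b)]
  refine Finset.card_le_card fun x hx => ?_
  rw [h.mem_bal] at hx ⊢
  exact hx.trans hab

theorem pos [Nonempty G] (h : IsWordMetric δ V) (k : ℕ) : 0 < V k := by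
  obtain ⟨g⟩ := ‹Nonempty G›
  rw [← h.card_bal (g, k)]
  exact Finset.card_pos.2 ⟨g, h.center_mem_bal (g, k)⟩

end IsWordMetric

theorem exists_greedy_subfamily {ι : Type*} (s : ι → Finset G) (hs : ∀ i, (s i).Nonempty)
    (rad : ι → ℕ) (P : Finset ι) :
    ∃ Q ⊆ P, (Q : Set ι).PairwiseDisjoint s ∧
      ∀ p ∈ P, ∃ q ∈ Q, rad p ≤ rad q ∧ ¬ Disjoint (s p) (s q) := by
  classical
  induction P using Finset.strongInduction with
  | H P ih =>
    rcases P.eq_empty_or_nonempty with rfl | hP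
    · exact ⟨∅, by simp, by simp, by simp⟩
    · obtain ⟨p₀, hp₀, hmax⟩ := P.exists_max_image rad hP
      obtain ⟨Q, hQ, hdis, hcov⟩ := ih (P.filter fun p => Disjoint (s p) (s p₀)) (by
        refine Finset.filter_ssubset.2 ⟨p₀, hp₀, fun hd => ?_⟩
        exact (hs p₀).ne_empty (disjoint_self.1 hd))
      refine ⟨insert p₀ Q, Finset.insert_subset hp₀ (hQ.trans (Finset.filter_subset _ _)), ?_, ?_⟩
      · rw [Finset.coe_insert]
        refine hdis.insert fun q hq _ => ?_
        exact (Finset.mem_filter.1 (hQ hq)).2.symm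
      · intro p hp
        by_cases hd : Disjoint (s p) (s p₀)
        · obtain ⟨q, hq, h⟩ := hcov p (Finset.mem_filter.2 ⟨hp, hd⟩)
          exact ⟨q, Finset.mem_insert_of_mem hq, h⟩
        · exact ⟨p₀, Finset.mem_insert_self _ _, hmax p hp, hd⟩

namespace IsWordMetric

theorem dist_le_of_not_disjoint (h : IsWordMetric δ V) {p q : G × ℕ}
    (hd : ¬ Disjoint (h.bal p) (h.bal q)) : δ p.1 q.1 ≤ p.2 + q.2 := by
  obtain ⟨x, hx, hy⟩ := Finset.not_disjoint_iff.1 hd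
  rw [h.mem_bal] at hx hy
  have := h.tri p.1 x q.1
  rw [h.symm p.1 x] at this
  omega

/-- The points at distance in `(a, b]` from `g`. -/
noncomputable def ann (h : IsWordMetric δ V) (g : G) (a b : ℕ) : Finset G :=
  (h.bal (g, b)).filter fun x => a < δ x g

theorem mem_ann (h : IsWordMetric δ V) {g x : G} {a b : ℕ} :
    x ∈ h.ann g a b ↔ a < δ x g ∧ δ x g ≤ b := by
  rw [ann, Finset.mem_filter, h.mem_bal, and_comm]

theorem exists_card_ann_le (h : IsWordMetric δ V) :
    ∃ K : ℕ, ∀ (g : G) (k j : ℕ), 1 ≤ j → 3 * j ≤ k →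
      (h.ann g (k - j) k).card ≤ K * (h.ann g (k - 3 * j) (k - j)).card := by
  classical
  obtain ⟨K, hK⟩ := h.doub 4
  refine ⟨K, fun g k j hj hk => ?_⟩
  obtain ⟨Q, hQ, hdis, hcov⟩ := exists_greedy_subfamily (fun y => h.bal (y, j - 1))
    (fun y => ⟨y, h.center_mem_bal (y, j - 1)⟩) (fun _ => 0)
    ((h.bal (g, k - 2 * j)).filter fun y => δ y g = k - 2 * j)
  have hout : h.ann g (k - j) k ⊆ Q.biUnion fun q => h.bal (q, 4 * j) := by
    intro x hx
    rw [h.mem_ann] at hx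
    obtain ⟨z, hz, hxz⟩ := h.geod x g (k - 2 * j) (by omega)
    obtain ⟨q, hq, -, hd⟩ := hcov z (by
      rw [Finset.mem_filter, h.mem_bal]; exact ⟨hz.le, hz⟩)
    have h1 := h.dist_le_of_not_disjoint hd
    have h2 := h.tri x z q
    simp only at h1
    rw [Finset.mem_biUnion]
    refine ⟨q, hq, ?_⟩
    rw [h.mem_bal]
    simp only
    omega
  have hin : Q.biUnion (fun q => h.bal (q, j - 1)) ⊆ h.ann g (k - 3 * j) (k - j) := by
    intro x hx
    obtain ⟨q, hq, hx⟩ := Finset.mem_biUnion.1 hx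
    rw [h.mem_bal] at hx
    simp only at hx
    have h0 := (Finset.mem_filter.1 (hQ hq)).2
    have h1 := h.tri x q g
    have h2 := h.tri q x g
    rw [h.symm q x] at h2
    rw [h.mem_ann]
    omega
  calc (h.ann g (k - j) k).card ≤ ∑ q ∈ Q, (h.bal (q, 4 * j)).card :=
        (Finset.card_le_card hout).trans Finset.card_biUnion_le
    _ ≤ ∑ q ∈ Q, K * (h.bal (q, j - 1)).card := by
        refine Finset.sum_le_sum fun q _ => ?_
        rw [h.card_bal, h.card_bal]
        have := hK (j - 1)
        rwa [Nat.sub_add_cancel hj] at this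
    _ = K * (Q.biUnion fun q => h.bal (q, j - 1)).card := by
        rw [Finset.card_biUnion fun x hx y hy hxy => hdis hx hy hxy, Finset.mul_sum]
    _ ≤ _ := Nat.mul_le_mul_left _ (Finset.card_le_card hin)

theorem exists_card_ann_le_mul (h : IsWordMetric δ V) {ε : ℝ} (hε : 0 < ε) :
    ∃ Λ : ℕ, 1 ≤ Λ ∧ ∀ (g : G) (s t : ℕ), Λ * t ≤ s →
      ((h.ann g (s - t) (s + t)).card : ℝ) ≤ ε * V s := by
  obtain ⟨K, hK⟩ := h.exists_card_ann_le
  obtain ⟨K₂, hK₂⟩ := h.doub 2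
  set θ : ℝ := K / (K + 1) with hθ
  have hθ0 : 0 ≤ θ := by positivity
  have hθ1 : θ < 1 := by rw [hθ, div_lt_one (by positivity)]; linarith
  obtain ⟨n, hn⟩ := exists_pow_lt_of_lt_one (show (0 : ℝ) < ε / (K₂ + 1) by positivity) hθ1
  refine ⟨2 * 3 ^ n, Nat.one_le_iff_ne_zero.2 (by positivity), fun g s t hst => ?_⟩
  rcases Nat.eq_zero_or_pos t with rfl | ht
  · have : h.ann g (s - 0) (s + 0) = ∅ := by
      refine Finset.eq_empty_of_forall_notMem fun x hx => ?_
      rw [h.mem_ann] at hx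
      omega
    rw [this]; simp only [Finset.card_empty, Nat.cast_zero]; positivity
  have hG : Nonempty G := ⟨g⟩
  have hts : t ≤ s := by
    have : 1 ≤ 3 ^ n := Nat.one_le_pow _ _ (by norm_num)
    nlinarith
  have key : ∀ i ≤ n, ((h.ann g (s - t) (s + t)).card : ℝ) ≤
      θ ^ i * (h.ann g (s + t - 2 * t * 3 ^ i) (s + t)).card := by
    intro i hi
    induction i with
    | zero =>
      rw [pow_zero, pow_zero, one_mul]
      have : s + t - 2 * t * 1 = s - t := by omega
      rw [this]
    | succ i ih =>
      refine (ih (by omega)).trans ?_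
      rw [pow_succ θ i, mul_assoc (θ ^ i)]
      refine mul_le_mul_of_nonneg_left ?_ (pow_nonneg hθ0 i)
      have h3 : 3 ^ (i + 1) ≤ 3 ^ n := Nat.pow_le_pow_right (by norm_num) hi
      have h3' : 2 * t * 3 ^ (i + 1) ≤ s := by nlinarith
      have h4 : 3 * (2 * t * 3 ^ i) = 2 * t * 3 ^ (i + 1) := by ring
      have h5 := hK g (s + t) (2 * t * 3 ^ i) (Nat.one_le_iff_ne_zero.2 (by positivity))
        (by omega)
      rw [h4] at h5
      set a := s + t - 2 * t * 3 ^ i with ha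
      set b := s + t - 2 * t * 3 ^ (i + 1) with hb
      have h6 : (h.ann g a (s + t)).card + (h.ann g b a).card ≤ (h.ann g b (s + t)).card := by
        classical
        rw [← Finset.card_union_of_disjoint]
        · refine Finset.card_le_card fun x hx => ?_
          rw [Finset.mem_union, h.mem_ann, h.mem_ann] at hx
          rw [h.mem_ann]
          omega
        · refine Finset.disjoint_left.2 fun x hx hy => ?_
          rw [h.mem_ann] at hx hy
          omega
      have h5' : ((h.ann g a (s + t)).card : ℝ) ≤ K * (h.ann g b a).card := by exact_mod_cast h5
      have h6' : ((h.ann g a (s + t)).card : ℝ) + (h.ann g b a).card ≤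
          (h.ann g b (s + t)).card := by exact_mod_cast h6
      rw [hθ, div_mul_eq_mul_div, le_div_iff₀ (by positivity)]
      have hK0 : (0 : ℝ) ≤ K := by positivity
      nlinarith
  have h7 : ((h.ann g (s + t - 2 * t * 3 ^ n) (s + t)).card : ℝ) ≤ K₂ * V s := by
    have h8 : (h.ann g (s + t - 2 * t * 3 ^ n) (s + t)).card ≤ V (s + t) := by
      rw [← h.card_bal (g, s + t)]; exact Finset.card_le_card (Finset.filter_subset _ _)
    have h9 := h8.trans ((h.mono (by omega : s + t ≤ 2 * (s + 1))).trans (hK₂ s))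
    exact_mod_cast h9
  calc _ ≤ θ ^ n * (K₂ * V s) := (key n le_rfl).trans (by gcongr)
    _ ≤ ε / (K₂ + 1) * (K₂ * V s) := by gcongr
    _ = (ε * V s) * (K₂ / (K₂ + 1)) := by ring
    _ ≤ (ε * V s) * 1 := by
      gcongr
      rw [div_le_one (by positivity)]; linarith
    _ = _ := mul_one _

end IsWordMetric
end Annulus

section Covering

variable {G : Type*} {δ : G → G → ℕ} {V : ℕ → ℕ}

namespace IsWordMetric

theorem card_biUnion_bal [DecidableEq G] (h : IsWordMetric δ V) {Q : Finset (G × ℕ)}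
    (hQ : (Q : Set (G × ℕ)).PairwiseDisjoint h.bal) : (Q.biUnion h.bal).card = ∑ q ∈ Q, V q.2 := by
  rw [Finset.card_biUnion fun x hx y hy hxy => hQ hx hy hxy]
  exact Finset.sum_congr rfl fun q _ => h.card_bal q

open Classical in
theorem exists_covering_family [Nonempty G] (h : IsWordMetric δ V) {ε : ℝ} (hε : 0 < ε) :
    ∃ L M : ℕ, 1 ≤ M ∧ ∀ (P : Finset (G × ℕ)) (r : G → ℕ → ℕ),
      (P : Set (G × ℕ)).PairwiseDisjoint h.bal → (∀ p ∈ P, ∀ m < M, p.2 ≤ r p.1 m) →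
      (∀ p ∈ P, ∀ m m', m < m' → m' < M → L * r p.1 m ≤ r p.1 m') →
      ∃ Q : Finset (G × ℕ), (∀ q ∈ Q, ∃ p ∈ P, ∃ m < M, q = (p.1, r p.1 m)) ∧
        (Q : Set (G × ℕ)).PairwiseDisjoint h.bal ∧
        (∑ p ∈ P, (V p.2 : ℝ)) ≤
          ∑ p ∈ P with h.bal p ⊆ Q.biUnion h.bal, (V p.2 : ℝ) + ε * ∑ q ∈ Q, (V q.2 : ℝ) := by
  obtain ⟨Λ, hΛ, hann⟩ := h.exists_card_ann_le_mul (half_pos hε)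
  obtain ⟨K, hK⟩ := h.doub 3
  set M : ℕ := ⌈2 * K / ε⌉₊ + 1 with hM
  have hKM : (K : ℝ) ≤ M * (ε / 2) := by
    have h1 : 2 * K / ε ≤ (⌈2 * K / ε⌉₊ : ℝ) := Nat.le_ceil _
    rw [div_le_iff₀ hε] at h1
    rw [hM]; push_cast; nlinarith
  refine ⟨2 * Λ, M, by omega, fun P r hP hρ hr => ?_⟩
  set R : Finset (G × ℕ) := (P ×ˢ Finset.range M).image fun a => (a.1.1, r a.1.1 a.2) with hR
  obtain ⟨Q, hQR, hQ, hcov⟩ := exists_greedy_subfamily h.bal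
    (fun q => ⟨q.1, h.center_mem_bal q⟩) (fun q => q.2) R
  have hQmem : ∀ q ∈ Q, ∃ p ∈ P, ∃ m < M, q = (p.1, r p.1 m) := by
    intro q hq
    obtain ⟨⟨p, m⟩, ha, rfl⟩ := Finset.mem_image.1 (hQR hq)
    rw [Finset.mem_product, Finset.mem_range] at ha
    exact ⟨p, ha.1, m, ha.2, rfl⟩
  have hcov' : ∀ p ∈ P, ∀ m < M, ∃ q ∈ Q, r p.1 m ≤ q.2 ∧ δ p.1 q.1 ≤ r p.1 m + q.2 := by
    intro p hp m hm
    obtain ⟨q, hq, h1, h2⟩ := hcov (p.1, r p.1 m)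
      (Finset.mem_image.2 ⟨(p, m), Finset.mem_product.2 ⟨hp, Finset.mem_range.2 hm⟩, rfl⟩)
    exact ⟨q, hq, h1, h.dist_le_of_not_disjoint h2⟩
  refine ⟨Q, hQmem, hQ, ?_⟩
  set B := P.filter fun p => ¬ h.bal p ⊆ Q.biUnion h.bal with hB
  set W := B.filter fun p => ∃ m < M, ∃ q ∈ Q, r p.1 m ≤ q.2 ∧ δ p.1 q.1 ≤ r p.1 m + q.2 ∧
    2 * Λ * r p.1 m ≤ q.2 with hW
  set W' := B.filter fun p => ¬ ∃ m < M, ∃ q ∈ Q, r p.1 m ≤ q.2 ∧ δ p.1 q.1 ≤ r p.1 m + q.2 ∧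
    2 * Λ * r p.1 m ≤ q.2 with hW'
  have hBP : B ⊆ P := Finset.filter_subset _ _
  have hWP : W ⊆ P := (Finset.filter_subset _ _).trans hBP
  have hWP' : W' ⊆ P := (Finset.filter_subset _ _).trans hBP
  have hdisj : ∀ {Y : Finset (G × ℕ)}, Y ⊆ P → (Y : Set (G × ℕ)).PairwiseDisjoint h.bal :=
    fun hY => hP.subset (Finset.coe_subset.2 hY)
  have hW1 : (∑ p ∈ W, (V p.2 : ℝ)) ≤ ε / 2 * ∑ q ∈ Q, (V q.2 : ℝ) := by
    have hsub : W.biUnion h.bal ⊆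
        Q.biUnion fun q => h.ann q.1 (q.2 - q.2 / Λ) (q.2 + q.2 / Λ) := by
      intro x hx
      obtain ⟨p, hp, hx⟩ := Finset.mem_biUnion.1 hx
      obtain ⟨hpB, m, hm, q, hq, h1, h2, h3⟩ := Finset.mem_filter.1 hp
      obtain ⟨hpP, hbad⟩ := Finset.mem_filter.1 hpB
      refine Finset.mem_biUnion.2 ⟨q, hq, ?_⟩
      have h4 : 2 * r p.1 m ≤ q.2 / Λ := by
        rw [Nat.le_div_iff_mul_le (by omega)]; linarith
      have h5 : q.2 / Λ ≤ q.2 := Nat.div_le_self _ _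
      have h6 := hρ p hpP m hm
      have h7 : ∃ y ∈ h.bal p, y ∉ h.bal q := by
        by_contra hcon
        push Not at hcon
        exact hbad fun y hy => Finset.mem_biUnion.2 ⟨q, hq, hcon y hy⟩
      obtain ⟨y, hy, hyq⟩ := h7
      rw [h.mem_bal] at hx hy hyq
      have h8 := h.tri y p.1 q.1
      have h9 := h.tri x p.1 q.1
      have h10 := h.tri p.1 x q.1
      rw [h.symm p.1 x] at h10
      rw [h.mem_ann]
      omega
    have h1 : (∑ p ∈ W, V p.2) ≤
        ∑ q ∈ Q, (h.ann q.1 (q.2 - q.2 / Λ) (q.2 + q.2 / Λ)).card := by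
      rw [← h.card_biUnion_bal (hdisj hWP)]
      exact (Finset.card_le_card hsub).trans Finset.card_biUnion_le
    have h2 : (∑ p ∈ W, (V p.2 : ℝ)) ≤
        ∑ q ∈ Q, ((h.ann q.1 (q.2 - q.2 / Λ) (q.2 + q.2 / Λ)).card : ℝ) := by exact_mod_cast h1
    rw [Finset.mul_sum]
    exact h2.trans (Finset.sum_le_sum fun q _ => hann q.1 q.2 _ (Nat.mul_div_le _ _))
  have hW2 : (∑ p ∈ W', (V p.2 : ℝ)) ≤ ε / 2 * ∑ q ∈ Q, (V q.2 : ℝ) := by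
    have hmult : ∀ x ∈ W'.biUnion h.bal,
        M ≤ (Q.filter fun q => x ∈ h.bal (q.1, 3 * q.2)).card := by
      intro x hx
      obtain ⟨p, hp, hx⟩ := Finset.mem_biUnion.1 hx
      obtain ⟨hpB, hno⟩ := Finset.mem_filter.1 hp
      have hpP := hBP hpB
      choose! c hcQ hc1 hc2 using hcov' p hpP
      have hc3 : ∀ m < M, (c m).2 < 2 * Λ * r p.1 m := by
        intro m hm
        by_contra hcon
        exact hno ⟨m, hm, c m, hcQ m hm, hc1 m hm, hc2 m hm, not_lt.1 hcon⟩
      have hlt : ∀ m m', m < m' → m' < M → (c m).2 < (c m').2 := fun m m' hmm hm' =>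
        (hc3 m (hmm.trans hm')).trans_le ((hr p hpP m m' hmm hm').trans (hc1 m' hm'))
      calc M = (Finset.range M).card := (Finset.card_range M).symm
        _ ≤ _ := Finset.card_le_card_of_injOn c ?_ ?_
      · intro m hm
        have hm := Finset.mem_range.1 (Finset.mem_coe.1 hm)
        refine Finset.mem_coe.2 (Finset.mem_filter.2 ⟨hcQ m hm, ?_⟩)
        rw [h.mem_bal] at hx ⊢
        have h1 := hc1 m hm
        have h2 := hc2 m hm
        have h3 := hρ p hpP m hm
        have h4 := h.tri x p.1 (c m).1
        simp only
        omega
      · intro m hm m' hm' hcc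
        have hm := Finset.mem_range.1 (Finset.mem_coe.1 hm)
        have hm' := Finset.mem_range.1 (Finset.mem_coe.1 hm')
        rcases lt_trichotomy m m' with hlt' | rfl | hlt'
        · have := hlt m m' hlt' hm'
          rw [hcc] at this; omega
        · rfl
        · have := hlt m' m hlt' hm
          rw [hcc] at this; omega
    have h1 : (∑ p ∈ W', V p.2) * M ≤ ∑ q ∈ Q, K * V q.2 := by
      rw [← h.card_biUnion_bal (hdisj hWP'), ← smul_eq_mul]
      refine (Finset.card_nsmul_le_sum _ _ _ hmult).trans ?_
      refine (Finset.sum_card_bipartiteAbove_eq_sum_card_bipartiteBelow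
        (fun (x : G) (q : G × ℕ) => x ∈ h.bal (q.1, 3 * q.2))).trans_le ?_
      refine Finset.sum_le_sum fun q _ => ?_
      calc _ ≤ (h.bal (q.1, 3 * q.2)).card :=
            Finset.card_le_card fun x hx => (Finset.mem_filter.1 hx).2
        _ = V (3 * q.2) := h.card_bal _
        _ ≤ K * V q.2 := (h.mono (by omega)).trans (hK q.2)
    have h2 : (∑ p ∈ W', (V p.2 : ℝ)) * M ≤ K * ∑ q ∈ Q, (V q.2 : ℝ) := by
      rw [Finset.mul_sum]; exact_mod_cast h1
    have hM0 : (0 : ℝ) < M := by rw [hM]; positivity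
    have hS : (0 : ℝ) ≤ ∑ q ∈ Q, (V q.2 : ℝ) := by positivity
    nlinarith
  have hsplit : (∑ p ∈ P, (V p.2 : ℝ)) =
      ∑ p ∈ P with h.bal p ⊆ Q.biUnion h.bal, (V p.2 : ℝ) +
        (∑ p ∈ W, (V p.2 : ℝ) + ∑ p ∈ W', (V p.2 : ℝ)) := by
    rw [hW, hW', Finset.sum_filter_add_sum_filter_not, hB, Finset.sum_filter_add_sum_filter_not]
  rw [hsplit]
  linarith

end IsWordMetric
end Covering

section Stages

variable {G : Type*} {δ : G → G → ℕ} {V : ℕ → ℕ}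

namespace IsWordMetric

theorem sum_filter_le_sum [DecidableEq G] (h : IsWordMetric δ V) {F : G → ℝ} (hF : ∀ x, 0 ≤ F x)
    {P P' Q : Finset (G × ℕ)} (hP : (P : Set (G × ℕ)).PairwiseDisjoint h.bal) (hP' : P' ⊆ P)
    (hQ : (Q : Set (G × ℕ)).PairwiseDisjoint h.bal)
    (hPQ : ∀ p ∈ P', h.bal p ⊆ Q.biUnion h.bal) :
    ∑ p ∈ P', ∑ x ∈ h.bal p, F x ≤ ∑ q ∈ Q, ∑ x ∈ h.bal q, F x := by
  rw [← Finset.sum_biUnion fun x hx y hy hxy => hP (hP' hx) (hP' hy) hxy,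
    ← Finset.sum_biUnion fun x hx y hy hxy => hQ hx hy hxy]
  exact Finset.sum_le_sum_of_subset_of_nonneg (Finset.biUnion_subset.2 hPQ) fun x _ _ => hF x

/-- Two successive covering steps, first by balls on which the averages of `F` exceed `β` and then
by balls on which they are below `α`, multiply the total size of a disjoint family of balls by a
factor greater than `1`. -/
theorem exists_double_step [Nonempty G] (h : IsWordMetric δ V) {α β : ℝ} (hα : 0 < α)
    (hαβ : α < β) :
    ∃ (L M : ℕ) (c : ℝ), 1 ≤ M ∧ 1 < c ∧ ∀ F : G → ℝ, (∀ x, 0 ≤ F x) →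
      ∀ (P : Finset (G × ℕ)) (r s : G → ℕ → ℕ),
      (P : Set (G × ℕ)).PairwiseDisjoint h.bal → (∀ p ∈ P, ∀ m < M, p.2 ≤ r p.1 m) →
      (∀ p ∈ P, ∀ m m', m < m' → m' < M → L * r p.1 m ≤ r p.1 m') →
      (∀ p ∈ P, ∀ m m', m < m' → m' < M → L * s p.1 m ≤ s p.1 m') →
      (∀ p ∈ P, ∀ m < M, ∀ m' < M, r p.1 m ≤ s p.1 m') →
      (∀ p ∈ P, ∀ m < M, β * V (r p.1 m) ≤ ∑ x ∈ h.bal (p.1, r p.1 m), F x) →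
      (∀ p ∈ P, ∀ m < M, ∑ x ∈ h.bal (p.1, s p.1 m), F x ≤ α * V (s p.1 m)) →
      ∃ Q : Finset (G × ℕ), (∀ q ∈ Q, ∃ p ∈ P, ∃ m < M, q = (p.1, s p.1 m)) ∧
        (Q : Set (G × ℕ)).PairwiseDisjoint h.bal ∧
        c * ∑ p ∈ P, (V p.2 : ℝ) ≤ ∑ q ∈ Q, (V q.2 : ℝ) := by
  classical
  have hβ : 0 < β := hα.trans hαβ
  set ε := (β - α) / (4 * β) with hε
  have hε0 : 0 < ε := div_pos (by linarith) (by positivity)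
  have hεβ : β * ε = (β - α) / 4 := by rw [hε]; field_simp
  have hε1 : ε ≤ 1 := by rw [hε, div_le_one (by positivity)]; linarith
  have hlt : (α + β * ε) * (1 + ε) < β := by nlinarith
  have hpos : 0 < (α + β * ε) * (1 + ε) := by positivity
  obtain ⟨L, M, hM, hcov⟩ := h.exists_covering_family hε0
  refine ⟨L, M, β / ((α + β * ε) * (1 + ε)), hM, (one_lt_div hpos).2 hlt,
    fun F hF P r s hP hPr hr hs hrs hsup hinf => ?_⟩
  obtain ⟨Q, hQP, hQ, hPQ⟩ := hcov P r hP hPr hr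
  have hQP' : ∀ q ∈ Q, (∀ m < M, q.2 ≤ s q.1 m) ∧
      (∀ m m', m < m' → m' < M → L * s q.1 m ≤ s q.1 m') ∧
      β * V q.2 ≤ ∑ x ∈ h.bal q, F x := by
    intro q hq
    obtain ⟨p, hp, m, hm, rfl⟩ := hQP q hq
    exact ⟨hrs p hp m hm, hs p hp, hsup p hp m hm⟩
  obtain ⟨R, hRQ, hR, hQR⟩ := hcov Q s hQ (fun q hq => (hQP' q hq).1) fun q hq => (hQP' q hq).2.1
  have hRP : ∀ q ∈ R, ∃ p ∈ P, ∃ m < M, q = (p.1, s p.1 m) := by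
    intro q hq
    obtain ⟨q', hq', m, hm, rfl⟩ := hRQ q hq
    obtain ⟨p, hp, m', hm', rfl⟩ := hQP q' hq'
    exact ⟨p, hp, m, hm, rfl⟩
  refine ⟨R, hRP, hR, ?_⟩
  have h1 : ∑ p ∈ P, (V p.2 : ℝ) ≤ (1 + ε) * ∑ q ∈ Q, (V q.2 : ℝ) := by
    have := h.sum_filter_le_sum (F := fun _ => 1) (fun _ => zero_le_one) hP
      (Finset.filter_subset (fun p => h.bal p ⊆ Q.biUnion h.bal) P) hQ
      fun p hp => (Finset.mem_filter.1 hp).2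
    simp only [Finset.sum_const, h.card_bal, nsmul_eq_mul, mul_one] at this
    linarith
  have h2 : β * (∑ q ∈ Q, (V q.2 : ℝ) - ε * ∑ q ∈ R, (V q.2 : ℝ)) ≤
      α * ∑ q ∈ R, (V q.2 : ℝ) := by
    calc β * (∑ q ∈ Q, (V q.2 : ℝ) - ε * ∑ q ∈ R, (V q.2 : ℝ))
        ≤ β * ∑ q ∈ Q with h.bal q ⊆ R.biUnion h.bal, (V q.2 : ℝ) := by gcongr; linarith
      _ ≤ ∑ q ∈ Q with h.bal q ⊆ R.biUnion h.bal, ∑ x ∈ h.bal q, F x := by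
        rw [Finset.mul_sum]
        exact Finset.sum_le_sum fun q hq => (hQP' q (Finset.mem_filter.1 hq).1).2.2
      _ ≤ ∑ q ∈ R, ∑ x ∈ h.bal q, F x := h.sum_filter_le_sum hF hQ (Finset.filter_subset _ _) hR
        fun q hq => (Finset.mem_filter.1 hq).2
      _ ≤ α * ∑ q ∈ R, (V q.2 : ℝ) := by
        rw [Finset.mul_sum]
        refine Finset.sum_le_sum fun q hq => ?_
        obtain ⟨p, hp, m, hm, rfl⟩ := hRP q hq
        exact hinf p hp m hm
  rw [div_mul_eq_mul_div, div_le_iff₀ hpos]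
  calc β * ∑ p ∈ P, (V p.2 : ℝ) ≤ β * ((1 + ε) * ∑ q ∈ Q, (V q.2 : ℝ)) := by gcongr
    _ = (1 + ε) * (β * ∑ q ∈ Q, (V q.2 : ℝ)) := by ring
    _ ≤ (1 + ε) * ((α + β * ε) * ∑ q ∈ R, (V q.2 : ℝ)) :=
      mul_le_mul_of_nonneg_left (by linarith) (by positivity)
    _ = _ := by ring

/-- If around every point of `E` there are `n` successive pairs of batches of balls, alternately
with large and with small averages of `F`, then disjoint balls centred in `E` occupy a set which is
exponentially larger than `E`. -/
theorem exists_disjoint_family [Nonempty G] (h : IsWordMetric δ V) (h0 : V 0 = 1) {α β : ℝ}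
    (hα : 0 < α) (hαβ : α < β) :
    ∃ (L M : ℕ) (c : ℝ), 1 ≤ M ∧ 1 < c ∧ ∀ F : G → ℝ, (∀ x, 0 ≤ F x) →
      ∀ (E : Finset G) (n R : ℕ) (r : ℕ → G → ℕ → ℕ),
      (∀ g ∈ E, ∀ t < 2 * n, ∀ m < M, r t g m ≤ R) →
      (∀ g ∈ E, ∀ t < 2 * n, ∀ m m', m < m' → m' < M → L * r t g m ≤ r t g m') →
      (∀ g ∈ E, ∀ t t', t < t' → t' < 2 * n → ∀ m < M, ∀ m' < M, r t g m ≤ r t' g m') →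
      (∀ g ∈ E, ∀ t < 2 * n, Even t → ∀ m < M,
        β * V (r t g m) ≤ ∑ x ∈ h.bal (g, r t g m), F x) →
      (∀ g ∈ E, ∀ t < 2 * n, Odd t → ∀ m < M,
        ∑ x ∈ h.bal (g, r t g m), F x ≤ α * V (r t g m)) →
      ∃ Q : Finset (G × ℕ), (∀ q ∈ Q, q.1 ∈ E ∧ q.2 ≤ R) ∧
        (Q : Set (G × ℕ)).PairwiseDisjoint h.bal ∧
        (E.card : ℝ) * c ^ n ≤ ∑ q ∈ Q, (V q.2 : ℝ) := by
  classical
  obtain ⟨L, M, c, hM, hc, hstep⟩ := h.exists_double_step hα hαβ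
  refine ⟨L, M, c, hM, hc, fun F hF E n R r hR hL hr hsup hinf => ?_⟩
  have key : ∀ k ≤ n, ∃ Q : Finset (G × ℕ), (∀ q ∈ Q, q.1 ∈ E ∧ q.2 ≤ R ∧
      ∀ t, 2 * k ≤ t → t < 2 * n → ∀ m < M, q.2 ≤ r t q.1 m) ∧
      (Q : Set (G × ℕ)).PairwiseDisjoint h.bal ∧
      (E.card : ℝ) * c ^ k ≤ ∑ q ∈ Q, (V q.2 : ℝ) := by
    intro k
    induction k with
    | zero =>
      intro _
      refine ⟨E.image fun g => (g, 0), ?_, ?_, ?_⟩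
      · intro q hq
        obtain ⟨g, hg, rfl⟩ := Finset.mem_image.1 hq
        exact ⟨hg, Nat.zero_le _, fun _ _ _ _ _ => Nat.zero_le _⟩
      · have hsing : ∀ g : G, h.bal (g, 0) = {g} := by
          intro g
          obtain ⟨a, ha⟩ := Finset.card_eq_one.1 ((h.card_bal (g, 0)).trans h0)
          have := h.center_mem_bal (g, 0)
          rw [ha, Finset.mem_singleton] at this
          rw [ha, ← this]
        intro p hp q hq hpq
        obtain ⟨a, -, rfl⟩ := Finset.mem_image.1 hp
        obtain ⟨b, -, rfl⟩ := Finset.mem_image.1 hq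
        simp only [Function.onFun, hsing, Finset.disjoint_singleton]
        rintro rfl
        exact hpq rfl
      · rw [Finset.sum_image fun a _ b _ hab => (Prod.ext_iff.1 hab).1]
        simp [h0]
    | succ k ih =>
      intro hk
      obtain ⟨P, hPE, hP, hcard⟩ := ih (by omega)
      obtain ⟨Q, hQP, hQ, hle⟩ := hstep F hF P (r (2 * k)) (r (2 * k + 1)) hP
        (fun p hp => (hPE p hp).2.2 _ le_rfl (by omega))
        (fun p hp => hL _ (hPE p hp).1 _ (by omega))
        (fun p hp => hL _ (hPE p hp).1 _ (by omega))
        (fun p hp => hr _ (hPE p hp).1 _ _ (by omega) (by omega))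
        (fun p hp => hsup _ (hPE p hp).1 _ (by omega) (even_two_mul k))
        (fun p hp => hinf _ (hPE p hp).1 _ (by omega) (odd_two_mul_add_one k))
      refine ⟨Q, ?_, hQ, ?_⟩
      · intro q hq
        obtain ⟨p, hp, m, hm, rfl⟩ := hQP q hq
        have hpE := (hPE p hp).1
        exact ⟨hpE, hR _ hpE _ (by omega) _ hm, fun t ht htn m' hm' =>
          hr _ hpE _ _ (by omega) htn m hm m' hm'⟩
      · refine le_trans ?_ hle
        rw [pow_succ, ← mul_assoc, mul_comm _ c]
        gcongr
  obtain ⟨Q, hQE, hQ, hle⟩ := key n le_rfl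
  exact ⟨Q, fun q hq => ⟨(hQE q hq).1, (hQE q hq).2.1⟩, hQ, hle⟩

end IsWordMetric
end Stages

section Separation

theorem exists_separated_index {V : ℕ → ℕ} (hV : Monotone V) (hpos : ∀ k, 0 < V k) {L K : ℕ}
    (hK : ∀ r, V (L * (r + 1)) ≤ K * V r) {α β : ℝ} (hα : 0 < α) (hαβ : α < β) :
    ∃ p : ℕ, 1 ≤ p ∧ ∀ S : ℕ → ℝ, Monotone S → ∀ (N : ℕ) (ι : ℕ → ℕ),
      (∀ a b, a < b → b ≤ N → ι a < ι b) →
      (∀ j ≤ N, Even j → β * V (ι j) ≤ S (ι j)) → (∀ j ≤ N, Odd j → S (ι j) ≤ α * V (ι j)) →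
      ∀ j, j + 2 * p ≤ N → L * ι j ≤ ι (j + 2 * p) := by
  obtain ⟨p, hp⟩ := pow_unbounded_of_one_lt (K : ℝ) ((one_lt_div hα).2 hαβ)
  refine ⟨p + 1, by omega, fun S hS N ι hι hev hodd j hj => ?_⟩
  have hβ : 0 < β := hα.trans hαβ
  have hle : ∀ a b, a ≤ b → b ≤ N → ι a ≤ ι b := fun a b hab hb => by
    rcases hab.eq_or_lt with rfl | hab
    · exact le_rfl
    · exact (hι a b hab hb).le
  have h1 : ∀ j, Even j → j + 1 ≤ N → β / α * V (ι j) ≤ V (ι (j + 1)) := fun j he hj => by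
    rw [div_mul_eq_mul_div, div_le_iff₀ hα, mul_comm _ α]
    exact (hev j (by omega) he).trans
      ((hS (hle _ _ (by omega) hj)).trans (hodd _ hj he.add_one))
  have h2 : ∀ j, j + 2 ≤ N → β / α * V (ι j) ≤ V (ι (j + 2)) := fun j hj => by
    rcases Nat.even_or_odd j with he | ho
    · exact (h1 j he (by omega)).trans (Nat.cast_le.2 (hV (hle _ _ (by omega) hj)))
    · refine le_trans ?_ (h1 (j + 1) ho.add_one hj)
      have : (V (ι j) : ℝ) ≤ V (ι (j + 1)) := Nat.cast_le.2 (hV (hle _ _ (by omega) (by omega)))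
      gcongr
  have h3 : ∀ q j, j + 2 * q ≤ N → (β / α) ^ q * V (ι j) ≤ V (ι (j + 2 * q)) := by
    intro q
    induction q with
    | zero => intro j _; simp
    | succ q ih =>
      intro j hj
      refine le_trans ?_ (h2 (j + 2 * q) (by omega))
      rw [pow_succ', mul_assoc]
      exact mul_le_mul_of_nonneg_left (ih j (by omega)) (by positivity)
  have h4 : V (L * (ι j + 1)) < V (ι (j + 2 * (p + 1))) := by
    have h5 : 0 < (V (ι j) : ℝ) := Nat.cast_pos.2 (hpos _)
    have h6 : (V (L * (ι j + 1)) : ℝ) ≤ K * V (ι j) := by exact_mod_cast hK (ι j)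
    have h7 := h3 p j (by omega)
    have h8 : (V (ι (j + 2 * p)) : ℝ) ≤ V (ι (j + 2 * (p + 1))) :=
      Nat.cast_le.2 (hV (hle _ _ (by omega) hj))
    have h9 : (K : ℝ) * V (ι j) < (β / α) ^ p * V (ι j) := by gcongr
    exact_mod_cast h6.trans_lt (h9.trans_le (h7.trans h8))
  have h5 := hV.reflect_lt h4
  nlinarith

variable {G : Type*} {δ : G → G → ℕ} {V : ℕ → ℕ}

namespace IsWordMetric

/-- A set of points around which the averages of `F` fluctuate `N` times at scales below `R` is
exponentially small in comparison with its `R`-neighbourhood. -/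
theorem exists_card_mul_pow_le [Nonempty G] (h : IsWordMetric δ V) (h0 : V 0 = 1) {α β : ℝ}
    (hα : 0 < α) (hαβ : α < β) :
    ∃ (c : ℝ) (b : ℕ), 1 < c ∧ 1 ≤ b ∧ ∀ F : G → ℝ, (∀ x, 0 ≤ F x) →
      ∀ (E : Finset G) (N R R' : ℕ) (g₀ : G), E ⊆ h.bal (g₀, R') →
      (∀ g ∈ E, ∃ ι : ℕ → ℕ, (∀ a b, a < b → b ≤ N → ι a < ι b) ∧ (∀ j ≤ N, ι j ≤ R) ∧
        (∀ j ≤ N, Even j → β * V (ι j) ≤ ∑ x ∈ h.bal (g, ι j), F x) ∧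
        ∀ j ≤ N, Odd j → ∑ x ∈ h.bal (g, ι j), F x ≤ α * V (ι j)) →
      (E.card : ℝ) * c ^ (N / b) ≤ V (R' + R) := by
  classical
  obtain ⟨L, M, c, hM, hc, hfam⟩ := h.exists_disjoint_family h0 hα hαβ
  obtain ⟨K, hK⟩ := h.doub L
  obtain ⟨p, hp, hsep⟩ := exists_separated_index h.mono h.pos hK hα hαβ
  refine ⟨c, 4 * p * M, hc, by nlinarith, fun F hF E N R R' g₀ hE hfl => ?_⟩
  choose! ι hι hιR hev hodd using hfl
  set n := N / (4 * p * M) with hn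
  have hnN : 4 * p * M * n ≤ N := Nat.mul_div_le _ _
  have hidx : ∀ t < 2 * n, ∀ m < M, 2 * p * (t * M + m) + t % 2 + 1 ≤ 2 * p * ((t + 1) * M) := by
    intro t _ m hm
    have h1 : t % 2 ≤ 1 := by omega
    have h2 : (t * M + m) + 1 ≤ (t + 1) * M := by nlinarith
    have h3 := Nat.mul_le_mul_left (2 * p) h2
    nlinarith
  have hidxN : ∀ t < 2 * n, ∀ m < M, 2 * p * (t * M + m) + t % 2 ≤ N := by
    intro t ht m hm
    have h1 := hidx t ht m hm
    have h2 : 2 * p * ((t + 1) * M) ≤ 2 * p * ((2 * n) * M) := by gcongr; omega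
    have h3 : 2 * p * ((2 * n) * M) = 4 * p * M * n := by ring
    omega
  have hle : ∀ g ∈ E, ∀ a b, a ≤ b → b ≤ N → ι g a ≤ ι g b := fun g hg a b hab hb => by
    rcases hab.eq_or_lt with rfl | hab
    · exact le_rfl
    · exact (hι g hg a b hab hb).le
  have hex : ∃ Q : Finset (G × ℕ), (∀ q ∈ Q, q.1 ∈ E ∧ q.2 ≤ R) ∧
      (Q : Set (G × ℕ)).PairwiseDisjoint h.bal ∧
      (E.card : ℝ) * c ^ n ≤ ∑ q ∈ Q, (V q.2 : ℝ) := by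
    refine hfam F hF E n R (fun t g m => ι g (2 * p * (t * M + m) + t % 2))
      (fun g hg t ht m hm => hιR g hg _ (hidxN t ht m hm)) ?_ ?_ ?_ ?_
    · intro g hg t ht m m' hmm hm'
      have h1 := hidxN t ht m' hm'
      have h2 : 2 * p * (t * M + m) + t % 2 + 2 * p ≤ 2 * p * (t * M + m') + t % 2 := by
        have := Nat.mul_le_mul_left (2 * p) (show t * M + m + 1 ≤ t * M + m' by omega)
        nlinarith
      refine (hsep (fun k => ∑ x ∈ h.bal (g, k), F x) ?_ N (ι g) (hι g hg) (hev g hg)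
        (hodd g hg) _ (h2.trans h1)).trans (hle g hg _ _ h2 h1)
      intro a b hab
      refine Finset.sum_le_sum_of_subset_of_nonneg (fun x hx => ?_) fun x _ _ => hF x
      rw [h.mem_bal] at hx ⊢
      exact hx.trans hab
    · intro g hg t t' htt ht' m hm m' hm'
      refine hle g hg _ _ ?_ (hidxN t' ht' m' hm')
      have h1 := hidx t (htt.trans ht') m hm
      have h2 : 2 * p * ((t + 1) * M) ≤ 2 * p * (t' * M + m') := by
        have : (t + 1) * M ≤ t' * M := Nat.mul_le_mul_right _ htt
        exact Nat.mul_le_mul_left _ (by omega)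
      omega
    · intro g hg t ht he m hm
      refine hev g hg _ (hidxN t ht m hm) ?_
      rw [Nat.even_iff.1 he, add_zero, mul_assoc]
      exact even_two_mul _
    · intro g hg t ht ho m hm
      refine hodd g hg _ (hidxN t ht m hm) ?_
      rw [Nat.odd_iff.1 ho, mul_assoc]
      exact odd_two_mul_add_one _
  obtain ⟨Q, hQE, hQ, hcard⟩ := hex
  refine hcard.trans ?_
  have h1 : ∑ q ∈ Q, V q.2 ≤ V (R' + R) := by
    rw [← h.card_biUnion_bal hQ, ← h.card_bal (g₀, R' + R)]
    refine Finset.card_le_card (Finset.biUnion_subset.2 fun q hq x hx => ?_)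
    have h2 := hE (hQE q hq).1
    have h3 := (hQE q hq).2
    rw [h.mem_bal] at h2 hx ⊢
    have h4 := h.tri x q.1 g₀
    simp only at h2 ⊢
    omega
  exact_mod_cast h1

end IsWordMetric
end Separation

section WordMetric

variable {G : Type*} [Group G] {T : Set G}

/-- The length of `x` with respect to `T`. -/
noncomputable def len (T : Set G) (x : G) : ℕ := sInf {n | x ∈ T ^ n}

theorem len_le_iff (hinv : T⁻¹ = T) (h1 : 1 ∈ T) (hT : Subgroup.closure T = ⊤) {x : G} {n : ℕ} :
    len T x ≤ n ↔ x ∈ T ^ n :=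
  ⟨fun h => Set.pow_subset_pow_right h1 h (Nat.sInf_mem (exists_mem_pow hinv h1 hT x)),
    fun h => Nat.sInf_le h⟩

theorem Growth.isWordMetric {D : ℕ} (hD : Growth T D) (hTf : T.Finite) (hinv : T⁻¹ = T)
    (h1 : 1 ∈ T) (hT : Subgroup.closure T = ⊤) :
    IsWordMetric (fun x y => len T (x * y⁻¹)) fun k => (T ^ k).ncard := by
  have hlen := fun {x : G} {n : ℕ} => len_le_iff hinv h1 hT (x := x) (n := n)
  have hinvlen : ∀ x, len T x⁻¹ ≤ len T x := fun x => by
    rw [hlen, ← Set.mem_inv, ← inv_pow, hinv]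
    exact hlen.1 le_rfl
  have hmul : ∀ x y, len T (x * y) ≤ len T x + len T y := fun x y => by
    rw [hlen, pow_add]
    exact Set.mul_mem_mul (hlen.1 le_rfl) (hlen.1 le_rfl)
  have hball : ∀ g k, {x | len T (x * g⁻¹) ≤ k} = (fun x => x * g) '' (T ^ k) := fun g k => by
    ext x
    rw [Set.mem_ofPred_eq, hlen, image_mul_right, mem_preimage]
  refine ⟨fun x => ?_, fun x y => ?_, fun x y z => ?_, fun g k => ?_, fun g k => ?_,
    fun x y k hk => ?_, fun m => ?_⟩
  · rw [mul_inv_cancel, ← Nat.le_zero, hlen, pow_zero]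
    exact Set.mem_one.2 rfl
  · refine le_antisymm ?_ ?_
    · have := hinvlen (y * x⁻¹)
      rwa [mul_inv_rev, inv_inv] at this
    · have := hinvlen (x * y⁻¹)
      rwa [mul_inv_rev, inv_inv] at this
  · have := hmul (x * y⁻¹) (y * z⁻¹)
    rwa [mul_assoc x, inv_mul_cancel_left] at this
  · rw [hball]
    exact (finite_pow hTf k).image _
  · rw [hball, ncard_image_of_injective _ (mul_left_injective g)]
  · have h2 : x * y⁻¹ ∈ T ^ (len T (x * y⁻¹) - k) * T ^ k := by
      rw [← pow_add, Nat.sub_add_cancel hk]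
      exact hlen.1 le_rfl
    obtain ⟨a, ha, b, hb, hab⟩ := Set.mem_mul.1 h2
    have h3 : len T b ≤ k := hlen.2 hb
    have h4 : len T a ≤ len T (x * y⁻¹) - k := hlen.2 ha
    have h5 := hmul a b
    rw [hab] at h5
    have h6 : x * (b * y)⁻¹ = a := by
      rw [mul_inv_rev, ← mul_assoc, ← hab, mul_inv_cancel_right]
    refine ⟨b * y, ?_, ?_⟩
    · rw [mul_inv_cancel_right]; omega
    · rw [h6]; omega
  · obtain ⟨c, C, hc, hcC⟩ := hD
    have hC : 0 < C := by
      have := hcC 1 le_rfl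
      simp only [Nat.cast_one, one_pow, mul_one] at this
      exact hc.trans_le (this.1.trans this.2)
    refine ⟨⌈C * (2 * (m + 1)) ^ D / c⌉₊ + (T ^ m).ncard, fun r => ?_⟩
    rcases Nat.eq_zero_or_pos r with rfl | hr
    · rw [pow_zero, ← Set.singleton_one, ncard_singleton, zero_add, mul_one, mul_one]
      exact Nat.le_add_left _ _
    have h2 : (T ^ (m * (r + 1))).ncard ≤ (T ^ (2 * (m + 1) * r)).ncard :=
      ncard_le_ncard (Set.pow_subset_pow_right h1 (by nlinarith)) (finite_pow hTf _)
    have h3 := (hcC (2 * (m + 1) * r) (by nlinarith)).2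
    have h4 := (hcC r hr).1
    have h5 : C * (2 * (m + 1)) ^ D / c ≤ (⌈C * (2 * (m + 1)) ^ D / c⌉₊ : ℝ) := Nat.le_ceil _
    have h6 : ((T ^ (2 * (m + 1) * r)).ncard : ℝ) ≤
        C * (2 * (m + 1)) ^ D / c * (T ^ r).ncard := by
      refine h3.trans ?_
      push_cast
      rw [mul_pow, ← mul_assoc]
      calc _ = C * (2 * (m + 1)) ^ D / c * (c * (r : ℝ) ^ D) := by field_simp
        _ ≤ _ := by gcongr
    have h7 : ((T ^ (m * (r + 1))).ncard : ℝ) ≤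
        (⌈C * (2 * (m + 1)) ^ D / c⌉₊ + (T ^ m).ncard : ℝ) * (T ^ r).ncard := by
      calc ((T ^ (m * (r + 1))).ncard : ℝ) ≤ (T ^ (2 * (m + 1) * r)).ncard := Nat.cast_le.2 h2
        _ ≤ _ := h6
        _ ≤ _ := by gcongr; exact h5.trans (le_add_of_nonneg_right (Nat.cast_nonneg _))
    exact_mod_cast h7

end WordMetric

section WordBall

variable {G : Type*} [Group G] {S : Finset G} {T : Set G}

/-- The symmetrization of `S`, with the identity added. -/
def symmGen (S : Finset G) : Set G := (S : Set G) ∪ (S : Set G)⁻¹ ∪ {1}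

theorem exists_list_iff_mem_pow {γ : G} {n : ℕ} :
    (∃ l : List (G × ℤ), (∀ p ∈ l, p.1 ∈ S) ∧ (l.map fun p => p.1 ^ p.2).prod = γ ∧
      (l.map fun p => p.2.natAbs).sum ≤ n) ↔ γ ∈ symmGen S ^ n := by
  have h1 : (1 : G) ∈ symmGen S := Or.inr rfl
  constructor
  · rintro ⟨l, hl, rfl, hn⟩
    refine Set.pow_subset_pow_right h1 hn ?_
    clear hn
    induction l with
    | nil => simp
    | cons p l ih =>
      simp only [List.map_cons, List.prod_cons, List.sum_cons, pow_add]
      refine Set.mul_mem_mul ?_ (ih fun q hq => hl q (List.mem_cons_of_mem _ hq))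
      have hp := hl p List.mem_cons_self
      rcases Int.natAbs_eq p.2 with h | h
      · rw [h, zpow_natCast, Int.natAbs_natCast]
        exact Set.pow_mem_pow (Or.inl (Or.inl hp))
      · rw [h, zpow_neg, zpow_natCast, Int.natAbs_neg, Int.natAbs_natCast, ← inv_pow]
        refine Set.pow_mem_pow (Or.inl (Or.inr ?_))
        rwa [Set.mem_inv, inv_inv]
  · intro h
    induction n generalizing γ with
    | zero =>
      rw [pow_zero, Set.mem_one] at h
      exact ⟨[], by simp, by simp [h], by simp⟩
    | succ n ih =>
      rw [pow_succ] at h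
      obtain ⟨a, ha, t, ht, rfl⟩ := Set.mem_mul.1 h
      obtain ⟨l, hl, rfl, hn⟩ := ih ha
      rcases ht with (ht | ht) | ht
      · refine ⟨l ++ [(t, 1)], ?_, by simp, by simpa using hn⟩
        simpa [or_imp, forall_and] using ⟨fun a b hab => hl (a, b) hab, ht⟩
      · refine ⟨l ++ [(t⁻¹, -1)], ?_, by simp, by simpa using hn⟩
        simpa [or_imp, forall_and] using ⟨fun a b hab => hl (a, b) hab, ht⟩
      · rw [Set.mem_singleton_iff.1 ht, mul_one]
        exact ⟨l, hl, rfl, hn.trans (Nat.le_succ n)⟩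

theorem inv_symmGen : (symmGen S)⁻¹ = symmGen S := by
  rw [symmGen, Set.union_inv, Set.union_inv, inv_inv, Set.inv_singleton, inv_one,
    Set.union_comm (S : Set G)]

theorem closure_symmGen (hS : Subgroup.closure (S : Set G) = ⊤) :
    Subgroup.closure (symmGen S) = ⊤ := by
  rw [eq_top_iff, ← hS]
  exact Subgroup.closure_mono fun x hx => Or.inl (Or.inl hx)

theorem finite_symmGen : (symmGen S).Finite :=
  (S.finite_toSet.union S.finite_toSet.inv).union (Set.finite_singleton 1)

theorem one_mem_symmGen : (1 : G) ∈ symmGen S := Or.inr rfl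

theorem wordBall_one (hS : Subgroup.closure (S : Set G) = ⊤) (k : ℕ) :
    wordBall S 1 (k : ℝ) = symmGen S ^ k := by
  ext y
  have hiff : wordNorm S (1 * y⁻¹) ≤ k ↔ y⁻¹ ∈ symmGen S ^ k := by
    rw [one_mul, ← exists_list_iff_mem_pow]
    constructor
    · intro h
      obtain ⟨n, hn⟩ := exists_mem_pow inv_symmGen one_mem_symmGen (closure_symmGen hS) y⁻¹
      obtain ⟨l, h1, h2, -⟩ := exists_list_iff_mem_pow.2 hn
      have hne : {n | ∃ l : List (G × ℤ), (∀ p ∈ l, p.1 ∈ S) ∧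
        (l.map fun p => p.1 ^ p.2).prod = y⁻¹ ∧ (l.map fun p => p.2.natAbs).sum = n}.Nonempty :=
        ⟨_, l, h1, h2, rfl⟩
      obtain ⟨l, h1, h2, h3⟩ := Nat.sInf_mem hne
      exact ⟨l, h1, h2, h3.trans_le h⟩
    · rintro ⟨l, h1, h2, h3⟩
      refine le_trans (Nat.sInf_le ?_) h3
      exact ⟨l, h1, h2, rfl⟩
  rw [wordBall, Set.mem_ofPred_eq, Nat.cast_le, hiff, ← Set.mem_inv, ← inv_pow, inv_symmGen]

theorem PG.of_ncard_pow_le (hinv : T⁻¹ = T) (h1 : 1 ∈ T) (hTf : T.Finite)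
    (hT : Subgroup.closure T = ⊤) {C : ℝ} (hC : 0 ≤ C) {d : ℕ}
    (h : ∀ k : ℕ, ((T ^ k).ncard : ℝ) ≤ C * ((k : ℝ) ^ d + 1)) : PG d G := by
  intro A hA
  obtain ⟨m, hm⟩ : ∃ m, A ⊆ T ^ m := by
    choose n hn using exists_mem_pow hinv h1 hT
    obtain ⟨m, hm⟩ := (hA.image n).bddAbove
    exact ⟨m, fun a ha => Set.pow_subset_pow_right h1 (hm (mem_image_of_mem _ ha)) (hn a)⟩
  refine ⟨C * ((m : ℝ) ^ d + 1), fun n => ?_⟩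
  have hle : (A ^ n).ncard ≤ (T ^ (m * n)).ncard := by
    rw [pow_mul]
    refine ncard_le_ncard (Set.pow_subset_pow_left hm) ?_
    rw [← pow_mul]
    exact finite_pow hTf _
  calc ((A ^ n).ncard : ℝ) ≤ (T ^ (m * n)).ncard := Nat.cast_le.2 hle
    _ ≤ C * (((m * n : ℕ) : ℝ) ^ d + 1) := h _
    _ ≤ C * ((m : ℝ) ^ d * ((n : ℝ) + 1) ^ d + 1 * ((n : ℝ) + 1) ^ d) := by
      push_cast
      rw [mul_pow, one_mul]
      gcongr
      · linarith
      · exact one_le_pow₀ (by linarith [(Nat.cast_nonneg n : (0 : ℝ) ≤ n)])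
    _ = _ := by ring

end WordBall

section Transference

variable {G : Type*} [Group G] {T : Set G}

theorem measurableSet_fluct_le {X : Type*} [MeasurableSpace X] {a : ℕ → X → ℝ}
    (ha : ∀ k, Measurable (a k)) (α β : ℝ) (N m : ℕ) :
    MeasurableSet {x | ∃ i : Fin (N + 1) → ℕ, StrictMono i ∧ (∀ j, 1 ≤ i j) ∧ (∀ j, i j ≤ m) ∧
      ∀ j : Fin (N + 1), (Odd (j : ℕ) → a (i j) x < α) ∧ (Even (j : ℕ) → β < a (i j) x)} := by
  refine measurableSet_setOfPred.2 (Measurable.exists fun i => ?_)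
  refine measurable_const.and (measurable_const.and (measurable_const.and ?_))
  refine Measurable.forall fun j => ?_
  exact (measurable_const.imp (measurableSet_setOfPred.1 (measurableSet_lt (ha _) measurable_const))).and
    (measurable_const.imp (measurableSet_setOfPred.1 (measurableSet_lt measurable_const (ha _))))

theorem finsum_smul_eq_sum_bal {V : ℕ → ℕ} (hinv : T⁻¹ = T) (h1 : 1 ∈ T) (hTf : T.Finite)
    (hT : Subgroup.closure T = ⊤) (h : IsWordMetric (fun x y => len T (x * y⁻¹)) V)
    (F : G → ℝ) (g : G) (k : ℕ) :
    ∑ᶠ y ∈ T ^ k, F (y * g) = ∑ z ∈ h.bal (g, k), F z := by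
  rw [finsum_mem_eq_finite_toFinset_sum _ (finite_pow hTf k)]
  refine Finset.sum_bij (fun y _ => y * g) ?_ ?_ ?_ ?_
  · intro y hy
    rw [h.mem_bal]
    simpa [len_le_iff hinv h1 hT] using hy
  · intro a _ b _ hab
    exact mul_right_cancel hab
  · intro z hz
    rw [h.mem_bal] at hz
    exact ⟨z * g⁻¹, by simpa [len_le_iff hinv h1 hT] using hz, by simp⟩
  · intros; rfl

universe v in
theorem exists_measure_fluct_le (hinv : T⁻¹ = T) (h1 : 1 ∈ T) (hTf : T.Finite)
    (hT : Subgroup.closure T = ⊤)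
    (h : IsWordMetric (fun x y : G => len T (x * y⁻¹)) fun k => (T ^ k).ncard) {α β : ℝ}
    (hα : 0 < α) (hαβ : α < β) :
    ∃ (c : ℝ) (b K : ℕ), 1 < c ∧ 1 ≤ b ∧
      ∀ (X : Type v) (mX : MeasurableSpace X) (μ : Measure X), IsProbabilityMeasure μ →
      ∀ τ : G → X → X, (∀ g h x, τ (g * h) x = τ g (τ h x)) →
      (∀ g, MeasurePreserving (τ g) μ μ) →
      ∀ f : X → ℝ, Measurable f → (∀ x, 0 ≤ f x) → ∀ N : ℕ,
      μ {x | Fluct (fun k : ℕ => (∑ᶠ g ∈ T ^ k, f (τ g x)) / ((T ^ k).ncard : ℝ)) α β N} ≤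
        ENNReal.ofReal (K / c ^ (N / b)) := by
  classical
  obtain ⟨c, b, hc, hb, hmain⟩ := h.exists_card_mul_pow_le (by simp [← Set.singleton_one]) hα hαβ
  obtain ⟨K, hK⟩ := h.doub 2
  refine ⟨c, b, K, hc, hb, fun X mX μ hμ τ hτ hmp f hf hf0 N => ?_⟩
  have hc0 : 0 < c := zero_lt_one.trans hc
  set a : ℕ → X → ℝ := fun k x => (∑ᶠ g ∈ T ^ k, f (τ g x)) / ((T ^ k).ncard : ℝ) with ha
  have ham : ∀ k, Measurable (a k) := fun k => by
    refine Measurable.div_const ?_ _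
    simp only [finsum_mem_eq_finite_toFinset_sum _ (finite_pow hTf k)]
    exact Finset.measurable_fun_sum _ fun g _ => hf.comp (hmp g).measurable
  set A : ℕ → Set X := fun m => {x | ∃ i : Fin (N + 1) → ℕ, StrictMono i ∧ (∀ j, 1 ≤ i j) ∧
    (∀ j, i j ≤ m) ∧
      ∀ j : Fin (N + 1), (Odd (j : ℕ) → a (i j) x < α) ∧ (Even (j : ℕ) → β < a (i j) x)} with hA
  have hAm : ∀ m, MeasurableSet (A m) := fun m => measurableSet_fluct_le ham α β N m
  have hAmono : Monotone A := by
    rintro m m' hm x ⟨i, h1, h2, h3, h4⟩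
    exact ⟨i, h1, h2, fun j => (h3 j).trans hm, h4⟩
  have hAU : {x | Fluct (fun k => a k x) α β N} = ⋃ m, A m := by
    ext x
    rw [Set.mem_iUnion]
    constructor
    · rintro ⟨i, h1, h2, h3⟩
      exact ⟨i (Fin.last N), i, h1, h2, fun j => h1.monotone (Fin.le_last j), h3⟩
    · rintro ⟨m, i, h1, h2, -, h3⟩
      exact ⟨i, h1, h2, h3⟩
  change μ {x | Fluct (fun k => a k x) α β N} ≤ _
  rw [hAU, hAmono.measure_iUnion]
  refine iSup_le fun m => ?_
  have hV : 0 < ((T ^ m).ncard : ℝ) := Nat.cast_pos.2 (h.pos m)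
  set B := h.bal (1, m) with hB
  have hBc : B.card = (T ^ m).ncard := h.card_bal _
  have hpt : ∀ x, ((B.filter fun g => τ g x ∈ A m).card : ℝ) ≤
      (T ^ m).ncard * (K / c ^ (N / b)) := by
    intro x
    have h2 := hmain (fun z => f (τ z x)) (fun z => hf0 _) (B.filter fun g => τ g x ∈ A m) N m m 1
      (Finset.filter_subset _ _) ?_
    · have h3 : ((T ^ (m + m)).ncard : ℝ) ≤ K * (T ^ m).ncard := by
        exact_mod_cast (h.mono (by omega : m + m ≤ 2 * (m + 1))).trans (hK m)
      rw [← mul_div_assoc, le_div_iff₀ (by positivity)]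
      linarith
    · intro g hg
      obtain ⟨i, hi1, -, hi3, hi4⟩ := (Finset.mem_filter.1 hg).2
      have hsum : ∀ k, a k (τ g x) = (∑ z ∈ h.bal (g, k), f (τ z x)) / ((T ^ k).ncard : ℝ) := by
        intro k
        rw [← finsum_smul_eq_sum_bal hinv h1 hTf hT h fun z => f (τ z x)]
        simp only [ha, hτ]
      have hVpos : ∀ k, 0 < ((T ^ k).ncard : ℝ) := fun k => Nat.cast_pos.2 (h.pos k)
      refine ⟨fun j => if hj : j < N + 1 then i ⟨j, hj⟩ else 0, ?_, ?_, ?_, ?_⟩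
      · intro p q hpq hq
        simp only [dif_pos (show p < N + 1 by omega), dif_pos (show q < N + 1 by omega)]
        exact hi1 hpq
      · intro j hj
        simp only [dif_pos (show j < N + 1 by omega)]
        exact hi3 _
      · intro j hj he
        have := (hi4 ⟨j, by omega⟩).2 he
        rw [hsum, lt_div_iff₀ (hVpos _)] at this
        simpa only [dif_pos (show j < N + 1 by omega)] using this.le
      · intro j hj ho
        have := (hi4 ⟨j, by omega⟩).1 ho
        rw [hsum, div_lt_iff₀ (hVpos _)] at this
        simpa only [dif_pos (show j < N + 1 by omega)] using this.le
  have hInt : ∫⁻ x, ∑ g ∈ B, (A m).indicator (fun _ => (1 : ENNReal)) (τ g x) ∂μ =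
      (T ^ m).ncard * μ (A m) := by
    have hmeas : Measurable ((A m).indicator fun _ => (1 : ENNReal)) :=
      measurable_const.indicator (hAm m)
    rw [lintegral_finsetSum (μ := μ) (f := fun g x => (A m).indicator (fun _ => 1) (τ g x)) B
      fun g _ => hmeas.comp (hmp g).measurable]
    rw [Finset.sum_congr rfl fun g _ => (hmp g).lintegral_comp hmeas]
    rw [Finset.sum_const, hBc, lintegral_indicator_const (hAm m), one_mul, nsmul_eq_mul]
  have hle : ∫⁻ x, ∑ g ∈ B, (A m).indicator (fun _ => (1 : ENNReal)) (τ g x) ∂μ ≤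
      ENNReal.ofReal ((T ^ m).ncard * (K / c ^ (N / b))) := by
    refine (lintegral_mono (g := fun _ => ENNReal.ofReal ((T ^ m).ncard * (K / c ^ (N / b))))
      fun x => ?_).trans (by simp)
    have : ∑ g ∈ B, (A m).indicator (fun _ => (1 : ENNReal)) (τ g x) =
        ((B.filter fun g => τ g x ∈ A m).card : ENNReal) := by
      simp only [Set.indicator_apply, Finset.sum_boole]
    simp only
    rw [this, ← ENNReal.ofReal_natCast]
    exact ENNReal.ofReal_le_ofReal (hpt x)
  rw [hInt, ENNReal.ofReal_mul hV.le, ENNReal.ofReal_natCast] at hle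
  exact (ENNReal.mul_le_mul_iff_right (Nat.cast_ne_zero.2 (h.pos m).ne')
    (ENNReal.natCast_ne_top _)).1 hle

end Transference

end PolyGrowth

universe u

/-- Main theorem: exponential decay of the probability of `N` fluctuations of ergodic
ball averages across `(α,β)`, for measure-preserving actions of a group of polynomial
growth. -/
theorem exponential_decay_of_fluctuations
    (S : Finset Γ) (hS : Subgroup.closure (S : Set Γ) = ⊤)
    (C : ℝ) (hC : 0 < C) (d : ℕ)
    (hgr : ∀ k : ℕ, ((wordBall S 1 (k : ℝ)).ncard : ℝ) ≤ C * ((k : ℝ) ^ d + 1))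
    (α β : ℝ) (hα : 0 < α) (hαβ : α < β) :
    ∃ c₁ c₂ : ℝ, 0 < c₁ ∧ 0 < c₂ ∧ c₂ < 1 ∧
      ∀ (X : Type u) (mX : MeasurableSpace X) (μ : Measure X), IsProbabilityMeasure μ →
      ∀ T : Γ → X → X, (∀ x, T 1 x = x) → (∀ g h x, T (g * h) x = T g (T h x)) →
      (∀ g, MeasurePreserving (T g) μ μ) →
      ∀ f : X → ℝ, Measurable f → (∀ x, 0 ≤ f x) →
      ∀ N : ℕ, 1 ≤ N →
      μ {x | Fluct (fun k : ℕ =>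
          (∑ᶠ g ∈ wordBall S 1 (k : ℝ), f (T g x)) / ((wordBall S 1 (k : ℝ)).ncard : ℝ))
          α β N} < ENNReal.ofReal (c₁ * c₂ ^ N) := by
  have hPG := PolyGrowth.PG.of_ncard_pow_le PolyGrowth.inv_symmGen PolyGrowth.one_mem_symmGen
    PolyGrowth.finite_symmGen (PolyGrowth.closure_symmGen hS) hC.le (d := d)
    fun k => by rw [← PolyGrowth.wordBall_one hS]; exact hgr k
  obtain ⟨D, hD⟩ := hPG.exists_growth PolyGrowth.finite_symmGen PolyGrowth.inv_symmGen
    PolyGrowth.one_mem_symmGen (PolyGrowth.closure_symmGen hS)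
  obtain ⟨c, b, K, hc, hb, hmain⟩ := PolyGrowth.exists_measure_fluct_le PolyGrowth.inv_symmGen
    PolyGrowth.one_mem_symmGen PolyGrowth.finite_symmGen (PolyGrowth.closure_symmGen hS)
    (hD.isWordMetric PolyGrowth.finite_symmGen PolyGrowth.inv_symmGen
      PolyGrowth.one_mem_symmGen (PolyGrowth.closure_symmGen hS)) hα hαβ
  have hc0 : 0 < c := zero_lt_one.trans hc
  have hb0 : (0 : ℝ) < b := by exact_mod_cast hb
  set q : ℝ := c⁻¹ ^ ((b : ℝ)⁻¹) with hq
  have hq0 : 0 < q := Real.rpow_pos_of_pos (inv_pos.2 hc0) _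
  have hq1 : q < 1 := Real.rpow_lt_one (inv_pos.2 hc0).le (inv_lt_one_of_one_lt₀ hc) (inv_pos.2 hb0)
  have hqb : q ^ b = c⁻¹ := Real.rpow_inv_natCast_pow (inv_pos.2 hc0).le (by omega)
  refine ⟨K * c + 1, q, by positivity, hq0, hq1, fun X mX μ hμ T hT1 hT hmp f hf hf0 N hN => ?_⟩
  simp only [PolyGrowth.wordBall_one hS]
  refine (hmain X mX μ hμ T hT hmp f hf hf0 N).trans_lt ?_
  refine (ENNReal.ofReal_lt_ofReal_iff (by positivity)).2 ?_
  have h1 : c⁻¹ ^ (N / b) * c⁻¹ ≤ q ^ N := by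
    calc c⁻¹ ^ (N / b) * c⁻¹ = q ^ (b * (N / b) + b) := by rw [pow_add, pow_mul, hqb]
      _ ≤ q ^ N := pow_le_pow_of_le_one hq0.le hq1.le (by
        have := Nat.div_add_mod N b
        have := Nat.mod_lt N (show 0 < b by omega)
        omega)
  have h2 : (K : ℝ) / c ^ (N / b) = K * c * (c⁻¹ ^ (N / b) * c⁻¹) := by
    rw [inv_pow]; field_simp
  rw [h2, add_mul, one_mul]
  have h3 : (0 : ℝ) ≤ K * c := by positivity
  exact lt_add_of_le_of_pos (mul_le_mul_of_nonneg_left h1 h3) (pow_pos hq0 N)
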